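/- arXiv:2409.08336 — 2 statements merged into one kernel-verified Lean document; each statement's English description precedes it below -/
import Mathlib

section
/- For every natural number m there exists a flag triangulation T of the 3-sphere S³ with more than m vertices such that γ₂(T) > 0 and every 1-simplex of T is contained in a square of T. Consequently, there are infinitely many pairwise non-isomorphic flag triangulations of S³ with positive γ₂ in which every edge is contained in a square. -/
open scoped Classical

noncomputable section

/-- A family of finsets of `V` is an abstract simplicial complex on the vertex set `V`:
it contains the empty set and all singletons, and is closed under taking subsets. -/
def IsComplex {V : Type*} (F : Set (Finset V)) : Prop :=
  ∅ ∈ F ∧ (∀ v : V, ({v} : Finset V) ∈ F) ∧ ∀ σ ∈ F, ∀ τ : Finset V, τ ⊆ σ → τ ∈ F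

/-- `f₀`: the number of vertices (`0`-simplices) of a family of finsets. -/
def fZero {V : Type*} (F : Set (Finset V)) : ℕ := {σ ∈ F | σ.card = 1}.ncard

/-- `f₁`: the number of edges (`1`-simplices) of a family of finsets. -/
def fOne {V : Type*} (F : Set (Finset V)) : ℕ := {σ ∈ F | σ.card = 2}.ncard

/-- `γ₂(T) = 16 - 5·f₀(T) + f₁(T)`, as an integer. -/
def gammaTwo {V : Type*} (F : Set (Finset V)) : ℤ := 16 - 5 * (fZero F : ℤ) + (fOne F : ℤ)

/-- `T` is a flag simplicial complex: every set of vertices that are pairwise joined by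
`1`-simplices of `T` is itself a simplex of `T`. -/
def IsFlag {V : Type*} (F : Set (Finset V)) : Prop :=
  ∀ σ : Finset V, (∀ u ∈ σ, ({u} : Finset V) ∈ F) →
    (∀ u ∈ σ, ∀ w ∈ σ, u ≠ w → ({u, w} : Finset V) ∈ F) → σ ∈ F

/-- The set of neighbours of the vertex `v` (the vertex set of the link of `v`). -/
def nbrs {V : Type*} [DecidableEq V] (F : Set (Finset V)) (v : V) : Set V :=
  {u | u ≠ v ∧ ({u, v} : Finset V) ∈ F}

/-- The vertex set of the double of a complex `F` at a vertex `v`: the neighbours of `v`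
appear once (with tag `true`), while all other vertices distinct from `v` appear in two
copies, tagged by a Boolean. -/
def DblVtx {V : Type*} [DecidableEq V] (F : Set (Finset V)) (v : V) : Type _ :=
  {p : V × Bool // p.1 ≠ v ∧ (p.1 ∈ nbrs F v → p.2 = true)}

/-- The copy-`i` inclusion of a vertex `u ≠ v` of the antistar of `v` into the double:
it fixes the neighbours of `v` and sends every other vertex to its copy `i`. -/
def inclVtx {V : Type*} [DecidableEq V] (F : Set (Finset V)) (v : V) (i : Bool)
    (u : V) (hu : u ≠ v) : DblVtx F v :=
  ⟨(u, if u ∈ nbrs F v then true else i), hu, fun h => if_pos h⟩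

/-- The copy-`i` image in the double of a simplex `σ` of the antistar of `v`. -/
def inclFace {V : Type*} [DecidableEq V] (F : Set (Finset V)) (v : V) (i : Bool)
    (σ : Finset V) (hσ : v ∉ σ) : Finset (DblVtx F v) :=
  σ.attach.image fun u => inclVtx F v i u.1 (fun h => hσ (h ▸ u.2))

/-- The faces of the double `T_v` of `T` at `v`: the images of the simplices of the antistar
of `v` under the two copy inclusions. -/
def doubleFaces {V : Type*} [DecidableEq V] (F : Set (Finset V)) (v : V) :
    Set (Finset (DblVtx F v)) :=
  {ρ | ∃ (i : Bool) (σ : Finset V) (_ : σ ∈ F) (hv : v ∉ σ), ρ = inclFace F v i σ hv}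

/-- `a, b, c, d` form a square in `F`: four distinct vertices with consecutive pairs joined
by `1`-simplices and the two diagonals not simplices (a full subcomplex isomorphic to a
`4`-cycle). -/
def IsSquareIn {V : Type*} [DecidableEq V] (F : Set (Finset V)) (a b c d : V) : Prop :=
  a ≠ b ∧ a ≠ c ∧ a ≠ d ∧ b ≠ c ∧ b ≠ d ∧ c ≠ d ∧
    ({a, b} : Finset V) ∈ F ∧ ({b, c} : Finset V) ∈ F ∧ ({c, d} : Finset V) ∈ F ∧
    ({d, a} : Finset V) ∈ F ∧ ({a, c} : Finset V) ∉ F ∧ ({b, d} : Finset V) ∉ F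

/-- The `1`-simplex `{x, y}` is contained in a square of `F`. -/
def EdgeInSquare {V : Type*} [DecidableEq V] (F : Set (Finset V)) (x y : V) : Prop :=
  ∃ c d, IsSquareIn F x y c d

/-- `K` is a triangulation of the `n`-sphere: a finite geometric simplicial complex in some
Euclidean space whose underlying space is homeomorphic to the unit sphere of `ℝ^(n+1)`. -/
def IsSphereTriangulation (n : ℕ) {N : ℕ}
    (K : Geometry.SimplicialComplex ℝ (EuclideanSpace ℝ (Fin N))) : Prop :=
  K.faces.Finite ∧
    Nonempty (↥K.space ≃ₜ ↥(Metric.sphere (0 : EuclideanSpace ℝ (Fin (n + 1))) 1))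

/-- The abstract simplicial complex associated to a geometric simplicial complex: its
simplices are the vertex sets of the faces, together with the empty simplex. -/
def abstractFaces {N : ℕ} (K : Geometry.SimplicialComplex ℝ (EuclideanSpace ℝ (Fin N))) :
    Set (Finset (EuclideanSpace ℝ (Fin N))) :=
  insert ∅ K.faces

/-- Combinatorial isomorphism of two families of finsets: a bijection between the vertex
sets inducing a bijection between the simplices. -/
def CombIso {X Y : Type*} (F : Set (Finset X)) (G : Set (Finset Y)) : Prop :=
  ∃ e : {x : X // ({x} : Finset X) ∈ F} ≃ {y : Y // ({y} : Finset Y) ∈ G},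
    ∀ σ : Finset {x : X // ({x} : Finset X) ∈ F},
      σ.image Subtype.val ∈ F ↔ σ.image (fun x => (e x).val) ∈ G

/-! ### Realizing a complete simplicial fan as a triangulated sphere -/

/-- `l` is a nonnegative weight function supported on a simplex of `Δ`. -/
def Wt {ι : Type*} (Δ : Set (Finset ι)) (l : ι → ℝ) : Prop :=
  (∀ i, 0 ≤ l i) ∧ ∃ σ ∈ Δ, ∀ i, l i ≠ 0 → i ∈ σ

theorem mem_hull_image {ι E : Type*} [Fintype ι] [DecidableEq E] [AddCommGroup E] [Module ℝ E]
    (v : ι → E) (hv : Function.Injective v) (σ : Finset ι) (x : E) :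
    x ∈ convexHull ℝ ((σ.image v : Finset E) : Set E) ↔
      ∃ l : ι → ℝ, (∀ i, 0 ≤ l i) ∧ (∀ i, l i ≠ 0 → i ∈ σ) ∧ ∑ i, l i = 1 ∧
        ∑ i, l i • v i = x := by
  rw [Finset.mem_convexHull']
  constructor
  · rintro ⟨w, h0, h1, h2⟩
    rw [Finset.sum_image (fun a _ b _ h => hv h)] at h1 h2
    refine ⟨fun i => if i ∈ σ then w (v i) else 0, ?_, ?_, ?_, ?_⟩
    · intro i
      by_cases h : i ∈ σ
      · simpa [h] using h0 _ (Finset.mem_image_of_mem v h)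
      · simp [h]
    · intro i h
      by_contra h'
      simp [h'] at h
    · simpa using h1
    · simpa [ite_smul] using h2
  · rintro ⟨l, h0, hs, h1, h2⟩
    by_cases hne : Nonempty ι
    · have hi := Function.leftInverse_invFun hv
      refine ⟨fun y => l (Function.invFun v y), fun y _ => h0 _, ?_, ?_⟩
      · rw [Finset.sum_image (fun a _ b _ h => hv h)]
        simp only [hi _]
        rw [← h1]
        exact Finset.sum_subset (Finset.subset_univ _) fun i _ h => by
          by_contra h'
          exact h (hs i h')
      · rw [Finset.sum_image (fun a _ b _ h => hv h)]
        simp only [hi _]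
        rw [← h2]
        exact Finset.sum_subset (Finset.subset_univ _) fun i _ h => by
          have : l i = 0 := by
            by_contra h'
            exact h (hs i h')
          simp [this]
    · have := not_nonempty_iff.1 hne
      simp at h1

theorem fan_realization {ι : Type} [Fintype ι] (Δ : Set (Finset ι)) (hΔ : IsComplex Δ)
    (v : ι → EuclideanSpace ℝ (Fin 4))
    (hA : ∀ x, ∃ l : ι → ℝ, Wt Δ l ∧ ∑ i, l i • v i = x)
    (hB : ∀ l m : ι → ℝ, Wt Δ l → Wt Δ m → ∑ i, l i • v i = ∑ i, m i • v i → l = m) :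
    Function.Injective v ∧ ∃ K : Geometry.SimplicialComplex ℝ (EuclideanSpace ℝ (Fin 4)),
      IsSphereTriangulation 3 K ∧ abstractFaces K = (fun σ : Finset ι => σ.image v) '' Δ := by
  obtain ⟨hemp, hsing, hdown⟩ := hΔ
  have hzero : Wt Δ (0 : ι → ℝ) := ⟨fun _ => le_rfl, ∅, hemp, fun i h => absurd rfl h⟩
  have hsingle : ∀ i, Wt Δ (Pi.single i (1 : ℝ)) := fun i =>
    ⟨fun j => by
      by_cases h : j = i
      · subst h; simp
      · simp [h], {i}, hsing i, fun j h => by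
      by_contra h'
      simp at h'
      simp [h'] at h⟩
  have hinj : Function.Injective v := by
    intro i j hij
    have := hB _ _ (hsingle i) (hsingle j) (by
      simp [Pi.single_apply, ite_smul, hij])
    have h2 := congrFun this i
    by_contra hne
    simp [hne] at h2
  have hlin : ∀ σ ∈ Δ, ∀ c : ι → ℝ, (∀ i, c i ≠ 0 → i ∈ σ) → ∑ i, c i • v i = 0 → c = 0 := by
    intro σ hσ c hc h0
    have := hB (fun i => max (c i) 0) (fun i => max (-c i) 0)
      ⟨fun i => le_max_right _ _, σ, hσ, fun i h => hc i (by rintro h'; simp [h'] at h)⟩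
      ⟨fun i => le_max_right _ _, σ, hσ, fun i h => hc i (by rintro h'; simp [h'] at h)⟩
      (by
        rw [← sub_eq_zero, ← Finset.sum_sub_distrib, ← h0]
        refine Finset.sum_congr rfl fun i _ => ?_
        rw [← sub_smul]
        congr 1
        rcases le_total (c i) 0 with h | h
        · rw [max_eq_right h, max_eq_left (by linarith)]; ring
        · rw [max_eq_left h, max_eq_right (by linarith)]; ring)
    funext i
    have h : max (c i) 0 = max (-c i) 0 := congrFun this i
    rcases le_total (c i) 0 with h' | h'
    · rw [max_eq_right h', max_eq_left (by linarith)] at h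
      simp; linarith
    · rw [max_eq_left h', max_eq_right (by linarith)] at h
      simp; linarith
  have hind : ∀ s ∈ (fun σ : Finset ι => σ.image v) '' Δ,
      AffineIndependent ℝ ((↑) : s → EuclideanSpace ℝ (Fin 4)) := by
    rintro _ ⟨σ, hσ, rfl⟩
    apply LinearIndependent.affineIndependent
    have h1 : LinearIndepOn ℝ v (σ : Set ι) := by
      rw [linearIndepOn_finset_iff]
      intro g hg i hi
      have := hlin σ hσ (fun i => if i ∈ σ then g i else 0) (fun i h => by
        by_contra h'; simp [h'] at h) (by simpa [ite_smul] using hg)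
      have := congrFun this i
      simpa [hi] using this
    have h2 := h1.id_image
    rw [← Finset.coe_image] at h2
    exact h2
  let K : Geometry.SimplicialComplex ℝ (EuclideanSpace ℝ (Fin 4)) :=
    Geometry.SimplicialComplex.ofErase ((fun σ : Finset ι => σ.image v) '' Δ) hind
      (by
        rintro _ t hts ⟨σ, hσ, rfl⟩
        obtain ⟨τ, hτ, rfl⟩ := Finset.subset_image_iff.1 hts
        exact ⟨τ, hdown σ hσ τ (by exact_mod_cast hτ), rfl⟩)
      (by
        rintro _ ⟨σ, hσ, rfl⟩ _ ⟨τ, hτ, rfl⟩ x ⟨hx1, hx2⟩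
        obtain ⟨l, l0, ls, l1, lx⟩ := (mem_hull_image v hinj σ x).1 hx1
        obtain ⟨m, m0, ms, m1, mx⟩ := (mem_hull_image v hinj τ x).1 hx2
        have := hB l m ⟨l0, σ, hσ, ls⟩ ⟨m0, τ, hτ, ms⟩ (lx.trans mx.symm)
        subst this
        have h := (mem_hull_image v hinj (σ ∩ τ) x).2
          ⟨l, l0, fun i hi => Finset.mem_inter.2 ⟨ls i hi, ms i hi⟩, l1, lx⟩
        refine convexHull_mono ?_ h
        intro y hy
        simp only [Finset.coe_image, Finset.coe_inter] at hy ⊢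
        exact Set.image_inter_subset _ _ _ hy)
  have hKf : K.faces = ((fun σ : Finset ι => σ.image v) '' Δ) \ {∅} := rfl
  have hab : abstractFaces K = (fun σ : Finset ι => σ.image v) '' Δ := by
    rw [abstractFaces, hKf, Set.insert_sdiff_singleton, Set.insert_eq_of_mem]
    exact ⟨∅, hemp, by simp⟩
  have hfin : K.faces.Finite := by
    rw [hKf]
    exact (Set.Finite.image _ (Set.toFinite Δ)).subset Set.sdiff_subset
  have hsp : ∀ x, x ∈ K.space ↔
      ∃ l : ι → ℝ, Wt Δ l ∧ ∑ i, l i = 1 ∧ ∑ i, l i • v i = x := by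
    intro x
    rw [Geometry.SimplicialComplex.mem_space_iff]
    constructor
    · rintro ⟨s, hs, hx⟩
      rw [hKf] at hs
      obtain ⟨⟨σ, hσ, rfl⟩, -⟩ := hs
      obtain ⟨l, l0, ls, l1, lx⟩ := (mem_hull_image v hinj σ x).1 hx
      exact ⟨l, ⟨l0, σ, hσ, ls⟩, l1, lx⟩
    · rintro ⟨l, ⟨l0, σ, hσ, ls⟩, l1, lx⟩
      have h := (mem_hull_image v hinj σ x).2 ⟨l, l0, ls, l1, lx⟩
      refine ⟨σ.image v, ?_, h⟩
      rw [hKf]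
      refine ⟨⟨σ, hσ, rfl⟩, ?_⟩
      intro h'
      simp only [Set.mem_singleton_iff] at h'
      rw [h'] at h
      simp at h
  have hcomp : IsCompact K.space := by
    unfold Geometry.SimplicialComplex.space
    exact hfin.isCompact_biUnion fun s _ => s.finite_toSet.isCompact_convexHull ℝ
  have hne : ∀ x ∈ K.space, x ≠ 0 := by
    rintro x hx rfl
    obtain ⟨l, hl, l1, lx⟩ := (hsp 0).1 hx
    have := hB l 0 hl hzero (by simpa using lx)
    simp [this] at l1
  have hscale : ∀ (l : ι → ℝ) (c : ℝ), 0 ≤ c → Wt Δ l → Wt Δ (fun i => c * l i) := by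
    rintro l c hc ⟨h0, σ, hσ, h⟩
    exact ⟨fun i => mul_nonneg hc (h0 i), σ, hσ, fun i hi => h i (right_ne_zero_of_mul hi)⟩
  have hscs : ∀ (l : ι → ℝ) (c : ℝ), ∑ i, (c * l i) • v i = c • ∑ i, l i • v i := by
    intro l c
    rw [Finset.smul_sum]
    exact Finset.sum_congr rfl fun i _ => by rw [smul_smul]
  let f : K.space → Metric.sphere (0 : EuclideanSpace ℝ (Fin (3 + 1))) 1 := fun x =>
    ⟨‖x.1‖⁻¹ • x.1, by
      have := norm_ne_zero_iff.2 (hne x.1 x.2)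
      simp [norm_smul, this]⟩
  have hfc : Continuous f := by
    refine Continuous.subtype_mk ?_ _
    refine Continuous.smul (Continuous.inv₀ (continuous_norm.comp continuous_subtype_val) ?_) continuous_subtype_val
    intro x
    exact norm_ne_zero_iff.2 (hne x.1 x.2)
  have hfi : Function.Injective f := by
    rintro ⟨x, hx⟩ ⟨y, hy⟩ hxy
    have hxy' : ‖x‖⁻¹ • x = ‖y‖⁻¹ • y := congrArg Subtype.val hxy
    obtain ⟨l, hl, l1, lx⟩ := (hsp x).1 hx
    obtain ⟨m, hm, m1, my⟩ := (hsp y).1 hy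
    have := hB _ _ (hscale l ‖x‖⁻¹ (by positivity) hl) (hscale m ‖y‖⁻¹ (by positivity) hm)
      (by rw [hscs, hscs, lx, my, hxy'])
    have hs := congrArg (fun g : ι → ℝ => ∑ i, g i) this
    simp only [← Finset.mul_sum, l1, m1, mul_one] at hs
    rw [hs] at hxy'
    have hy0 : ‖y‖⁻¹ ≠ 0 := inv_ne_zero (norm_ne_zero_iff.2 (hne y hy))
    exact Subtype.ext (smul_right_injective _ hy0 hxy')
  have hfs : Function.Surjective f := by
    rintro ⟨s, hs⟩
    have hs1 : ‖s‖ = 1 := by simpa using hs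
    obtain ⟨l, hl, lx⟩ := hA s
    have hpos : 0 < ∑ i, l i := by
      refine lt_of_le_of_ne (Finset.sum_nonneg fun i _ => hl.1 i) ?_
      intro h
      have h' := (Finset.sum_eq_zero_iff_of_nonneg (fun i _ => hl.1 i)).1 h.symm
      have : s = 0 := by
        rw [← lx]
        exact Finset.sum_eq_zero fun i hi => by rw [h' i hi, zero_smul]
      simp [this] at hs1
    have hmem : (∑ i, l i)⁻¹ • s ∈ K.space := by
      rw [hsp]
      refine ⟨_, hscale l (∑ i, l i)⁻¹ (inv_nonneg.2 hpos.le) hl, ?_, ?_⟩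
      · rw [← Finset.mul_sum]; exact inv_mul_cancel₀ hpos.ne'
      · rw [hscs, lx]
    refine ⟨⟨_, hmem⟩, Subtype.ext ?_⟩
    change ‖(∑ i, l i)⁻¹ • s‖⁻¹ • (∑ i, l i)⁻¹ • s = s
    rw [norm_smul, hs1, mul_one, norm_inv, inv_inv, Real.norm_of_nonneg hpos.le, smul_smul,
      mul_inv_cancel₀ hpos.ne', one_smul]
  have : CompactSpace K.space := isCompact_iff_compactSpace.1 hcomp
  refine ⟨hinj, K, ⟨hfin, ⟨?_⟩⟩, hab⟩
  exact Continuous.homeoOfEquivCompactToT2 (f := Equiv.ofBijective f ⟨hfi, hfs⟩) hfc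

/-! ### The wedge: integer tables -/

/-- Adjacency bitmasks of the wedge. -/
def wedgeMask : Fin 11 → ℕ :=
  ![762, 885, 1402, 1461, 911, 1231, 1959, 1913, 1758, 467, 492]

/-- Adjacency in the wedge. -/
def wAdj (a b : Fin 11) : Bool := (wedgeMask a).testBit b

/-- Coordinates of the wedge vertices. -/
def vz : Fin 11 → Fin 4 → ℤ :=
  ![![0, 0, 1, 0],
    ![0, 0, 0, 1],
    ![0, 0, -1, 0],
    ![0, 0, 0, -1],
    ![1, 0, 0, 0],
    ![0, 1, 0, 0],
    ![1, 1, 0, 2],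
    ![1, 1, 0, 1],
    ![2, 1, -1, -1],
    ![2, 1, 0, 2],
    ![1, 1, -1, 1]]

/-- Heights exhibiting the wedge as a regular fan. -/
def hz : Fin 11 → ℤ := ![0, 0, 15, 4, 0, 0, -21, -19, -9, -22, -5]

/-- The facets of the wedge. -/
def fac : Fin 25 → Fin 4 → Fin 11 :=
  ![![0, 1, 4, 9],
    ![0, 1, 5, 6],
    ![0, 1, 6, 9],
    ![0, 3, 4, 7],
    ![0, 3, 5, 7],
    ![0, 4, 7, 9],
    ![0, 5, 6, 7],
    ![0, 6, 7, 9],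
    ![1, 2, 4, 8],
    ![1, 2, 5, 6],
    ![1, 2, 6, 8],
    ![1, 4, 8, 9],
    ![1, 6, 8, 9],
    ![2, 3, 4, 8],
    ![2, 3, 5, 10],
    ![2, 3, 8, 10],
    ![2, 5, 6, 10],
    ![2, 6, 8, 10],
    ![3, 4, 7, 8],
    ![3, 5, 7, 10],
    ![3, 7, 8, 10],
    ![4, 7, 8, 9],
    ![5, 6, 7, 10],
    ![6, 7, 8, 9],
    ![6, 7, 8, 10]]

/-- The dual bases of the facets of the wedge. -/
def dz : Fin 25 → Fin 4 → Fin 4 → ℤ :=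
  ![![![0, 0, 1, 0], ![0, -2, 0, 1], ![1, -2, 0, 0], ![0, 1, 0, 0]],
    ![![0, 0, 1, 0], ![-2, 0, 0, 1], ![-1, 1, 0, 0], ![1, 0, 0, 0]],
    ![![0, 0, 1, 0], ![0, -2, 0, 1], ![-1, 2, 0, 0], ![1, -1, 0, 0]],
    ![![0, 0, 1, 0], ![0, 1, 0, -1], ![1, -1, 0, 0], ![0, 1, 0, 0]],
    ![![0, 0, 1, 0], ![1, 0, 0, -1], ![-1, 1, 0, 0], ![1, 0, 0, 0]],
    ![![0, 0, 1, 0], ![1, 0, 0, -1], ![0, 2, 0, -1], ![0, -1, 0, 1]],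
    ![![0, 0, 1, 0], ![-1, 1, 0, 0], ![-1, 0, 0, 1], ![2, 0, 0, -1]],
    ![![0, 0, 1, 0], ![-1, 0, 0, 1], ![0, 2, 0, -1], ![1, -1, 0, 0]],
    ![![0, 1, 0, 1], ![0, -1, -1, 0], ![1, -2, 0, 0], ![0, 1, 0, 0]],
    ![![-2, 0, 0, 1], ![0, 0, -1, 0], ![-1, 1, 0, 0], ![1, 0, 0, 0]],
    ![![3, -5, 0, 1], ![-1, 1, -1, 0], ![-1, 2, 0, 0], ![1, -1, 0, 0]],
    ![![0, -2, -3, 1], ![1, -2, 0, 0], ![0, 0, -1, 0], ![0, 1, 1, 0]],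
    ![![0, -2, -3, 1], ![-1, 2, 0, 0], ![0, 0, -1, 0], ![1, -1, 1, 0]],
    ![![0, -1, -1, 0], ![0, -1, 0, -1], ![1, -2, 0, 0], ![0, 1, 0, 0]],
    ![![-1, 0, -1, 0], ![1, 0, 0, -1], ![-1, 1, 0, 0], ![1, 0, 0, 0]],
    ![![0, -1, -1, 0], ![-2, 3, 0, -1], ![1, -1, 0, 0], ![-1, 2, 0, 0]],
    ![![-2, 0, -1, 1], ![-1, 1, 0, 0], ![-1, 0, 0, 1], ![2, 0, 0, -1]],
    ![![2, -4, -1, 1], ![2, -3, 0, 1], ![1, -1, 0, 0], ![-3, 5, 0, -1]],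
    ![![0, 1, 2, -1], ![1, -1, 1, 0], ![0, 1, 1, 0], ![0, 0, -1, 0]],
    ![![1, 0, 0, -1], ![-1, 1, 0, 0], ![1, 0, 1, 0], ![0, 0, -1, 0]],
    ![![-2, 3, 0, -1], ![0, 1, 1, 0], ![1, -1, 0, 0], ![-1, 1, -1, 0]],
    ![![1, 0, 3, -1], ![0, 2, 3, -1], ![0, 0, -1, 0], ![0, -1, -2, 1]],
    ![![-1, 1, 0, 0], ![-1, 0, 0, 1], ![2, 0, 1, -1], ![0, 0, -1, 0]],
    ![![-1, 0, -3, 1], ![0, 2, 3, -1], ![0, 0, -1, 0], ![1, -1, 1, 0]],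
    ![![2, -3, 0, 1], ![-2, 4, 1, -1], ![1, -1, 0, 0], ![-1, 1, -1, 0]]]

/-- The covectors of the facets. -/
def az : Fin 25 → Fin 4 → ℤ :=
  ![![0, -22, 0, 0],
    ![-21, 0, 0, 0],
    ![-1, -20, 0, 0],
    ![0, -15, 0, -4],
    ![-15, 0, 0, -4],
    ![0, -16, 0, -3],
    ![-17, 0, 0, -2],
    ![-1, -16, 0, -2],
    ![0, -24, -15, 0],
    ![-21, 0, -15, 0],
    ![-3, -18, -15, 0],
    ![0, -22, -13, 0],
    ![-1, -20, -13, 0],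
    ![0, -28, -15, -4],
    ![-16, 0, -15, -4],
    ![-12, -4, -15, -4],
    ![-19, 0, -15, -1],
    ![-6, -13, -15, -1],
    ![0, -15, -2, -4],
    ![-15, 0, -14, -4],
    ![-12, -3, -14, -4],
    ![0, -16, -4, -3],
    ![-17, 0, -14, -2],
    ![-1, -16, -7, -2],
    ![-8, -9, -14, -2]]

/-- The neighbouring facets. -/
def nbz : Fin 25 → Fin 4 → Fin 25 :=
  ![![11, 5, 2, 0],
    ![9, 6, 2, 1],
    ![12, 7, 0, 1],
    ![18, 5, 4, 3],
    ![19, 6, 3, 4],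
    ![21, 7, 0, 3],
    ![22, 7, 4, 1],
    ![23, 5, 2, 6],
    ![13, 11, 10, 8],
    ![16, 1, 10, 9],
    ![17, 12, 8, 9],
    ![21, 12, 0, 8],
    ![23, 11, 2, 10],
    ![18, 8, 15, 13],
    ![19, 16, 15, 14],
    ![20, 17, 14, 13],
    ![22, 17, 14, 9],
    ![24, 15, 16, 10],
    ![21, 20, 13, 3],
    ![22, 20, 14, 4],
    ![24, 15, 19, 18],
    ![23, 11, 5, 18],
    ![24, 19, 16, 6],
    ![21, 12, 7, 24],
    ![20, 17, 22, 23]]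

/-- Expanded dot product. -/
def dot4 (f g : Fin 4 → ℤ) : ℤ := f 0 * g 0 + f 1 * g 1 + f 2 * g 2 + f 3 * g 3

theorem dz_left : ∀ F i i', dot4 (dz F i) (vz (fac F i')) = if i = i' then 1 else 0 := by
  decide +kernel

theorem dz_right : ∀ F j j',
    dot4 (fun i => dz F i j) (fun i => vz (fac F i) j') = if j = j' then 1 else 0 := by
  decide +kernel

theorem az_lt : ∀ F w, (∃ i, fac F i = w) ∨ dot4 (az F) (vz w) < hz w := by
  decide +kernel

theorem az_eq : ∀ F i, dot4 (az F) (vz (fac F i)) = hz (fac F i) := by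
  decide +kernel

theorem az_nb : ∀ F i,
    (0 < hz (fac F i) - dot4 (az (nbz F i)) (vz (fac F i)) ∧
      ∀ j, az F j - az (nbz F i) j =
        (hz (fac F i) - dot4 (az (nbz F i)) (vz (fac F i))) * dz F i j) ∨
    (dz F i 2 = 0 ∧ dz F i 3 = 0 ∧ 0 ≤ dz F i 0 ∧ 0 ≤ dz F i 1) := by
  decide +kernel

theorem wAdj_symm : ∀ a b, wAdj a b = wAdj b a := by decide +kernel

theorem wAdj_fac : ∀ F i i', i ≠ i' → wAdj (fac F i) (fac F i') = true := by decide +kernel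

theorem wAdj_square : ∀ a b, wAdj a b = true → ∃ c d, a ≠ b ∧ a ≠ c ∧ a ≠ d ∧ b ≠ c ∧ b ≠ d ∧
    c ≠ d ∧ wAdj b c = true ∧ wAdj c d = true ∧ wAdj d a = true ∧ wAdj a c = false ∧
    wAdj b d = false := by decide +kernel

/-- Pruned search through the cliques of the wedge. -/
def chk : List (Fin 11) → ℕ → List (Fin 25) → Bool
  | [], _, Fs => !Fs.isEmpty
  | v :: vs, m, Fs => chk vs m Fs && (!m.testBit v ||
      chk vs (m &&& wedgeMask v) (Fs.filter fun F => decide (∃ i, fac F i = v)))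

theorem chk_sound (vs : List (Fin 11)) : ∀ (m : ℕ) (Fs : List (Fin 25)), chk vs m Fs = true →
    ∀ s : Finset (Fin 11), (∀ a ∈ s, a ∈ vs) → (∀ a ∈ s, m.testBit a = true) →
    (∀ a ∈ s, ∀ b ∈ s, a ≠ b → wAdj a b = true) →
    ∃ F ∈ Fs, ∀ a ∈ s, ∃ i, fac F i = a := by
  induction vs with
  | nil =>
    intro m Fs h s hs _ _
    cases Fs with
    | nil => simp [chk] at h
    | cons F Fs => exact ⟨F, by simp, fun a ha => absurd (hs a ha) (by simp)⟩
  | cons v vs ih =>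
    intro m Fs h s hs hm hc
    rw [chk, Bool.and_eq_true, Bool.or_eq_true] at h
    by_cases hv : v ∈ s
    · rcases h.2 with h2 | h2
      · have := hm v hv
        simp [this] at h2
      · obtain ⟨F, hF, h'⟩ := ih _ _ h2 (s.erase v)
          (fun a ha => by
            have h1 := hs a (Finset.mem_of_mem_erase ha)
            have h3 := Finset.ne_of_mem_erase ha
            simpa [h3] using h1)
          (fun a ha => by
            rw [Nat.testBit_and, hm a (Finset.mem_of_mem_erase ha), Bool.true_and]
            exact hc v hv a (Finset.mem_of_mem_erase ha) (Finset.ne_of_mem_erase ha).symm)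
          (fun a ha b hb => hc a (Finset.mem_of_mem_erase ha) b (Finset.mem_of_mem_erase hb))
        rw [List.mem_filter] at hF
        refine ⟨F, hF.1, fun a ha => ?_⟩
        by_cases hav : a = v
        · subst hav
          simpa using hF.2
        · exact h' a (Finset.mem_erase.2 ⟨hav, ha⟩)
    · exact ih m Fs h.1 s (fun a ha => by
        have h1 := hs a ha
        have h3 : a ≠ v := fun h => hv (h ▸ ha)
        simpa [h3] using h1) hm hc

theorem wAdj_clique (s : Finset (Fin 11)) (hs : ∀ a ∈ s, ∀ b ∈ s, a ≠ b → wAdj a b = true) :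
    ∃ F, ∀ a ∈ s, ∃ i, fac F i = a := by
  have h0 : ∀ a : Fin 11, Nat.testBit 2047 a = true := by decide +kernel
  obtain ⟨F, -, h⟩ := chk_sound (List.finRange 11) 2047 (List.finRange 25)
    (by decide +kernel) s (fun a _ => List.mem_finRange a)
    (fun a _ => h0 a) hs
  exact ⟨F, h⟩

/-! ### The glued complexes -/

/-- The vertices of the complex obtained by gluing `N + 3` wedges cyclically. -/
abbrev VT (N : ℕ) := Fin 4 ⊕ (Fin (N + 3) × Fin 6)

/-- Position in the wedge of the vertices owned by a wedge. -/
def loc : Fin 6 → Fin 11 := ![4, 6, 7, 8, 9, 10]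

/-- Embedding of the wedge as the `k`-th wedge. -/
def emb {N : ℕ} (k : Fin (N + 3)) : Fin 11 → VT N :=
  ![Sum.inl 0, Sum.inl 1, Sum.inl 2, Sum.inl 3, Sum.inr (k, 0), Sum.inr (k + 1, 0),
    Sum.inr (k, 1), Sum.inr (k, 2), Sum.inr (k, 3), Sum.inr (k, 4), Sum.inr (k, 5)]

/-- Adjacency in the glued complex. -/
def tAdj {N : ℕ} : VT N → VT N → Prop
  | Sum.inl i, Sum.inl j => wAdj (i.castLE (by norm_num)) (j.castLE (by norm_num)) = true
  | Sum.inl i, Sum.inr (_, j) => wAdj (i.castLE (by norm_num)) (loc j) = true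
  | Sum.inr (_, i), Sum.inl j => wAdj (loc i) (j.castLE (by norm_num)) = true
  | Sum.inr (k, i), Sum.inr (l, j) => (k = l ∧ wAdj (loc i) (loc j) = true) ∨
      (l = k + 1 ∧ j = 0 ∧ wAdj (loc i) 5 = true) ∨ (k = l + 1 ∧ i = 0 ∧ wAdj 5 (loc j) = true)

theorem succ_ne {N : ℕ} (k : Fin (N + 3)) : k + 1 ≠ k := by
  intro h
  simp at h

theorem succ_succ_ne {N : ℕ} (k : Fin (N + 3)) : k + 1 + 1 ≠ k := by
  intro h
  have : (1 + 1 : Fin (N + 3)) = 0 := by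
    rw [add_assoc] at h
    simpa using h
  have := congrArg Fin.val this
  simp only [Fin.val_add, Fin.val_one', Fin.val_zero] at this
  rw [Nat.mod_eq_of_lt (a := 1) (by omega), Nat.mod_eq_of_lt (by omega)] at this
  omega

theorem emb_injective {N : ℕ} (k : Fin (N + 3)) : Function.Injective (emb k) := by
  have h1 := succ_ne k
  intro a b h
  fin_cases a <;> fin_cases b <;> simp [emb, h1, h1.symm] at h ⊢

theorem tAdj_emb {N : ℕ} (k : Fin (N + 3)) (a b : Fin 11) :
    tAdj (emb k a) (emb k b) ↔ wAdj a b = true := by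
  have h1 := succ_ne k
  have h2 := succ_succ_ne k
  fin_cases a <;> fin_cases b <;>
    simp [emb, tAdj, loc, h1, h1.symm, h2.symm, Fin.castLE] <;> decide

theorem tAdj_symm {N : ℕ} (u w : VT N) (h : tAdj u w) : tAdj w u := by
  rcases u with i | ⟨k, i⟩ <;> rcases w with j | ⟨l, j⟩ <;> simp only [tAdj] at h ⊢
  · rwa [wAdj_symm]
  · rwa [wAdj_symm]
  · rwa [wAdj_symm]
  · rcases h with ⟨h, h'⟩ | ⟨h, h', h''⟩ | ⟨h, h', h''⟩
    · exact Or.inl ⟨h.symm, by rwa [wAdj_symm]⟩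
    · exact Or.inr (Or.inr ⟨h, h', by rwa [wAdj_symm]⟩)
    · exact Or.inr (Or.inl ⟨h, h', by rwa [wAdj_symm]⟩)

theorem emb_inl {N : ℕ} (k : Fin (N + 3)) (i : Fin 4) :
    (Sum.inl i : VT N) = emb k (i.castLE (by norm_num)) := by
  fin_cases i <;> rfl

theorem emb_loc {N : ℕ} (k : Fin (N + 3)) (i : Fin 6) :
    (Sum.inr (k, i) : VT N) = emb k (loc i) := by
  fin_cases i <;> rfl

theorem emb_five {N : ℕ} (k : Fin (N + 3)) : (Sum.inr (k + 1, 0) : VT N) = emb k 5 := rfl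

/-- Every clique of the glued complex lies in a single wedge. -/
theorem clique_wedge {N : ℕ} (s : Finset (VT N))
    (hs : ∀ a ∈ s, ∀ b ∈ s, a ≠ b → tAdj a b) : ∃ k, ∀ a ∈ s, ∃ w, emb k w = a := by
  by_cases h : ∃ k i, i ≠ 0 ∧ Sum.inr (k, i) ∈ s
  · obtain ⟨k, i, hi, hk⟩ := h
    refine ⟨k, fun a ha => ?_⟩
    by_cases hne : Sum.inr (k, i) = a
    · exact ⟨loc i, by rw [← hne, emb_loc]⟩
    have h := hs _ hk a ha hne
    rcases a with j | ⟨l, j⟩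
    · exact ⟨_, (emb_inl k j).symm⟩
    · rcases h with ⟨rfl, -⟩ | ⟨rfl, rfl, -⟩ | ⟨-, h', -⟩
      · exact ⟨_, (emb_loc _ j).symm⟩
      · exact ⟨_, (emb_five k).symm⟩
      · exact absurd h' hi
  · push Not at h
    have h0 : ∀ k i, Sum.inr (k, i) ∈ s → i = 0 := fun k i hk => by
      by_contra hi
      exact h k i hi hk
    by_cases hp : ∃ k, Sum.inr (k, 0) ∈ s
    · obtain ⟨k, hk⟩ := hp
      refine ⟨k, fun a ha => ?_⟩
      rcases a with j | ⟨l, j⟩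
      · exact ⟨_, (emb_inl k j).symm⟩
      · have hj := h0 l j ha
        subst hj
        by_cases hlk : l = k
        · subst hlk
          exact ⟨_, (emb_loc _ 0).symm⟩
        · have h' := hs _ ha _ hk (by simpa using hlk)
          have e1 : wAdj (loc 0) 5 = false := by decide
          have e2 : wAdj 5 (loc 0) = false := by decide
          simp [tAdj, hlk, e1, e2] at h'
    · push Not at hp
      refine ⟨0, fun a ha => ?_⟩
      rcases a with j | ⟨l, j⟩
      · exact ⟨_, (emb_inl _ j).symm⟩
      · have hj := h0 l j ha
        subst hj
        exact absurd ha (hp l)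

theorem clique_facet {N : ℕ} (s : Finset (VT N))
    (hs : ∀ a ∈ s, ∀ b ∈ s, a ≠ b → tAdj a b) :
    ∃ k F, ∀ a ∈ s, ∃ i, emb k (fac F i) = a := by
  obtain ⟨k, hk⟩ := clique_wedge s hs
  obtain ⟨F, hF⟩ := wAdj_clique (Finset.univ.filter fun w => emb k w ∈ s) (by
    intro a ha b hb hab
    simp only [Finset.mem_filter, Finset.mem_univ, true_and] at ha hb
    exact (tAdj_emb k a b).1 (hs _ ha _ hb fun h => hab (emb_injective k h)))
  refine ⟨k, F, fun a ha => ?_⟩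
  obtain ⟨w, rfl⟩ := hk a ha
  obtain ⟨i, rfl⟩ := hF w (by simpa using ha)
  exact ⟨i, rfl⟩

/-- The simplices of the glued complex: the cliques. -/
def tFaces (N : ℕ) : Set (Finset (VT N)) := {s | ∀ a ∈ s, ∀ b ∈ s, a ≠ b → tAdj a b}

theorem tFaces_complex (N : ℕ) : IsComplex (tFaces N) := by
  refine ⟨by simp [tFaces], fun v => ?_, fun σ hσ τ hτ a ha b hb => hσ a (hτ ha) b (hτ hb)⟩
  intro a ha b hb hab
  rw [Finset.mem_singleton] at ha hb
  exact absurd (ha.trans hb.symm) hab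

theorem pair_mem {N : ℕ} (u w : VT N) (h : u ≠ w) :
    ({u, w} : Finset (VT N)) ∈ tFaces N ↔ tAdj u w := by
  constructor
  · intro h'
    exact h' u (by simp) w (by simp) h
  · intro h' a ha b hb hab
    simp only [Finset.mem_insert, Finset.mem_singleton] at ha hb
    rcases ha with rfl | rfl <;> rcases hb with rfl | rfl
    · exact absurd rfl hab
    · exact h'
    · exact tAdj_symm _ _ h'
    · exact absurd rfl hab

theorem tAdj_wedge {N : ℕ} (u w : VT N) (hne : u ≠ w) (h : tAdj u w) :
    ∃ k a b, emb k a = u ∧ emb k b = w ∧ wAdj a b = true := by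
  obtain ⟨k, hk⟩ := clique_wedge {u, w} ((pair_mem u w hne).2 h)
  obtain ⟨a, rfl⟩ := hk u (by simp)
  obtain ⟨b, rfl⟩ := hk w (by simp)
  exact ⟨k, a, b, rfl, rfl, (tAdj_emb k a b).1 h⟩

theorem tSquare {N : ℕ} (u w : VT N) (hne : u ≠ w) (h : tAdj u w) :
    ∃ c d, u ≠ c ∧ u ≠ d ∧ w ≠ c ∧ w ≠ d ∧ c ≠ d ∧ tAdj w c ∧ tAdj c d ∧ tAdj d u ∧
      ¬ tAdj u c ∧ ¬ tAdj w d := by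
  obtain ⟨k, a, b, rfl, rfl, hab⟩ := tAdj_wedge u w hne h
  obtain ⟨c, d, -, h2, h3, h4, h5, h6, h7, h8, h9, h10, h11⟩ := wAdj_square a b hab
  have hi := emb_injective k
  refine ⟨emb k c, emb k d, hi.ne h2, hi.ne h3, hi.ne h4, hi.ne h5, hi.ne h6, ?_, ?_, ?_, ?_, ?_⟩
    <;> simp only [tAdj_emb, *] <;> simp

/-- Oriented edges owned by a wedge. -/
def ownEdges : Finset (Fin 11 × Fin 6) :=
  Finset.univ.filter fun p => wAdj p.1 (loc p.2) = true ∧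
    (p.1.val < 4 ∨ (p.1.val = 4 ∨ p.1.val = 5) ∧ p.2 ≠ 0 ∨ p.1 < loc p.2)

theorem ownEdges_card : ownEdges.card = 31 := by decide +kernel

/-- A proper colouring of the vertices. -/
def col {N : ℕ} : VT N → ℕ
  | Sum.inl i => i
  | Sum.inr (_, j) => 4 + j

theorem col_lt {N : ℕ} (k : Fin (N + 3)) : ∀ p ∈ ownEdges,
    col (emb k p.1) < col (N := N) (Sum.inr (k, p.2)) := by
  have h : ∀ p ∈ ownEdges, (![0, 1, 2, 3, 4, 4, 5, 6, 7, 8, 9] : Fin 11 → ℕ) p.1 < 4 + p.2.val := by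
    decide +kernel
  intro p hp
  have := h p hp
  have e : ∀ a : Fin 11, col (emb k a) = (![0, 1, 2, 3, 4, 4, 5, 6, 7, 8, 9] : Fin 11 → ℕ) a := by
    intro a
    fin_cases a <;> rfl
  rw [e]
  exact this

theorem tEdges (N : ℕ) : 31 * (N + 3) ≤ fOne (tFaces N) := by
  let f : Fin (N + 3) × ownEdges → Finset (VT N) := fun q =>
    {emb q.1 q.2.1.1, Sum.inr (q.1, q.2.1.2)}
  have hf : Function.Injective f := by
    rintro ⟨k, ⟨⟨a, i⟩, hp⟩⟩ ⟨l, ⟨⟨b, j⟩, hq⟩⟩ h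
    have c1 := col_lt k _ hp
    have c2 := col_lt l _ hq
    simp only at c1 c2
    have h' : ({emb k a, Sum.inr (k, i)} : Finset (VT N)) = {emb l b, Sum.inr (l, j)} := h
    have m1 : emb k a ∈ ({emb l b, Sum.inr (l, j)} : Finset (VT N)) := by rw [← h']; simp
    have m2 : Sum.inr (k, i) ∈ ({emb l b, Sum.inr (l, j)} : Finset (VT N)) := by
      rw [← h']; simp
    have m3 : emb l b ∈ ({emb k a, Sum.inr (k, i)} : Finset (VT N)) := by rw [h']; simp
    simp only [Finset.mem_insert, Finset.mem_singleton] at m1 m2 m3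
    have e2 : (Sum.inr (k, i) : VT N) = Sum.inr (l, j) := by
      rcases m2 with m2 | m2
      · exfalso
        rw [← m2] at c2
        rcases m1 with m1 | m1
        · rw [m1, ← m2] at c1
          exact lt_irrefl _ c1
        · rw [m1] at c1
          exact lt_asymm c1 c2
      · exact m2
    have e1 : emb k a = emb l b := by
      rcases m1 with m1 | m1
      · exact m1
      · rw [m1, e2] at c1
        exact absurd c1 (lt_irrefl _)
    simp only [Sum.inr.injEq, Prod.mk.injEq] at e2
    obtain ⟨rfl, rfl⟩ := e2
    have := emb_injective _ e1
    subst this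
    rfl
  have hcard : Fintype.card (Fin (N + 3) × ownEdges) = 31 * (N + 3) := by
    rw [Fintype.card_prod, Fintype.card_fin, Fintype.card_coe, ownEdges_card, mul_comm]
  have hsub : Set.range f ⊆ {σ ∈ tFaces N | σ.card = 2} := by
    rintro _ ⟨⟨k, ⟨⟨a, i⟩, hp⟩⟩, rfl⟩
    have c1 := col_lt k _ hp
    have hne : emb k a ≠ Sum.inr (k, i) := fun h => by
      simp only [h] at c1
      exact lt_irrefl _ c1
    refine ⟨(pair_mem _ _ hne).2 ?_, Finset.card_pair hne⟩
    rw [emb_loc, tAdj_emb]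
    exact (Finset.mem_filter.1 hp).2.1
  rw [← hcard, ← Nat.card_eq_fintype_card, ← Set.ncard_univ, ← Set.ncard_image_of_injective _ hf,
    Set.image_univ]
  exact Set.ncard_le_ncard hsub (Set.toFinite _)

/-! ### Uniqueness of conical representations in a regular fan -/

theorem fan_unique {ι Φ E : Type*} [Fintype ι] [AddCommGroup E] [Module ℝ E]
    (V : ι → E) (S : Φ → ι → Prop) (H : ι → ℝ) (g : Φ → E →ₗ[ℝ] ℝ)
    (h1 : ∀ φ u, S φ u ∨ g φ (V u) < H u) (h2 : ∀ φ u, S φ u → g φ (V u) = H u)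
    (h3 : ∀ φ u, S φ u → ∃ f : E →ₗ[ℝ] ℝ, ∀ u', S φ u' → f (V u') = if u' = u then 1 else 0)
    (l m : ι → ℝ) (l0 : ∀ u, 0 ≤ l u) (m0 : ∀ u, 0 ≤ m u) (φ ψ : Φ)
    (lS : ∀ u, l u ≠ 0 → S φ u) (mS : ∀ u, m u ≠ 0 → S ψ u)
    (he : ∑ u, l u • V u = ∑ u, m u • V u) : l = m := by
  have hle : ∀ φ u, g φ (V u) ≤ H u := fun φ u => by
    rcases h1 φ u with h | h
    · exact (h2 φ u h).le
    · exact h.le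
  have hlin : ∀ (f : E →ₗ[ℝ] ℝ) (w : ι → ℝ), f (∑ u, w u • V u) = ∑ u, w u * f (V u) := by
    intro f w
    simp [map_sum]
  have hS : ∀ (w : ι → ℝ) (χ : Φ), (∀ u, w u ≠ 0 → S χ u) →
      ∑ u, w u * g χ (V u) = ∑ u, w u * H u := by
    intro w χ hw
    refine Finset.sum_congr rfl fun u _ => ?_
    by_cases h : w u = 0
    · simp [h]
    · rw [h2 χ u (hw u h)]
  have hineq : ∀ (w : ι → ℝ) (χ : Φ), (∀ u, 0 ≤ w u) →
      ∑ u, w u * g χ (V u) ≤ ∑ u, w u * H u := fun w χ hw =>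
    Finset.sum_le_sum fun u _ => mul_le_mul_of_nonneg_left (hle χ u) (hw u)
  have e1 : ∑ u, l u * H u = ∑ u, m u * g φ (V u) := by
    rw [← hS l φ lS, ← hlin, ← hlin, he]
  have e2 : ∑ u, m u * H u = ∑ u, l u * g ψ (V u) := by
    rw [← hS m ψ mS, ← hlin, ← hlin, he]
  have e3 : ∑ u, m u * (H u - g φ (V u)) = 0 := by
    have i1 := hineq m φ m0
    have i2 := hineq l ψ l0
    simp only [mul_sub, Finset.sum_sub_distrib]
    linarith
  have hm : ∀ u, m u ≠ 0 → S φ u := by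
    intro u hu
    have := (Finset.sum_eq_zero_iff_of_nonneg
      (fun u _ => mul_nonneg (m0 u) (sub_nonneg.2 (hle φ u)))).1 e3 u (Finset.mem_univ u)
    rcases h1 φ u with h | h
    · exact h
    · rcases mul_eq_zero.1 this with h' | h'
      · exact absurd h' hu
      · linarith
  have hval : ∀ (w : ι → ℝ) (f : E →ₗ[ℝ] ℝ) (u : ι), (∀ u, w u ≠ 0 → S φ u) →
      (∀ u', S φ u' → f (V u') = if u' = u then 1 else 0) → f (∑ u, w u • V u) = w u := by
    intro w f u hw hf
    rw [hlin, Finset.sum_eq_single u]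
    · by_cases h : w u = 0
      · simp [h]
      · rw [hf u (hw u h)]; simp
    · intro u' _ hne
      by_cases h : w u' = 0
      · simp [h]
      · rw [hf u' (hw u' h)]; simp [hne]
    · simp
  funext u
  by_cases hu : S φ u
  · obtain ⟨f, hf⟩ := h3 φ u hu
    rw [← hval l f u lS hf, ← hval m f u hm hf, he]
  · have a1 : l u = 0 := by
      by_contra h
      exact hu (lS u h)
    have a2 : m u = 0 := by
      by_contra h
      exact hu (hm u h)
    rw [a1, a2]

/-! ### A convex polygon with the origin in its interior -/

/-- First coordinates of the vertices of a convex polygon. -/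
def px {N : ℕ} (k : Fin (N + 3)) : ℝ := 2 * (k.val : ℝ) - (N + 2)

/-- Second coordinates of the vertices of a convex polygon. -/
def py {N : ℕ} (k : Fin (N + 3)) : ℝ := px k ^ 2 - 2

/-- The determinant of two consecutive vertices. -/
def pD {N : ℕ} (k : Fin (N + 3)) : ℝ := px k * py (k + 1) - px (k + 1) * py k

/-- The covector of the `k`-th edge at the `j`-th vertex. -/
def pa {N : ℕ} (k j : Fin (N + 3)) : ℝ :=
  (px j * py (k + 1) - py j * px (k + 1) + (px k * py j - py k * px j)) / pD k

theorem px_succ {N : ℕ} (k : Fin (N + 3)) :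
    (px (k + 1) = px k + 2 ∧ (k + 1).val = k.val + 1) ∨
      (px k = N + 2 ∧ px (k + 1) = -(N + 2) ∧ k.val = N + 2 ∧ (k + 1).val = 0) := by
  have h := Fin.val_add_one (n := N + 2) k
  by_cases hk : k = Fin.last (N + 2)
  · right
    rw [if_pos hk] at h
    have h' : k.val = N + 2 := by rw [hk]; rfl
    refine ⟨?_, ?_, h', h⟩
    · rw [px, h']; push_cast; ring
    · rw [px, h]; push_cast; ring
  · left
    rw [if_neg hk] at h
    refine ⟨?_, h⟩
    rw [px, px, h]; push_cast; ring

theorem pD_pos {N : ℕ} (k : Fin (N + 3)) : 0 < pD k := by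
  have hN : (0 : ℝ) ≤ N := Nat.cast_nonneg N
  unfold pD py
  rcases px_succ k with ⟨h, -⟩ | ⟨h, h', -⟩
  · rw [h]
    nlinarith [sq_nonneg (px k + 1)]
  · rw [h, h']
    have : 0 < ((N : ℝ) + 2) * (((N : ℝ) + 2) ^ 2 - 2) := by
      apply mul_pos <;> nlinarith
    nlinarith

theorem pa_self {N : ℕ} (k : Fin (N + 3)) : pa k k = 1 := by
  rw [pa, div_eq_one_iff_eq (pD_pos k).ne', pD]
  ring

theorem pa_succ {N : ℕ} (k : Fin (N + 3)) : pa k (k + 1) = 1 := by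
  rw [pa, div_eq_one_iff_eq (pD_pos k).ne', pD]
  ring

theorem pa_lt {N : ℕ} (k j : Fin (N + 3)) (h1 : j ≠ k) (h2 : j ≠ k + 1) : pa k j < 1 := by
  rw [pa, div_lt_one (pD_pos k), ← sub_pos]
  have key : pD k - (px j * py (k + 1) - py j * px (k + 1) + (px k * py j - py k * px j)) =
      (px (k + 1) - px j) * (px k - px j) * (px (k + 1) - px k) := by
    unfold pD py
    ring
  rw [key]
  have n1 : j.val ≠ k.val := fun h => h1 (Fin.ext h)
  have n2 : j.val ≠ (k + 1).val := fun h => h2 (Fin.ext h)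
  have hj := j.isLt
  rcases px_succ k with ⟨h, hv⟩ | ⟨h, h', hv, hv'⟩
  · rw [hv] at n2
    refine mul_pos ?_ (by linarith)
    rcases lt_or_gt_of_ne n1 with hl | hl
    · have : (j.val : ℝ) + 1 ≤ k.val := by exact_mod_cast hl
      refine mul_pos ?_ ?_
      · rw [h, px, px]; linarith
      · rw [px, px]; linarith
    · have : (k.val : ℝ) + 2 ≤ j.val := by
        have : k.val + 2 ≤ j.val := by omega
        exact_mod_cast this
      refine mul_pos_of_neg_of_neg ?_ ?_
      · rw [h, px, px]; linarith
      · rw [px, px]; linarith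
  · rw [hv'] at n2
    have hN : (0 : ℝ) ≤ N := Nat.cast_nonneg N
    have b1 : (1 : ℝ) ≤ j.val := by
      have : 1 ≤ j.val := by omega
      exact_mod_cast this
    have b2 : (j.val : ℝ) + 1 ≤ N + 2 := by
      have : j.val + 1 ≤ N + 2 := by omega
      exact_mod_cast this
    refine mul_pos_of_neg_of_neg (mul_neg_of_neg_of_pos ?_ ?_) ?_
    · rw [h', px]; linarith
    · rw [h, px]; linarith
    · rw [h, h']; linarith

theorem pa_le {N : ℕ} (k j : Fin (N + 3)) : pa k j ≤ 1 := by
  by_cases h1 : j = k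
  · rw [h1, pa_self]
  by_cases h2 : j = k + 1
  · rw [h2, pa_succ]
  exact (pa_lt k j h1 h2).le

/-! ### The fan of the glued complex -/

/-- Real coordinates of wedge vertices. -/
def vr (w : Fin 11) (j : Fin 4) : ℝ := (vz w j : ℝ)

/-- Placing wedge coordinates in the `k`-th wedge. -/
def pv {N : ℕ} (k : Fin (N + 3)) (y : Fin 4 → ℝ) : Fin 4 → ℝ :=
  ![y 0 * px k + y 1 * px (k + 1), y 0 * py k + y 1 * py (k + 1), y 2, y 3]

/-- Wedge coordinates with respect to the `k`-th wedge. -/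
def cf {N : ℕ} (k : Fin (N + 3)) : Fin 4 → (Fin 4 → ℝ) →ₗ[ℝ] ℝ :=
  ![(pD k)⁻¹ • (py (k + 1) • LinearMap.proj 0 - px (k + 1) • LinearMap.proj 1),
    (pD k)⁻¹ • (px k • LinearMap.proj 1 - py k • LinearMap.proj 0),
    LinearMap.proj 2, LinearMap.proj 3]

theorem cf_pv {N : ℕ} (k : Fin (N + 3)) (y : Fin 4 → ℝ) (j : Fin 4) : cf k j (pv k y) = y j := by
  have h := (pD_pos k).ne'
  fin_cases j
  · simp [cf, pv]
    rw [inv_mul_eq_iff_eq_mul₀ h, pD]; ring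
  · simp [cf, pv]
    rw [inv_mul_eq_iff_eq_mul₀ h, pD]; ring
  · simp [cf, pv]
  · simp [cf, pv]

theorem pv_cf {N : ℕ} (k : Fin (N + 3)) (x : Fin 4 → ℝ) : pv k (fun j => cf k j x) = x := by
  have h := (pD_pos k).ne'
  funext j
  fin_cases j
  · simp [cf, pv]
    field_simp
    rw [pD]; ring
  · simp [cf, pv]
    field_simp
    rw [pD]; ring
  · simp [cf, pv]
  · simp [cf, pv]

theorem cf_sum_pv {N : ℕ} (l k : Fin (N + 3)) (y : Fin 4 → ℝ) :
    cf l 0 (pv k y) + cf l 1 (pv k y) = y 0 * pa l k + y 1 * pa l (k + 1) := by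
  simp [cf, pv, pa]
  ring

/-- Coordinates of the vertices of the glued complex. -/
def tv {N : ℕ} : VT N → Fin 4 → ℝ
  | Sum.inl i => ![0, 0, vr (i.castLE (by norm_num)) 2, vr (i.castLE (by norm_num)) 3]
  | Sum.inr (k, j) => pv k (vr (loc j))

theorem tv_emb {N : ℕ} (k : Fin (N + 3)) (w : Fin 11) : tv (emb k w) = pv k (vr w) := by
  by_cases h5 : w = 5
  · subst h5
    rw [← emb_five]
    simp [tv, pv, loc, vr, vz]
  · fin_cases w
    all_goals first
      | rfl
      | exact absurd rfl h5
      | simp [emb, tv, pv, vr, vz, Fin.castLE]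

/-- Polygon part of the heights. -/
def hP {N : ℕ} : VT N → ℝ
  | Sum.inl _ => 0
  | Sum.inr (_, j) => vr (loc j) 0 + vr (loc j) 1

/-- Wedge part of the heights. -/
def hW {N : ℕ} : VT N → ℝ
  | Sum.inl i => hz (i.castLE (by norm_num))
  | Sum.inr (_, j) => hz (loc j)

theorem hP_emb {N : ℕ} (k : Fin (N + 3)) (w : Fin 11) : hP (emb k w) = vr w 0 + vr w 1 := by
  fin_cases w <;> simp [emb, hP, loc, vr, vz]

theorem hW_emb {N : ℕ} (k : Fin (N + 3)) (w : Fin 11) : hW (emb k w) = hz w := by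
  fin_cases w <;> simp [emb, hW, loc, hz, Fin.castLE]

/-- The wedge part of the covector of a facet. -/
def gW {N : ℕ} (k : Fin (N + 3)) (F : Fin 25) : (Fin 4 → ℝ) →ₗ[ℝ] ℝ :=
  ∑ j, (az F j : ℝ) • cf k j

theorem gW_pv {N : ℕ} (k : Fin (N + 3)) (F : Fin 25) (w : Fin 11) :
    gW k F (pv k (vr w)) = (dot4 (az F) (vz w) : ℤ) := by
  simp [gW, Fin.sum_univ_four, cf_pv, dot4, vr]

theorem hP_gap {N : ℕ} (k : Fin (N + 3)) (u : VT N) (hu : ∀ w, emb k w ≠ u) :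
    0 < hP u - (cf k 0 (tv u) + cf k 1 (tv u)) := by
  rcases u with i | ⟨l, j⟩
  · exact absurd (emb_inl k i).symm (hu _)
  · have hlk : l ≠ k := by
      rintro rfl
      exact hu _ (emb_loc l j).symm
    have a1 := pa_le k l
    have a2 := pa_le k (l + 1)
    simp only [hP, tv, cf_sum_pv]
    by_cases hj : j = 0
    · subst hj
      have hl2 : l ≠ k + 1 := by
        rintro rfl
        exact hu _ (emb_five k).symm
      have := pa_lt k l hlk hl2
      simp [loc, vr, vz]
      linarith
    · have hpos : ∀ j : Fin 6, j ≠ 0 → 0 < vz (loc j) 0 ∧ 0 < vz (loc j) 1 := by decide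
      have h0 : 0 < vr (loc j) 0 := by
        have := (hpos j hj).1
        simpa [vr] using this
      have h1 : 0 < vr (loc j) 1 := by
        have := (hpos j hj).2
        simpa [vr] using this
      by_cases hl2 : l = k + 1
      · have := pa_lt k (l + 1) (by rw [hl2]; exact succ_succ_ne k)
          (by rw [hl2]; exact succ_ne _)
        nlinarith
      · have := pa_lt k l hlk hl2
        nlinarith

/-- Heights and covectors exhibiting the glued fan as a regular fan. -/
theorem exists_scale (N : ℕ) : ∃ M : ℝ, ∀ (k : Fin (N + 3)) (F : Fin 25) (u : VT N),
    (∀ w, emb k w ≠ u) →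
      M * (cf k 0 (tv u) + cf k 1 (tv u)) + gW k F (tv u) < M * hP u + hW u := by
  obtain ⟨M, hM⟩ := (Set.finite_range (fun q : Fin (N + 3) × Fin 25 × VT N =>
    (gW q.1 q.2.1 (tv q.2.2) - hW q.2.2) /
      (hP q.2.2 - (cf q.1 0 (tv q.2.2) + cf q.1 1 (tv q.2.2))))).bddAbove
  refine ⟨M + 1, fun k F u hu => ?_⟩
  have hg := hP_gap k u hu
  have h := hM ⟨(k, F, u), rfl⟩
  simp only at h
  rw [div_le_iff₀ hg] at h
  nlinarith

theorem tFan_unique (N : ℕ) (l m : VT N → ℝ) (hl : Wt (tFaces N) l) (hm : Wt (tFaces N) m)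
    (he : ∑ u, l u • tv u = ∑ u, m u • tv u) : l = m := by
  obtain ⟨M, hM⟩ := exists_scale N
  obtain ⟨l0, σ, hσ, lσ⟩ := hl
  obtain ⟨m0, τ, hτ, mτ⟩ := hm
  obtain ⟨k, F, hF⟩ := clique_facet σ hσ
  obtain ⟨k', G, hG⟩ := clique_facet τ hτ
  refine fan_unique (Φ := Fin (N + 3) × Fin 25) tv
    (fun φ u => ∃ i, emb φ.1 (fac φ.2 i) = u) (fun u => M * hP u + hW u)
    (fun φ => M • (cf φ.1 0 + cf φ.1 1) + gW φ.1 φ.2) ?_ ?_ ?_ l m l0 m0 (k, F) (k', G)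
    (fun u hu => hF u (lσ u hu)) (fun u hu => hG u (mτ u hu)) he
  · rintro ⟨k, F⟩ u
    by_cases hu : ∃ w, emb k w = u
    · obtain ⟨w, rfl⟩ := hu
      rcases az_lt F w with ⟨i, hi⟩ | h
      · exact Or.inl ⟨i, by rw [hi]⟩
      · right
        simp only [LinearMap.add_apply, LinearMap.smul_apply, smul_eq_mul, tv_emb, cf_pv, gW_pv,
          hP_emb, hW_emb]
        have : ((dot4 (az F) (vz w) : ℤ) : ℝ) < hz w := by exact_mod_cast h
        linarith
    · push Not at hu
      right
      simpa [mul_add] using hM k F u hu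
  · rintro ⟨k, F⟩ u ⟨i, rfl⟩
    simp only [LinearMap.add_apply, LinearMap.smul_apply, smul_eq_mul, tv_emb, cf_pv, gW_pv,
      hP_emb, hW_emb, az_eq]
  · rintro ⟨k, F⟩ u ⟨i, rfl⟩
    have hf : ∀ i', (∑ j, (dz F i j : ℝ) • cf k j) (tv (emb k (fac F i'))) =
        if i = i' then 1 else 0 := by
      intro i'
      have h := dz_left F i i'
      have h' : ((dot4 (dz F i) (vz (fac F i')) : ℤ) : ℝ) = if i = i' then 1 else 0 := by
        rw [h]; split_ifs <;> simp
      rw [← h']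
      simp [tv_emb, cf_pv, Fin.sum_univ_four, dot4, vr]
    refine ⟨∑ j, (dz F i j : ℝ) • cf k j, ?_⟩
    rintro _ ⟨i', rfl⟩
    by_cases hii : i = i'
    · subst hii
      rw [hf]; simp
    · rw [if_neg]
      · rw [hf, if_neg hii]
      · intro h
        have a := hf i'
        have b := hf i
        simp only at h
        rw [h, b] at a
        simp [hii] at a

theorem tFan_cover (N : ℕ) (x : Fin 4 → ℝ) :
    ∃ l : VT N → ℝ, Wt (tFaces N) l ∧ ∑ u, l u • tv u = x := by
  obtain ⟨k, hk⟩ := Finite.exists_max (fun k : Fin (N + 3) => cf k 0 x + cf k 1 x)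
  have hx := pv_cf k x
  have hsum : ∀ l, cf l 0 x + cf l 1 x = cf k 0 x * pa l k + cf k 1 x * pa l (k + 1) := by
    intro l
    have := cf_sum_pv l k (fun j => cf k j x)
    rwa [hx] at this
  have c0 : 0 ≤ cf k 0 x := by
    have h := hk (k + 1)
    simp only [hsum, pa_self, pa_succ] at h
    have h' := pa_lt (k + 1) k (succ_ne k).symm (succ_succ_ne k).symm
    nlinarith
  have c1 : 0 ≤ cf k 1 x := by
    obtain ⟨k', rfl⟩ : ∃ k', k = k' + 1 := ⟨k - 1, by simp⟩
    have h := hk k'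
    simp only [hsum, pa_self, pa_succ] at h
    have h' := pa_lt k' (k' + 1 + 1) (succ_succ_ne k') (succ_ne _)
    nlinarith
  obtain ⟨F, hF⟩ := Finite.exists_max (fun F : Fin 25 => ∑ j, (az F j : ℝ) * cf k j x)
  let d : Fin 4 → ℝ := fun i => ∑ j, (dz F i j : ℝ) * cf k j x
  have d0 : ∀ i, 0 ≤ d i := by
    intro i
    rcases az_nb F i with ⟨hp, h⟩ | ⟨h2, h3, h0, h1⟩
    · have hG := hF (nbz F i)
      set c : ℤ := hz (fac F i) - dot4 (az (nbz F i)) (vz (fac F i)) with hc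
      have hp' : (0 : ℝ) < c := by exact_mod_cast hp
      have hd : (c : ℝ) * d i =
          ∑ j, (az F j : ℝ) * cf k j x - ∑ j, (az (nbz F i) j : ℝ) * cf k j x := by
        rw [← Finset.sum_sub_distrib, Finset.mul_sum]
        refine Finset.sum_congr rfl fun j _ => ?_
        have : ((az F j - az (nbz F i) j : ℤ) : ℝ) = ((c * dz F i j : ℤ) : ℝ) := by rw [h j]
        push_cast at this
        rw [← sub_mul, this]
        ring
      have : 0 ≤ (c : ℝ) * d i := by
        rw [hd]
        exact sub_nonneg.2 hG
      exact nonneg_of_mul_nonneg_right this hp'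
    · have h0' : (0 : ℝ) ≤ dz F i 0 := by exact_mod_cast h0
      have h1' : (0 : ℝ) ≤ dz F i 1 := by exact_mod_cast h1
      simp only [d, Fin.sum_univ_four, h2, h3]
      simp only [Int.cast_zero, zero_mul, add_zero]
      positivity
  have hrec : ∑ i, d i • tv (emb k (fac F i)) = x := by
    have hc : ∀ j', ∑ i, d i * vr (fac F i) j' = cf k j' x := by
      intro j'
      have hd : ∀ j, ∑ i, (dz F i j : ℝ) * vr (fac F i) j' = if j = j' then 1 else 0 := by
        intro j
        have h := dz_right F j j'
        have h' : ((dot4 (fun i => dz F i j) (fun i => vz (fac F i) j') : ℤ) : ℝ) =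
            if j = j' then 1 else 0 := by
          rw [h]; split_ifs <;> simp
        rw [← h']
        simp [Fin.sum_univ_four, dot4, vr]
      simp only [d, Finset.sum_mul]
      rw [Finset.sum_comm]
      have : ∀ j, ∑ i, (dz F i j : ℝ) * cf k j x * vr (fac F i) j' =
          if j = j' then cf k j x else 0 := by
        intro j
        have e : ∑ i, (dz F i j : ℝ) * cf k j x * vr (fac F i) j' =
            cf k j x * ∑ i, (dz F i j : ℝ) * vr (fac F i) j' := by
          rw [Finset.mul_sum]
          exact Finset.sum_congr rfl fun i _ => by ring
        rw [e, hd j]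
        simp
      simp [this]
    rw [← hx]
    have : ∀ i, tv (emb k (fac F i)) = pv k (vr (fac F i)) := fun i => tv_emb k _
    simp only [this]
    funext j
    simp only [Finset.sum_apply, Pi.smul_apply, smul_eq_mul]
    simp only [pv, ← hc]
    fin_cases j <;> simp [Fin.sum_univ_four] <;> ring
  refine ⟨fun u => ∑ i, if emb k (fac F i) = u then d i else 0, ⟨fun u => ?_, ?_⟩, ?_⟩
  · refine Finset.sum_nonneg fun i _ => ?_
    split_ifs
    · exact d0 i
    · exact le_rfl
  · refine ⟨Finset.univ.image fun i => emb k (fac F i), ?_, ?_⟩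
    · intro a ha b hb hab
      simp only [Finset.mem_image, Finset.mem_univ, true_and] at ha hb
      obtain ⟨i, rfl⟩ := ha
      obtain ⟨i', rfl⟩ := hb
      rw [tAdj_emb]
      exact wAdj_fac F i i' fun h => hab (by rw [h])
    · intro u hu
      obtain ⟨i, -, hi⟩ := Finset.exists_ne_zero_of_sum_ne_zero hu
      simp only [Finset.mem_image, Finset.mem_univ, true_and]
      refine ⟨i, ?_⟩
      by_contra h
      simp [h] at hi
  · simp only [Finset.sum_smul]
    rw [Finset.sum_comm, ← hrec]
    refine Finset.sum_congr rfl fun i _ => ?_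
    simp [ite_smul]

/-! ### Assembling the theorem -/

theorem fZero_eq {X : Type*} (F : Set (Finset X)) :
    fZero F = Nat.card {x : X // ({x} : Finset X) ∈ F} := by
  have h : {σ ∈ F | σ.card = 1} = (fun x : X => ({x} : Finset X)) '' {x | ({x} : Finset X) ∈ F} := by
    ext σ
    constructor
    · rintro ⟨h1, h2⟩
      obtain ⟨x, rfl⟩ := Finset.card_eq_one.1 h2
      exact ⟨x, h1, rfl⟩
    · rintro ⟨x, hx, rfl⟩
      exact ⟨hx, Finset.card_singleton x⟩
  rw [fZero, h, Set.ncard_image_of_injective _ Finset.singleton_injective]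
  rfl

theorem combIso_fZero {X Y : Type*} (F : Set (Finset X)) (G : Set (Finset Y)) (h : CombIso F G) :
    fZero F = fZero G := by
  obtain ⟨e, -⟩ := h
  rw [fZero_eq, fZero_eq]
  exact Nat.card_congr e

theorem good_exists (m : ℕ) : ∃ K : Geometry.SimplicialComplex ℝ (EuclideanSpace ℝ (Fin 4)),
    IsSphereTriangulation 3 K ∧ IsFlag (abstractFaces K) ∧
      m < fZero (abstractFaces K) ∧ 0 < gammaTwo (abstractFaces K) ∧
      ∀ x y : EuclideanSpace ℝ (Fin 4), x ≠ y →
        ({x, y} : Finset (EuclideanSpace ℝ (Fin 4))) ∈ abstractFaces K →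
        EdgeInSquare (abstractFaces K) x y := by
  let N := m + 5
  let L := (WithLp.linearEquiv 2 ℝ (Fin 4 → ℝ)).symm
  let v : VT N → EuclideanSpace ℝ (Fin 4) := fun u => L (tv u)
  have hv : ∀ l : VT N → ℝ, ∑ u, l u • v u = L (∑ u, l u • tv u) := by
    intro l
    simp [v, map_sum]
  obtain ⟨hinj, K, hK, hF⟩ := fan_realization (tFaces N) (tFaces_complex N) v
    (fun x => by
      obtain ⟨l, hl, hx⟩ := tFan_cover N (L.symm x)
      exact ⟨l, hl, by rw [hv, hx, LinearEquiv.apply_symm_apply]⟩)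
    (fun l l' hl hl' he => by
      rw [hv, hv] at he
      exact tFan_unique N l l' hl hl' (L.injective he))
  have himg : Function.Injective (fun σ : Finset (VT N) => σ.image v) :=
    Finset.image_injective hinj
  have hmem : ∀ σ : Finset (VT N), σ.image v ∈ abstractFaces K ↔ σ ∈ tFaces N := by
    intro σ
    rw [hF]
    exact himg.mem_set_image
  have hpair : ∀ a b : VT N, a ≠ b →
      (({v a, v b} : Finset (EuclideanSpace ℝ (Fin 4))) ∈ abstractFaces K ↔ tAdj a b) := by
    intro a b hab
    rw [← pair_mem a b hab, ← hmem]
    simp [Finset.image_insert]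
  have hrange : ∀ s ∈ abstractFaces K, ∀ x ∈ s, ∃ a, v a = x := by
    intro s hs x hx
    rw [hF] at hs
    obtain ⟨σ, -, rfl⟩ := hs
    obtain ⟨a, -, rfl⟩ := Finset.mem_image.1 hx
    exact ⟨a, rfl⟩
  have hsingle : ∀ x, ({x} : Finset (EuclideanSpace ℝ (Fin 4))) ∈ abstractFaces K ↔
      x ∈ Set.range v := by
    intro x
    constructor
    · intro h
      exact hrange _ h x (by simp)
    · rintro ⟨a, rfl⟩
      have := (hmem {a}).2 ((tFaces_complex N).2.1 a)
      simpa using this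
  have h0 : fZero (abstractFaces K) = 4 + 6 * (N + 3) := by
    rw [fZero_eq]
    have e : {x // ({x} : Finset (EuclideanSpace ℝ (Fin 4))) ∈ abstractFaces K} ≃ Set.range v :=
      Equiv.subtypeEquivRight hsingle
    rw [Nat.card_congr e, Nat.card_congr (Equiv.ofInjective v hinj).symm, Nat.card_eq_fintype_card]
    simp
    ring
  have h1 : 31 * (N + 3) ≤ fOne (abstractFaces K) := by
    refine (tEdges N).trans ?_
    unfold fOne
    rw [← Set.ncard_image_of_injective _ himg]
    refine Set.ncard_le_ncard ?_ ?_
    · rintro _ ⟨σ, ⟨h1, h2⟩, rfl⟩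
      exact ⟨(hmem σ).2 h1, by rw [Finset.card_image_of_injective _ hinj, h2]⟩
    · refine Set.Finite.subset ?_ (Set.sep_subset _ _)
      rw [hF]
      exact (Set.toFinite _).image _
  refine ⟨K, hK, ?_, ?_, ?_, ?_⟩
  · intro s hs hp
    have hr : ∀ x ∈ s, ∃ a, v a = x := fun x hx => (hsingle x).1 (hs x hx)
    have hsv : (Finset.univ.filter fun a => v a ∈ s).image v = s := by
      ext x
      simp only [Finset.mem_image, Finset.mem_filter, Finset.mem_univ, true_and]
      constructor
      · rintro ⟨a, ha, rfl⟩
        exact ha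
      · intro hx
        obtain ⟨a, rfl⟩ := hr x hx
        exact ⟨a, hx, rfl⟩
    rw [← hsv, hmem]
    intro a ha b hb hab
    simp only [Finset.mem_filter, Finset.mem_univ, true_and] at ha hb
    refine (hpair a b hab).1 ?_
    convert hp _ ha _ hb (hinj.ne hab)
  · rw [h0]
    omega
  · unfold gammaTwo
    rw [h0]
    have : ((31 * (N + 3) : ℕ) : ℤ) ≤ fOne (abstractFaces K) := by exact_mod_cast h1
    push_cast at this ⊢
    have hN : (N : ℤ) = m + 5 := by simp [N]
    omega
  · intro x y hxy h
    obtain ⟨a, rfl⟩ := hrange _ h x (by simp)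
    obtain ⟨b, rfl⟩ := hrange _ h y (by simp)
    have hab : a ≠ b := fun h => hxy (by rw [h])
    obtain ⟨c, d, n1, n2, n3, n4, n5, a1, a2, a3, a4, a5⟩ := tSquare a b hab ((hpair a b hab).1 h)
    exact ⟨v c, v d, hxy, hinj.ne n1, hinj.ne n2, hinj.ne n3, hinj.ne n4, hinj.ne n5, h,
      (hpair _ _ n3).2 a1, (hpair _ _ n5).2 a2, (hpair _ _ n2.symm).2 a3,
      fun h => a4 ((hpair _ _ n1).1 h), fun h => a5 ((hpair _ _ n4).1 h)⟩

/-- For every `m` there is a flag triangulation of `S³` with more than `m` vertices, positive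
`γ₂`, and every edge contained in a square; consequently, there are infinitely many pairwise
non-isomorphic flag triangulations of `S³` with these properties. -/
theorem infinitely_many_flag_triangulations_with_squares :
    (∀ m : ℕ, ∃ (N : ℕ) (K : Geometry.SimplicialComplex ℝ (EuclideanSpace ℝ (Fin N))),
      IsSphereTriangulation 3 K ∧ IsFlag (abstractFaces K) ∧
      m < fZero (abstractFaces K) ∧ 0 < gammaTwo (abstractFaces K) ∧
      ∀ x y : EuclideanSpace ℝ (Fin N), x ≠ y →
        ({x, y} : Finset (EuclideanSpace ℝ (Fin N))) ∈ abstractFaces K →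
        EdgeInSquare (abstractFaces K) x y) ∧
    ∃ g : ℕ → (Σ N : ℕ, Geometry.SimplicialComplex ℝ (EuclideanSpace ℝ (Fin N))),
      (∀ i, IsSphereTriangulation 3 (g i).2 ∧ IsFlag (abstractFaces (g i).2) ∧
        0 < gammaTwo (abstractFaces (g i).2) ∧
        ∀ x y, x ≠ y → ({x, y} : Finset _) ∈ abstractFaces (g i).2 →
          EdgeInSquare (abstractFaces (g i).2) x y) ∧
      ∀ i j, i ≠ j → ¬ CombIso (abstractFaces (g i).2) (abstractFaces (g j).2) := by
  refine ⟨fun m => ⟨4, good_exists m⟩, ?_⟩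
  choose K hK using good_exists
  let s : ℕ → ℕ := fun i => Nat.rec 0 (fun _ r => fZero (abstractFaces (K r))) i
  have hs : ∀ i, s (i + 1) = fZero (abstractFaces (K (s i))) := fun i => rfl
  have hlt : ∀ i, s i < s (i + 1) := fun i => by
    rw [hs]
    exact (hK (s i)).2.2.1
  have hmono : StrictMono s := strictMono_nat_of_lt_succ hlt
  refine ⟨fun i => ⟨4, K (s i)⟩, fun i => ?_, fun i j hij h => ?_⟩
  · obtain ⟨h1, h2, -, h3, h4⟩ := hK (s i)
    exact ⟨h1, h2, h3, h4⟩
  · have := combIso_fZero _ _ h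
    simp only at this
    rw [← hs, ← hs] at this
    have h2 : i + 1 = j + 1 := hmono.injective this
    omega
end
end

section
/- Every flag triangulation T of the 3-sphere S³ with exactly 10 vertices and γ₂(T) > 0 is combinatorially isomorphic to T₁₀, the join of two 5-cycles (the pentagon being the simplicial complex on 5 vertices whose maximal simplices are the 5 edges of a cycle). In particular, such a T has exactly 35 edges, and γ₂(T) = 1. -/
open scoped Classical

noncomputable section

/-- The pentagon: the simplicial complex on `Fin 5` whose maximal simplices are the five
edges of a cycle. -/
def pentagonFaces : Set (Finset (Fin 5)) :=
  {σ | σ = ∅ ∨ (∃ i : Fin 5, σ = {i}) ∨ ∃ i : Fin 5, σ = {i, i + 1}}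

/-- The join of two simplicial complexes on disjoint vertex sets. -/
def joinFaces {V₁ V₂ : Type*} [DecidableEq V₁] [DecidableEq V₂]
    (F₁ : Set (Finset V₁)) (F₂ : Set (Finset V₂)) : Set (Finset (V₁ ⊕ V₂)) :=
  {ρ | ∃ σ₁ ∈ F₁, ∃ σ₂ ∈ F₂, ρ = σ₁.image Sum.inl ∪ σ₂.image Sum.inr}

/-- `T₁₀`: the join of two pentagons. -/
def T10Faces : Set (Finset (Fin 5 ⊕ Fin 5)) := joinFaces pentagonFaces pentagonFaces


abbrev E3 := EuclideanSpace ℝ (Fin 3)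

lemma det_eq_matrix (A : E3 →L[ℝ] E3) :
    A.det = Matrix.det (Matrix.of fun i j : Fin 3 => (A (EuclideanSpace.single j 1)) i) := by
  unfold ContinuousLinearMap.det
  rw [← LinearMap.det_toMatrix (EuclideanSpace.basisFun (Fin 3) ℝ).toBasis]
  congr 1

lemma det_expand (A : E3 →L[ℝ] E3) (t : ℝ) :
    (ContinuousLinearMap.id ℝ E3 + t • A).det =
      1 + t * (((ContinuousLinearMap.id ℝ E3 + A).det - (ContinuousLinearMap.id ℝ E3 - A).det) / 2
            - A.det)
        + t ^ 2 * (((ContinuousLinearMap.id ℝ E3 + A).det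
            + (ContinuousLinearMap.id ℝ E3 - A).det) / 2 - 1)
        + t ^ 3 * A.det := by
  simp only [det_eq_matrix, Matrix.det_fin_three]
  simp
  ring

lemma poly_zero {a b c t0 : ℝ} (ht0 : 0 < t0)
    (h : ∀ t, 0 < t → t < t0 → t * a + t ^ 2 * b + t ^ 3 * c = 0) : a + b + c = 0 := by
  have h1 := h (t0 / 2) (by positivity) (by linarith)
  have h2 := h (t0 / 3) (by positivity) (by linarith)
  have h3 := h (t0 / 4) (by positivity) (by linarith)
  have e : ∀ s : ℝ, s * a + s ^ 2 * b + s ^ 3 * c = s * (a + s * b + s ^ 2 * c) := by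
    intro s; ring
  rw [e] at h1 h2 h3
  have k1 := (mul_eq_zero.1 h1).resolve_left (by positivity)
  have k2 := (mul_eq_zero.1 h2).resolve_left (by positivity)
  have k3 := (mul_eq_zero.1 h3).resolve_left (by positivity)
  have ht : t0 ≠ 0 := ht0.ne'
  have m1 : b / 6 + t0 * c * (5 / 36) = 0 := by
    apply mul_left_cancel₀ ht; linear_combination k1 - k2
  have m2 : b / 12 + t0 * c * (7 / 144) = 0 := by
    apply mul_left_cancel₀ ht; linear_combination k2 - k3
  have hc : t0 * c = 0 := by linarith
  have hc' := (mul_eq_zero.1 hc).resolve_left ht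
  subst hc'
  have hb : b = 0 := by linarith
  subst hb
  linarith

lemma lip_extend {u : E3 → E3} {C : NNReal} (hu : LipschitzOnWith C u (Metric.closedBall 0 1))
    (h0 : ∀ x, ‖x‖ = 1 → u x = 0) :
    LipschitzWith C (fun x => if ‖x‖ ≤ 1 then u x else 0) := by
  have key : ∀ x y : E3, ‖x‖ ≤ 1 → 1 < ‖y‖ → ‖u x‖ ≤ C * ‖x - y‖ := by
    intro x y hx hy
    have hc : ContinuousOn (fun s : ℝ => ‖AffineMap.lineMap (k := ℝ) x y s‖) (Set.Icc 0 1) := by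
      apply Continuous.continuousOn
      exact (AffineMap.lineMap_continuous).norm
    have := intermediate_value_Icc (zero_le_one' ℝ) hc
    obtain ⟨s, hs, hsz⟩ := this (show (1 : ℝ) ∈ _ by simpa using ⟨hx, hy.le⟩)
    simp only at hsz
    have h1 := hu.norm_sub_le (x := x) (y := AffineMap.lineMap (k := ℝ) x y s) (by simpa using hx)
      (by simpa using hsz.le)
    rw [h0 _ hsz, sub_zero] at h1
    refine h1.trans ?_
    gcongr
    rw [← dist_eq_norm, ← dist_eq_norm, dist_left_lineMap]
    have : ‖s‖ ≤ 1 := by rw [Real.norm_eq_abs, abs_of_nonneg hs.1]; exact hs.2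
    nlinarith [dist_nonneg (x := x) (y := y)]
  apply LipschitzWith.of_dist_le_mul
  intro x y
  rw [dist_eq_norm, dist_eq_norm]
  by_cases hx : ‖x‖ ≤ 1 <;> by_cases hy : ‖y‖ ≤ 1
  · simp only [hx, hy, if_true]
    exact hu.norm_sub_le (by simpa using hx) (by simpa using hy)
  · simp only [hx, hy, if_true, if_false, sub_zero]
    exact key x y hx (not_le.1 hy)
  · simp only [hx, hy, if_true, if_false, zero_sub, norm_neg]
    rw [norm_sub_rev]
    exact key y x hy (not_le.1 hx)
  · simp only [hx, hy, if_false, sub_zero, norm_zero]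
    positivity

lemma small_bij {v : E3 → E3} {C : NNReal} (hv : LipschitzWith C v) {t : ℝ} (ht : 0 ≤ t)
    (htC : t * C < 1) : Function.Bijective (fun x => x + t • v x) := by
  constructor
  · intro x y hxy
    simp only at hxy
    have h1 : x - y = t • (v y - v x) := by
      rw [smul_sub, sub_eq_sub_iff_add_eq_add, hxy]; abel
    have h2 : ‖x - y‖ ≤ t * C * ‖x - y‖ := by
      calc ‖x - y‖ = t * ‖v y - v x‖ := by rw [h1, norm_smul, Real.norm_of_nonneg ht]
        _ ≤ t * (C * ‖y - x‖) := by gcongr; exact hv.norm_sub_le _ _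
        _ = _ := by rw [norm_sub_rev]; ring
    have h3 : ‖x - y‖ = 0 := by nlinarith [norm_nonneg (x - y)]
    exact sub_eq_zero.1 (norm_eq_zero.1 h3)
  · intro y
    have hK : ContractingWith (t.toNNReal * C) (fun x => y - t • v x) := by
      refine ⟨by rw [← NNReal.coe_lt_coe]; simpa [ht] using htC, ?_⟩
      apply LipschitzWith.of_dist_le_mul
      intro a b
      rw [dist_eq_norm, dist_eq_norm]
      have : (y - t • v a) - (y - t • v b) = t • (v b - v a) := by rw [smul_sub]; abel
      rw [this, norm_smul, Real.norm_of_nonneg ht]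
      have := hv.norm_sub_le b a
      rw [norm_sub_rev b a] at this
      simp only [NNReal.coe_mul, Real.coe_toNNReal _ ht, mul_assoc]
      gcongr
    refine ⟨hK.fixedPoint, ?_⟩
    have := hK.fixedPoint_isFixedPt
    simp only [Function.IsFixedPt] at this
    simp only
    nth_rewrite 1 [← this]
    simp

open MeasureTheory in
lemma no_retraction (r : E3 → E3) (hr : ContDiff ℝ 1 r) (h1 : ∀ x, ‖r x‖ = 1)
    (h2 : ∀ x, ‖x‖ = 1 → r x = x) : False := by
  set B : Set E3 := Metric.closedBall 0 1 with hB
  have hBc : IsCompact B := isCompact_closedBall _ _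
  let u : E3 → E3 := fun x => r x - x
  have hu : ContDiff ℝ 1 u := hr.sub contDiff_id
  have hdc : Continuous (fderiv ℝ u) := hu.continuous_fderiv one_ne_zero
  obtain ⟨C, hC⟩ : ∃ C : NNReal, LipschitzOnWith C u B := by
    obtain ⟨C, hC⟩ := hBc.exists_bound_of_continuousOn hdc.continuousOn
    refine ⟨C.toNNReal, ?_⟩
    apply Convex.lipschitzOnWith_of_nnnorm_fderiv_le (𝕜 := ℝ)
    · intro x _; exact (hu.differentiable one_ne_zero) x
    · intro x hx
      rw [← NNReal.coe_le_coe]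
      exact (hC x hx).trans (Real.le_coe_toNNReal _)
    · exact convex_closedBall _ _
  have hu0 : ∀ x, ‖x‖ = 1 → u x = 0 := fun x hx => by simp [u, h2 x hx]
  have hLip := lip_extend hC hu0
  let I := ContinuousLinearMap.id ℝ E3
  let c1 : E3 → ℝ := fun x => ((I + fderiv ℝ u x).det - (I - fderiv ℝ u x).det) / 2 - (fderiv ℝ u x).det
  let c2 : E3 → ℝ := fun x => ((I + fderiv ℝ u x).det + (I - fderiv ℝ u x).det) / 2 - 1
  let c3 : E3 → ℝ := fun x => (fderiv ℝ u x).det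
  have cdet := ContinuousLinearMap.continuous_det (𝕜 := ℝ) (E := E3)
  have e1 : Continuous fun x => (I + fderiv ℝ u x).det := cdet.comp (continuous_const.add hdc)
  have e2 : Continuous fun x => (I - fderiv ℝ u x).det := cdet.comp (continuous_const.sub hdc)
  have k3 : Continuous c3 := cdet.comp hdc
  have k1 : Continuous c1 := ((e1.sub e2).div_const 2).sub k3
  have k2 : Continuous c2 := ((e1.add e2).div_const 2).sub continuous_const
  have hexp : ∀ x t, (I + t • fderiv ℝ u x).det = 1 + t * c1 x + t ^ 2 * c2 x + t ^ 3 * c3 x :=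
    fun x t => det_expand _ _
  obtain ⟨M1, hM1⟩ := hBc.exists_bound_of_continuousOn k1.continuousOn
  obtain ⟨M2, hM2⟩ := hBc.exists_bound_of_continuousOn k2.continuousOn
  obtain ⟨M3, hM3⟩ := hBc.exists_bound_of_continuousOn k3.continuousOn
  have z0 : (0 : E3) ∈ B := by simp [hB]
  have p1 := (norm_nonneg _).trans (hM1 0 z0)
  have p2 := (norm_nonneg _).trans (hM2 0 z0)
  have p3 := (norm_nonneg _).trans (hM3 0 z0)
  set t0 : ℝ := 1 / (1 + C + M1 + M2 + M3) with ht0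
  have hD : 0 < 1 + (C : ℝ) + M1 + M2 + M3 := by have := C.2; positivity
  have ht0p : 0 < t0 := by positivity
  have hvol : ∀ t, 0 < t → t < t0 →
      t * (∫ x in B, c1 x) + t ^ 2 * (∫ x in B, c2 x) + t ^ 3 * (∫ x in B, c3 x) = 0 := by
    intro t ht htt
    have hmul : t * (1 + (C : ℝ) + M1 + M2 + M3) < 1 := by
      rw [ht0, lt_div_iff₀ hD] at htt; exact htt
    have hCnn : (0 : ℝ) ≤ C := C.2
    have hlt1 : t < 1 := by nlinarith [mul_nonneg ht.le hCnn, mul_nonneg ht.le p1, mul_nonneg ht.le p2, mul_nonneg ht.le p3]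
    have htC : t * C < 1 := by nlinarith [mul_nonneg ht.le hCnn, mul_nonneg ht.le p1, mul_nonneg ht.le p2, mul_nonneg ht.le p3]
    have hbij := small_bij hLip ht.le htC
    have hon : ∀ x ∈ B, x + t • u x = (fun x => x + t • (fun x => if ‖x‖ ≤ 1 then u x else 0) x) x := by
      intro x hx
      have : ‖x‖ ≤ 1 := by simpa [hB] using hx
      simp [this]
    have hinj : Set.InjOn (fun x => x + t • u x) B := by
      intro x hx y hy hxy
      simp only at hxy
      rw [hon x hx, hon y hy] at hxy
      exact hbij.1 hxy
    have himg : (fun x => x + t • u x) '' B = B := by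
      apply Set.Subset.antisymm
      · rintro _ ⟨x, hx, rfl⟩
        have hx' : ‖x‖ ≤ 1 := by simpa [hB] using hx
        have : x + t • u x = (1 - t) • x + t • r x := by simp only [u]; module
        simp only [hB, Metric.mem_closedBall, dist_zero_right, this]
        calc _ ≤ ‖(1 - t) • x‖ + ‖t • r x‖ := norm_add_le _ _
          _ = (1 - t) * ‖x‖ + t := by
            rw [norm_smul, norm_smul, h1, Real.norm_of_nonneg ht.le, Real.norm_of_nonneg (by linarith)]; ring
          _ ≤ 1 := by nlinarith
      · intro y hy
        obtain ⟨x, hx⟩ := hbij.2 y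
        by_cases hx1 : ‖x‖ ≤ 1
        · exact ⟨x, by simpa [hB] using hx1, by simpa [hx1] using hx⟩
        · simp [hx1] at hx
          subst hx
          exact absurd (by simpa [hB] using hy) hx1
    have hder : ∀ x ∈ B, HasFDerivWithinAt (fun x => x + t • u x) (I + t • fderiv ℝ u x) B x := by
      intro x _
      apply HasFDerivAt.hasFDerivWithinAt
      exact (hasFDerivAt_id x).add (((hu.differentiable one_ne_zero) x).hasFDerivAt.const_smul t)
    have hcv := integral_image_eq_integral_abs_det_fderiv_smul volume (s := B) hBc.measurableSet hder hinj (fun _ => (1 : ℝ))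
    rw [himg] at hcv
    have hpos : ∀ x ∈ B, |(I + t • fderiv ℝ u x).det| • (1 : ℝ) = 1 + (t * c1 x + t ^ 2 * c2 x + t ^ 3 * c3 x) := by
      intro x hx
      rw [smul_eq_mul, mul_one, hexp, abs_of_nonneg, add_assoc, add_assoc, add_assoc]
      have q1 := abs_le.1 (hM1 x hx)
      have q2 := abs_le.1 (hM2 x hx)
      have q3 := abs_le.1 (hM3 x hx)
      have s2 : t ^ 2 ≤ t := by nlinarith
      have s3 : t ^ 3 ≤ t := by nlinarith [sq_nonneg t]
      have a1 : -(t * M1) ≤ t * c1 x := by nlinarith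
      have a2 : -(t * M2) ≤ t ^ 2 * c2 x := by nlinarith [sq_nonneg t]
      have a3 : -(t * M3) ≤ t ^ 3 * c3 x := by nlinarith [pow_pos ht 3]
      nlinarith [mul_nonneg ht.le hCnn]
    rw [setIntegral_congr_fun hBc.measurableSet hpos] at hcv
    have i1 : IntegrableOn c1 B := k1.continuousOn.integrableOn_compact hBc
    have i2 : IntegrableOn c2 B := k2.continuousOn.integrableOn_compact hBc
    have i3 : IntegrableOn c3 B := k3.continuousOn.integrableOn_compact hBc
    have i0 : IntegrableOn (fun _ => (1 : ℝ)) B := continuousOn_const.integrableOn_compact hBc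
    have j1 : IntegrableOn (fun x => t * c1 x) B := i1.const_mul t
    have j2 : IntegrableOn (fun x => t ^ 2 * c2 x) B := i2.const_mul _
    have j3 : IntegrableOn (fun x => t ^ 3 * c3 x) B := i3.const_mul _
    have j12 : IntegrableOn (fun x => t * c1 x + t ^ 2 * c2 x) B := j1.add j2
    have j123 : IntegrableOn (fun x => t * c1 x + t ^ 2 * c2 x + t ^ 3 * c3 x) B := j12.add j3
    rw [integral_add i0 j123, integral_add j12 j3, integral_add j1 j2, integral_const_mul, integral_const_mul, integral_const_mul] at hcv
    linarith
  have hfin := poly_zero ht0p hvol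
  have i1 : IntegrableOn c1 B := k1.continuousOn.integrableOn_compact hBc
  have i2 : IntegrableOn c2 B := k2.continuousOn.integrableOn_compact hBc
  have i3 : IntegrableOn c3 B := k3.continuousOn.integrableOn_compact hBc
  have i12 : IntegrableOn (fun x => c1 x + c2 x) B := i1.add i2
  rw [← integral_add i1 i2, ← integral_add i12 i3] at hfin
  have hdet0 : ∀ x ∈ B, (c1 x + c2 x + c3 x) = -1 := by
    intro x _
    have h := hexp x 1
    have hd : I + (1 : ℝ) • fderiv ℝ u x = fderiv ℝ r x := by
      have : fderiv ℝ u x = fderiv ℝ r x - I := by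
        have := ((hr.differentiable one_ne_zero x).hasFDerivAt.sub (hasFDerivAt_id x)).fderiv
        exact this
      rw [this]; simp
    have hz : (fderiv ℝ r x).det = 0 := by
      by_contra hne
      have hsurj : Function.Surjective (fderiv ℝ r x) := by
        have : IsUnit (LinearMap.det (fderiv ℝ r x).toLinearMap) := isUnit_iff_ne_zero.2 hne
        have := (LinearMap.equivOfIsUnitDet this).surjective
        intro y
        obtain ⟨z, hz⟩ := this y
        exact ⟨z, by simpa using hz⟩
      have hin : ∀ z, inner ℝ (r x) (fderiv ℝ r x z) = 0 := by
        intro z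
        have hd := (hr.differentiable one_ne_zero x).hasFDerivAt
        have h3 := hd.norm_sq
        have h4 : HasFDerivAt (fun y => ‖r y‖ ^ 2) (0 : E3 →L[ℝ] ℝ) x := by
          simp only [h1]; exact hasFDerivAt_const _ _
        have := congrArg (fun L => L z) (h3.unique h4)
        simpa using this
      obtain ⟨z, hz⟩ := hsurj (r x)
      have := hin z
      rw [hz, real_inner_self_eq_norm_sq, h1] at this
      norm_num at this
    rw [hd, hz] at h
    linarith
  have : ∫ x in B, (c1 x + c2 x + c3 x) = ∫ x in B, (-1 : ℝ) :=
    setIntegral_congr_fun hBc.measurableSet hdet0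
  have h5 : ∫ x in B, (-1 : ℝ) = 0 := by rw [← this]; exact hfin
  simp [Measure.real] at h5
  have hv : volume B ≠ 0 := (Metric.measure_closedBall_pos volume (0 : E3) one_pos).ne'
  have hv' : volume B ≠ ⊤ := hBc.measure_lt_top.ne
  rw [ENNReal.toReal_eq_zero_iff] at h5
  tauto

lemma exists_zero_smooth (h : E3 → E3) (hs : ContDiff ℝ 1 h)
    (hn : ∀ x, ‖x‖ ≤ 1 → ‖h x - x‖ ≤ 1 / 2) : ∃ x, ‖x‖ ≤ 1 ∧ h x = 0 := by
  by_contra! hne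
  let b : ContDiffBump (0 : E3) := ⟨7 / 10, 9 / 10, by norm_num, by norm_num⟩
  let k : E3 → E3 := fun x => x + b x • (h x - x)
  have hk : ContDiff ℝ 1 k := contDiff_id.add ((b.contDiff).smul (hs.sub contDiff_id))
  have hout : ∀ x, 9 / 10 ≤ ‖x‖ → k x = x := by
    intro x hx
    have : b x = 0 := b.zero_of_le_dist (by simpa using hx)
    simp [k, this]
  have hk0 : ∀ x, k x ≠ 0 := by
    intro x h0
    by_cases h1 : ‖x‖ ≤ 7 / 10
    · have : b x = 1 := b.one_of_mem_closedBall (by simpa using h1)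
      simp only [k, this, one_smul, add_sub_cancel] at h0
      exact hne x (by linarith) h0
    · by_cases h2 : 9 / 10 ≤ ‖x‖
      · rw [hout x h2] at h0
        simp [h0] at h2
        norm_num at h2
      · push Not at h1 h2
        have h3 : x = - (b x • (h x - x)) := eq_neg_of_add_eq_zero_left h0
        have h4 : ‖x‖ ≤ 1 / 2 := by
          rw [h3, norm_neg, norm_smul, Real.norm_of_nonneg b.nonneg]
          have h5 := hn x (by linarith)
          have h6 := b.le_one (x := x)
          have h7 := b.nonneg (x := x)
          nlinarith [norm_nonneg (h x - x)]
        linarith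
  refine no_retraction (fun x => ‖k x‖⁻¹ • k x) ?_ ?_ ?_
  · exact ((hk.norm ℝ hk0).inv (fun x => norm_ne_zero_iff.2 (hk0 x))).smul hk
  · intro x
    rw [norm_smul, norm_inv, norm_norm]
    exact inv_mul_cancel₀ (norm_ne_zero_iff.2 (hk0 x))
  · intro x hx
    have := hout x (by rw [hx]; norm_num)
    simp [this, hx]

lemma exists_zero (h : E3 → E3) (hc : ContinuousOn h (Metric.closedBall 0 1))
    (hn : ∀ x ∈ Metric.closedBall (0 : E3) 1, ‖h x - x‖ ≤ 1 / 4) :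
    ∃ x ∈ Metric.closedBall (0 : E3) 1, h x = 0 := by
  by_contra! hne
  have hBc : IsCompact (Metric.closedBall (0 : E3) 1) := isCompact_closedBall _ _
  obtain ⟨g, hg⟩ := ContinuousMap.exists_restrict_eq (Metric.isClosed_closedBall)
    (⟨_, hc.domRestrict⟩ : C(Metric.closedBall (0 : E3) 1, E3))
  have hg' : ∀ x ∈ Metric.closedBall (0 : E3) 1, g x = h x := by
    intro x hx
    exact congrArg (fun φ : C(Metric.closedBall (0 : E3) 1, E3) => φ ⟨x, hx⟩) hg
  obtain ⟨x0, hx0, hmin⟩ := hBc.exists_isMinOn ⟨0, by simp⟩ hc.norm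
  have hδ : 0 < ‖h x0‖ := norm_pos_iff.2 (hne x0 hx0)
  obtain ⟨s, hs, hsd, -⟩ := g.continuous.exists_contDiff_approx 1
    (ε := fun _ => min (‖h x0‖) (1 / 4)) continuous_const (fun _ => by positivity)
  obtain ⟨x, hx, hsx⟩ := exists_zero_smooth s hs (by
    intro x hx
    have hx' : x ∈ Metric.closedBall (0 : E3) 1 := by simpa using hx
    have h1 := hsd x
    rw [dist_eq_norm, hg' x hx'] at h1
    have h2 := hn x hx'
    have h3 := h1.trans_le (min_le_right _ _)
    have h4 : s x - x = (s x - h x) + (h x - x) := by abel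
    rw [h4]
    exact (norm_add_le _ _).trans (by linarith))
  have hx' : x ∈ Metric.closedBall (0 : E3) 1 := by simpa using hx
  have h1 := (hsd x).trans_le (min_le_left _ _)
  rw [dist_eq_norm, hg' x hx', hsx, zero_sub, norm_neg] at h1
  have : ‖h x0‖ ≤ ‖h x‖ := hmin hx'
  linarith

open MeasureTheory in
lemma inv_domain_core (f : E3 → E3) (hf : ContinuousOn f (Metric.closedBall 0 1))
    (hinj : Set.InjOn f (Metric.closedBall 0 1)) :
    f 0 ∈ interior (f '' Metric.closedBall 0 1) := by
  by_contra hzint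
  set B : Set E3 := Metric.closedBall 0 1 with hB
  have hBc : IsCompact B := isCompact_closedBall _ _
  have z0 : (0 : E3) ∈ B := by simp [hB]
  set K := f '' B with hK
  have hKc : IsCompact K := hBc.image_of_continuousOn hf
  have : CompactSpace B := isCompact_iff_compactSpace.1 hBc
  have hemb : Topology.IsClosedEmbedding (B.domRestrict f) :=
    hf.domRestrict.isClosedEmbedding (Set.injOn_iff_injective.1 hinj)
  obtain ⟨G, hG⟩ := ContinuousMap.exists_extension hemb (⟨Subtype.val, continuous_subtype_val⟩ : C(B, E3))
  have hGf : ∀ x ∈ B, G (f x) = x := by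
    intro x hx
    exact congrArg (fun φ : C(B, E3) => φ ⟨x, hx⟩) hG
  obtain ⟨η, hη, hGη⟩ := Metric.continuousAt_iff.1 (G.continuous.continuousAt (x := f 0)) (1 / 16) (by norm_num)
  rw [hGf 0 z0] at hGη
  simp only [dist_zero_right] at hGη
  set ε := η / 3 with hε
  have hεp : 0 < ε := by positivity
  obtain ⟨c, hcK, hcd⟩ : ∃ c, c ∉ K ∧ dist c (f 0) < ε := by
    by_contra! hcon
    apply hzint
    rw [mem_interior_iff_mem_nhds, Metric.mem_nhds_iff]
    refine ⟨ε, hεp, fun y hy => ?_⟩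
    by_contra hyK
    exact absurd (hcon y hyK) (not_le.2 hy)
  set S1 := K ∩ {y | ε ≤ dist y c} with hS1
  have hS1c : IsCompact S1 := hKc.inter_right (isClosed_le continuous_const (continuous_id.dist continuous_const))
  have hG0 : ∀ y ∈ S1, G y ≠ 0 := by
    rintro y ⟨⟨x, hx, rfl⟩, hy⟩ h0
    rw [hGf x hx] at h0
    subst h0
    rw [dist_comm] at hcd
    exact absurd hy (not_le.2 hcd)
  obtain ⟨δ, hδ, hδ1, hδG⟩ : ∃ δ : ℝ, 0 < δ ∧ δ ≤ 1 / 16 ∧ ∀ y ∈ S1, δ ≤ ‖G y‖ := by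
    rcases S1.eq_empty_or_nonempty with he | hne
    · exact ⟨1 / 16, by norm_num, le_rfl, by simp [he]⟩
    · obtain ⟨y0, hy0, hmin⟩ := hS1c.exists_isMinOn hne G.continuous.norm.continuousOn
      exact ⟨min (1 / 16) ‖G y0‖, lt_min (by norm_num) (norm_pos_iff.2 (hG0 y0 hy0)), min_le_left _ _,
        fun y hy => (min_le_right _ _).trans (hmin hy)⟩
  obtain ⟨P, hP, hPd, -⟩ := G.continuous.exists_contDiff_approx 1
    (ε := fun _ => δ / 2) continuous_const (fun _ => by positivity)
  have hnull : volume (P '' Metric.sphere c ε) = 0 := by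
    apply addHaar_image_eq_zero_of_differentiableOn_of_addHaar_eq_zero
    · exact (hP.differentiable one_ne_zero).differentiableOn
    · exact Measure.addHaar_sphere _ _ _
  obtain ⟨w, hw, hwP⟩ : ∃ w ∈ Metric.ball (0 : E3) (δ / 2), w ∉ P '' Metric.sphere c ε := by
    by_contra! hcon
    have := (measure_mono (μ := volume) (show Metric.ball (0 : E3) (δ / 2) ⊆ _ from hcon)).trans hnull.le
    exact absurd this (not_le.2 (Metric.measure_ball_pos _ _ (by positivity)))
  have hQ : ∀ y, ‖(P y - w) - G y‖ < δ := by
    intro y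
    have h1 := hPd y
    rw [dist_eq_norm] at h1
    have h2 : ‖w‖ < δ / 2 := by simpa using hw
    have : (P y - w) - G y = (P y - G y) - w := by abel
    rw [this]
    exact (norm_sub_le _ _).trans_lt (by linarith)
  let Φ : E3 → E3 := fun y => c + max (ε / ‖y - c‖) 1 • (y - c)
  have hΦc : ContinuousOn Φ K := by
    apply continuousOn_const.add
    have h1 : ContinuousOn (fun y => max (ε / ‖y - c‖) 1) K := by
      have h2 : ContinuousOn (fun y => ε / ‖y - c‖) K := by
        apply ContinuousOn.div continuousOn_const (by fun_prop)
        intro y hy h0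
        rw [norm_eq_zero, sub_eq_zero] at h0
        exact hcK (h0 ▸ hy)
      exact h2.sup continuousOn_const
    have h3 : ContinuousOn (fun y => y - c) K := by fun_prop
    exact h1.smul h3
  have hΦ1 : ∀ y, ε ≤ dist y c → Φ y = y := by
    intro y hy
    rw [dist_eq_norm] at hy
    have : ε / ‖y - c‖ ≤ 1 := div_le_one_of_le₀ hy (norm_nonneg _)
    simp [Φ, max_eq_right this]
  have hΦ2 : ∀ y ∈ K, dist y c < ε → Φ y ∈ Metric.sphere c ε := by
    intro y hyK hy
    rw [dist_eq_norm] at hy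
    have h0 : 0 < ‖y - c‖ := by
      rw [norm_pos_iff, sub_ne_zero]; rintro rfl; exact hcK hyK
    have : 1 ≤ ε / ‖y - c‖ := (one_le_div h0).2 hy.le
    simp only [Φ, max_eq_left this, Metric.mem_sphere, dist_eq_norm, add_sub_cancel_left, norm_smul,
      norm_div, norm_norm, Real.norm_of_nonneg hεp.le]
    field_simp
  obtain ⟨x, hx, hzero⟩ := exists_zero (fun x => P (Φ (f x)) - w) (by
      apply ContinuousOn.sub _ continuousOn_const
      apply hP.continuous.comp_continuousOn
      exact hΦc.comp hf (fun x hx => ⟨x, hx, rfl⟩)) (by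
    intro x hx
    by_cases hxe : ε ≤ dist (f x) c
    · simp only [hΦ1 _ hxe]
      have := hQ (f x)
      rw [hGf x hx] at this
      linarith
    · push Not at hxe
      have h1 := hΦ2 (f x) ⟨x, hx, rfl⟩ hxe
      have h2 := hQ (Φ (f x))
      have h3 : ‖G (Φ (f x))‖ < 1 / 16 := by
        apply hGη
        calc _ ≤ dist (Φ (f x)) c + dist c (f 0) := dist_triangle _ _ _
          _ < η := by rw [Metric.mem_sphere.1 h1]; linarith
      have h4 : ‖x‖ < 1 / 16 := by
        rw [← hGf x hx]
        apply hGη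
        calc _ ≤ dist (f x) c + dist c (f 0) := dist_triangle _ _ _
          _ < η := by linarith
      have h5 : P (Φ (f x)) - w - x = (P (Φ (f x)) - w - G (Φ (f x))) + G (Φ (f x)) - x := by abel
      rw [h5]
      refine (norm_sub_le _ _).trans ?_
      have := norm_add_le (P (Φ (f x)) - w - G (Φ (f x))) (G (Φ (f x)))
      linarith)
  by_cases hxe : ε ≤ dist (f x) c
  · rw [hΦ1 _ hxe] at hzero
    have h1 := hQ (f x)
    rw [hzero, zero_sub, norm_neg] at h1
    exact absurd (hδG (f x) ⟨⟨x, hx, rfl⟩, hxe⟩) (not_le.2 h1)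
  · push Not at hxe
    exact hwP ⟨_, hΦ2 (f x) ⟨x, hx, rfl⟩ hxe, sub_eq_zero.1 hzero⟩

theorem invariance_of_domain {U : Set E3} (hU : IsOpen U) (f : E3 → E3) (hf : ContinuousOn f U)
    (hinj : Set.InjOn f U) : IsOpen (f '' U) := by
  rw [isOpen_iff_mem_nhds]
  rintro _ ⟨x, hx, rfl⟩
  obtain ⟨ρ, hρ, hsub⟩ := Metric.nhds_basis_closedBall.mem_iff.1 (hU.mem_nhds hx)
  have hmap : Set.MapsTo (fun z : E3 => x + ρ • z) (Metric.closedBall 0 1) U := by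
    intro z hz
    apply hsub
    have : ‖z‖ ≤ 1 := by simpa using hz
    simp only [Metric.mem_closedBall, dist_eq_norm, add_sub_cancel_left, norm_smul, Real.norm_of_nonneg hρ.le]
    nlinarith
  have h := inv_domain_core (fun z => f (x + ρ • z)) (hf.comp (by fun_prop) hmap) (by
    intro a ha b hb hab
    have := hinj (hmap ha) (hmap hb) hab
    have := add_left_cancel this
    exact smul_right_injective _ hρ.ne' this)
  simp only [smul_zero, add_zero] at h
  rw [mem_interior_iff_mem_nhds] at h
  apply Filter.mem_of_superset h
  rintro _ ⟨z, hz, rfl⟩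
  exact ⟨_, hmap hz, rfl⟩

lemma isOpen_image_to {Y : Type*} [TopologicalSpace Y]
    (hY : ∀ y : Y, ∃ χ : OpenPartialHomeomorph Y E3, y ∈ χ.source)
    {U : Set E3} (hU : IsOpen U) (g : E3 → Y) (hg : ContinuousOn g U) (hinj : Set.InjOn g U) :
    IsOpen (g '' U) := by
  rw [isOpen_iff_mem_nhds]
  rintro _ ⟨x, hx, rfl⟩
  obtain ⟨χ, hχ⟩ := hY (g x)
  have hU' : IsOpen (U ∩ g ⁻¹' χ.source) := hg.isOpen_inter_preimage hU χ.open_source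
  have ho := invariance_of_domain hU' (fun z => χ (g z))
    (χ.continuousOn.comp (hg.mono Set.inter_subset_left) (fun z hz => hz.2))
    (by
      intro z hz w hw hzw
      exact hinj hz.1 hw.1 (χ.injOn hz.2 hw.2 hzw))
  have ho2 := χ.isOpen_inter_preimage ho
  apply Filter.mem_of_superset (ho2.mem_nhds ⟨hχ, x, ⟨hx, hχ⟩, rfl⟩)
  rintro y ⟨hy, z, hz, hzy⟩
  exact ⟨z, hz.1, χ.injOn hz.2 hy hzy⟩

lemma isOpen_image_from {Y : Type*} [TopologicalSpace Y]
    (hY : ∀ y : Y, ∃ χ : OpenPartialHomeomorph Y E3, y ∈ χ.source)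
    {W : Set Y} (hW : IsOpen W) (φ : Y → E3) (hφ : ContinuousOn φ W) (hinj : Set.InjOn φ W) :
    IsOpen (φ '' W) := by
  rw [isOpen_iff_mem_nhds]
  rintro _ ⟨y, hy, rfl⟩
  obtain ⟨χ, hχ⟩ := hY y
  have hV : IsOpen (χ.target ∩ χ.symm ⁻¹' W) := χ.symm.isOpen_inter_preimage hW
  have ho := invariance_of_domain hV (fun z => φ (χ.symm z))
    (hφ.comp (χ.symm.continuousOn.mono Set.inter_subset_left) (fun z hz => hz.2))
    (by
      intro z hz w hw hzw
      exact χ.symm.injOn hz.1 hw.1 (hinj hz.2 hw.2 hzw))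
  apply Filter.mem_of_superset (ho.mem_nhds ⟨χ y, ⟨χ.map_source hχ, by simpa [χ.left_inv hχ] using hy⟩,
    by simp [χ.left_inv hχ]⟩)
  rintro _ ⟨z, hz, rfl⟩
  exact ⟨_, hz.2, rfl⟩

lemma charts_of_homeo {E : Type*} [TopologicalSpace E] {X : Set E}
    (Φ : ↥X ≃ₜ ↥(Metric.sphere (0 : EuclideanSpace ℝ (Fin (3 + 1))) 1)) :
    ∀ y : X, ∃ χ : OpenPartialHomeomorph X E3, y ∈ χ.source := by
  intro y
  refine ⟨Φ.toOpenPartialHomeomorph.trans (chartAt E3 (Φ y)), ?_⟩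
  simp

section
variable {E : Type*} [TopologicalSpace E] {X : Set E}

lemma image_mem_nhdsWithin (hX : ∀ y : X, ∃ χ : OpenPartialHomeomorph X E3, y ∈ χ.source)
    {U : Set E3} (hU : IsOpen U) (g : E3 → E) (hg : ContinuousOn g U) (hinj : Set.InjOn g U)
    (hmap : Set.MapsTo g U X) {x : E3} (hx : x ∈ U) : g '' U ∈ nhdsWithin (g x) X := by
  let g' : E3 → X := fun z => if h : z ∈ U then ⟨g z, hmap h⟩ else ⟨g x, hmap hx⟩
  have hg' : ∀ z ∈ U, (g' z : E) = g z := by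
    intro z hz; simp [g', hz]
  have hc : ContinuousOn g' U := by
    rw [Topology.IsInducing.subtypeVal.continuousOn_iff]
    exact hg.congr hg'
  have hi : Set.InjOn g' U := by
    intro z hz w hw hzw
    apply hinj hz hw
    rw [← hg' z hz, ← hg' w hw, hzw]
  have ho := isOpen_image_to hX hU g' hc hi
  rw [nhdsWithin_eq_map_subtype_coe (hmap hx), Filter.mem_map]
  have : (⟨g x, hmap hx⟩ : X) = g' x := by simp [g', hx]
  rw [this]
  apply Filter.mem_of_superset (ho.mem_nhds ⟨x, hx, rfl⟩)
  rintro _ ⟨z, hz, rfl⟩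
  exact ⟨z, hz, (hg' z hz).symm⟩

lemma image_isOpen (hX : ∀ y : X, ∃ χ : OpenPartialHomeomorph X E3, y ∈ χ.source)
    {W : Set E} (hW : IsOpen W) (φ : E → E3) (hφ : ContinuousOn φ (W ∩ X))
    (hinj : Set.InjOn φ (W ∩ X)) : IsOpen (φ '' (W ∩ X)) := by
  have ho := isOpen_image_from hX (W := Subtype.val ⁻¹' W) (hW.preimage continuous_subtype_val)
    (fun y => φ y) (hφ.comp continuous_subtype_val.continuousOn (fun y hy => ⟨hy, y.2⟩))
    (by
      intro y hy z hz h
      exact Subtype.ext (hinj ⟨hy, y.2⟩ ⟨hz, z.2⟩ h))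
  convert ho using 1
  ext q
  constructor
  · rintro ⟨y, ⟨h1, h2⟩, rfl⟩; exact ⟨⟨y, h2⟩, h1, rfl⟩
  · rintro ⟨y, h1, rfl⟩; exact ⟨y, ⟨h1, y.2⟩, rfl⟩
end

lemma open_dir {O : Set E3} (hO : IsOpen O) {q : E3} (hq : q ∈ O) (d : E3) :
    ∃ ε : ℝ, 0 < ε ∧ q + ε • d ∈ O := by
  have hc : Continuous fun ε : ℝ => q + ε • d := by fun_prop
  have : (fun ε : ℝ => q + ε • d) ⁻¹' O ∈ nhds (0 : ℝ) :=
    (hO.preimage hc).mem_nhds (by simpa using hq)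
  obtain ⟨η, hη, hs⟩ := Metric.mem_nhds_iff.1 this
  exact ⟨η / 2, by positivity, hs (by simp [abs_of_pos hη]; linarith)⟩

section
variable {N : ℕ}

lemma affine_sum (c : (EuclideanSpace ℝ (Fin N)) →ᵃ[ℝ] ℝ) (s : Finset (EuclideanSpace ℝ (Fin N))) (w : (EuclideanSpace ℝ (Fin N)) → ℝ) (hw : ∑ y ∈ s, w y = 1) :
    c (∑ y ∈ s, w y • y) = ∑ y ∈ s, w y * c y := by
  have h : ∀ x, c x = c.linear x + c 0 := fun x => congrFun c.decomp x
  have h2 : ∑ y ∈ s, w y * c y = ∑ y ∈ s, (w y * c.linear y + w y * c 0) :=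
    Finset.sum_congr rfl (fun y _ => by rw [h y, mul_add])
  rw [h2, h (∑ y ∈ s, w y • y), map_sum, Finset.sum_add_distrib, ← Finset.sum_mul, hw, one_mul]
  simp

lemma exists_coords {s : Finset (EuclideanSpace ℝ (Fin N))} (hs : AffineIndependent ℝ ((↑) : s → (EuclideanSpace ℝ (Fin N)))) :
    ∃ c : (EuclideanSpace ℝ (Fin N)) → ((EuclideanSpace ℝ (Fin N)) →ᵃ[ℝ] ℝ), ∀ v ∈ s, ∀ w ∈ s, c v w = if w = v then 1 else 0 := by
  obtain ⟨t, hst, ht, htop⟩ := exists_subset_affineIndependent_affineSpan_eq_top (k := ℝ) hs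
  let b : AffineBasis t ℝ (EuclideanSpace ℝ (Fin N)) := ⟨((↑) : t → (EuclideanSpace ℝ (Fin N))), ht, by simpa using htop⟩
  refine ⟨fun v => if h : v ∈ t then b.coord ⟨v, h⟩ else AffineMap.const ℝ _ 0, ?_⟩
  intro v hv w hw
  have hv' : v ∈ t := hst hv
  have hw' : w ∈ t := hst hw
  simp only [hv', dif_pos]
  have : w = b ⟨w, hw'⟩ := rfl
  conv_lhs => rw [this, AffineBasis.coord_apply]
  simp [eq_comm]

/-- barycentric coordinates data -/
def IsCoords (s : Finset (EuclideanSpace ℝ (Fin N))) (c : (EuclideanSpace ℝ (Fin N)) → ((EuclideanSpace ℝ (Fin N)) →ᵃ[ℝ] ℝ)) : Prop :=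
  ∀ v ∈ s, ∀ w ∈ s, c v w = if w = v then 1 else 0

lemma IsCoords.comb {s : Finset (EuclideanSpace ℝ (Fin N))} {c : (EuclideanSpace ℝ (Fin N)) → ((EuclideanSpace ℝ (Fin N)) →ᵃ[ℝ] ℝ)} (hc : IsCoords s c)
    (w : (EuclideanSpace ℝ (Fin N)) → ℝ) (hw : ∑ y ∈ s, w y = 1) {v : (EuclideanSpace ℝ (Fin N))} (hv : v ∈ s) : c v (∑ y ∈ s, w y • y) = w v := by
  rw [affine_sum _ _ _ hw, Finset.sum_congr rfl (fun y hy => by rw [hc v hv y hy])]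
  simp [hv]

lemma IsCoords.hull {s : Finset (EuclideanSpace ℝ (Fin N))} {c : (EuclideanSpace ℝ (Fin N)) → ((EuclideanSpace ℝ (Fin N)) →ᵃ[ℝ] ℝ)} (hc : IsCoords s c)
    {x : (EuclideanSpace ℝ (Fin N))} (hx : x ∈ convexHull ℝ (s : Set (EuclideanSpace ℝ (Fin N)))) :
    (∀ v ∈ s, 0 ≤ c v x) ∧ ∑ v ∈ s, c v x = 1 ∧ ∑ v ∈ s, c v x • v = x := by
  rw [Finset.mem_convexHull'] at hx
  obtain ⟨w, h0, h1, rfl⟩ := hx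
  have h : ∀ v ∈ s, c v (∑ y ∈ s, w y • y) = w v := fun v hv => hc.comb w h1 hv
  refine ⟨fun v hv => by rw [h v hv]; exact h0 v hv, by rw [Finset.sum_congr rfl h, h1], ?_⟩
  exact Finset.sum_congr rfl (fun v hv => by rw [h v hv])

lemma IsCoords.sub_zero {s t : Finset (EuclideanSpace ℝ (Fin N))} {c : (EuclideanSpace ℝ (Fin N)) → ((EuclideanSpace ℝ (Fin N)) →ᵃ[ℝ] ℝ)} (hc : IsCoords s c)
    (hts : t ⊆ s) {x : (EuclideanSpace ℝ (Fin N))} (hx : x ∈ convexHull ℝ (t : Set (EuclideanSpace ℝ (Fin N)))) {v : (EuclideanSpace ℝ (Fin N))} (hv : v ∈ s) (hvt : v ∉ t) :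
    c v x = 0 := by
  rw [Finset.mem_convexHull'] at hx
  obtain ⟨w, h0, h1, rfl⟩ := hx
  rw [affine_sum _ _ _ h1]
  apply Finset.sum_eq_zero
  intro y hy
  rw [hc v hv y (hts hy), if_neg (by rintro rfl; exact hvt hy), mul_zero]

lemma affine_cont (c : (EuclideanSpace ℝ (Fin N)) →ᵃ[ℝ] ℝ) : Continuous c := c.continuous_of_finiteDimensional



lemma subset_of_pos {K : Geometry.SimplicialComplex ℝ (EuclideanSpace ℝ (Fin N))} {F τ : Finset (EuclideanSpace ℝ (Fin N))} {c : (EuclideanSpace ℝ (Fin N)) → ((EuclideanSpace ℝ (Fin N)) →ᵃ[ℝ] ℝ)} (hF : F ∈ K.faces) (hτ : τ ∈ K.faces)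
    (hc : IsCoords F c) {p : (EuclideanSpace ℝ (Fin N))} (hp : p ∈ convexHull ℝ (F : Set (EuclideanSpace ℝ (Fin N)))) (hpos : ∀ v ∈ F, 0 < c v p)
    (hpτ : p ∈ convexHull ℝ (τ : Set (EuclideanSpace ℝ (Fin N)))) : F ⊆ τ := by
  intro v hv
  by_contra hvτ
  have h := K.inter_subset_convexHull hF hτ ⟨hp, hpτ⟩
  rw [← Finset.coe_inter] at h
  have := hc.sub_zero Finset.inter_subset_left h hv (by simp [hvτ])
  exact absurd this (hpos v hv).ne'

lemma exists_center {F : Finset (EuclideanSpace ℝ (Fin N))} (hF : F.Nonempty) {c : (EuclideanSpace ℝ (Fin N)) → ((EuclideanSpace ℝ (Fin N)) →ᵃ[ℝ] ℝ)} (hc : IsCoords F c) :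
    ∃ p ∈ convexHull ℝ (F : Set (EuclideanSpace ℝ (Fin N))), ∀ v ∈ F, 0 < c v p := by
  have hcard : (0 : ℝ) < F.card := by exact_mod_cast hF.card_pos
  have h1 : ∑ y ∈ F, (fun _ : (EuclideanSpace ℝ (Fin N)) => (F.card : ℝ)⁻¹) y = 1 := by
    simp; field_simp
  refine ⟨∑ y ∈ F, (fun _ => (F.card : ℝ)⁻¹) y • y, ?_, ?_⟩
  · rw [Finset.mem_convexHull']
    exact ⟨_, fun _ _ => by positivity, h1, rfl⟩
  · intro v hv
    rw [hc.comb _ h1 hv]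
    positivity

lemma exists_nhd {K : Geometry.SimplicialComplex ℝ (EuclideanSpace ℝ (Fin N))} (hfin : K.faces.Finite) {F : Finset (EuclideanSpace ℝ (Fin N))} {c : (EuclideanSpace ℝ (Fin N)) → ((EuclideanSpace ℝ (Fin N)) →ᵃ[ℝ] ℝ)} (hF : F ∈ K.faces)
    (hc : IsCoords F c) {p : (EuclideanSpace ℝ (Fin N))} (hp : p ∈ convexHull ℝ (F : Set (EuclideanSpace ℝ (Fin N)))) (hpos : ∀ v ∈ F, 0 < c v p) :
    ∃ W : Set (EuclideanSpace ℝ (Fin N)), IsOpen W ∧ p ∈ W ∧ ∀ x ∈ W ∩ K.space, ∃ τ ∈ K.faces, F ⊆ τ ∧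
      x ∈ convexHull ℝ (τ : Set (EuclideanSpace ℝ (Fin N))) := by
  refine ⟨(⋃ τ ∈ {τ ∈ K.faces | p ∉ convexHull ℝ (τ : Set (EuclideanSpace ℝ (Fin N)))}, convexHull ℝ (τ : Set (EuclideanSpace ℝ (Fin N))))ᶜ, ?_, ?_, ?_⟩
  · rw [isOpen_compl_iff]
    apply (hfin.subset (Set.sep_subset _ _)).isClosed_biUnion
    intro τ _
    exact (τ.finite_toSet.isCompact_convexHull (𝕜 := ℝ)).isClosed
  · simp
  · rintro x ⟨hx, hxK⟩
    obtain ⟨τ, hτ, hxτ⟩ := Geometry.SimplicialComplex.mem_space_iff.1 hxK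
    refine ⟨τ, hτ, ?_, hxτ⟩
    by_cases hpt : p ∈ convexHull ℝ (τ : Set (EuclideanSpace ℝ (Fin N)))
    · exact subset_of_pos hF hτ hc hp hpos hpt
    · exact absurd (Set.mem_biUnion (show τ ∈ {τ ∈ K.faces | p ∉ convexHull ℝ (τ : Set (EuclideanSpace ℝ (Fin N)))} from ⟨hτ, hpt⟩) hxτ) hx

/-- every face with at most three vertices is a proper subface of another face -/
lemma face_extend {K : Geometry.SimplicialComplex ℝ (EuclideanSpace ℝ (Fin N))} (hfin : K.faces.Finite)
    (hX : ∀ y : K.space, ∃ χ : OpenPartialHomeomorph K.space E3, y ∈ χ.source)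
    {F : Finset (EuclideanSpace ℝ (Fin N))} (hF : F ∈ K.faces) (hcard : F.card ≤ 3) : ∃ τ ∈ K.faces, F ⊂ τ := by
  by_contra! hcon
  have hmax : ∀ τ ∈ K.faces, F ⊆ τ → τ = F := by
    intro τ hτ h
    by_contra hne
    exact hcon τ hτ (h.ssubset_of_ne (Ne.symm hne))
  obtain ⟨c, hc⟩ := exists_coords (K.indep hF)
  change IsCoords F c at hc
  obtain ⟨p, hp, hpos⟩ := exists_center (Geometry.SimplicialComplex.nonempty_of_mem_faces hF) hc
  obtain ⟨W, hW, hpW, hWs⟩ := exists_nhd hfin hF hc hp hpos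
  have hWF : ∀ x ∈ W ∩ K.space, x ∈ convexHull ℝ (F : Set (EuclideanSpace ℝ (Fin N))) := by
    intro x hx
    obtain ⟨τ, hτ, hFτ, hxτ⟩ := hWs x hx
    rwa [hmax τ hτ hFτ] at hxτ
  obtain ⟨e⟩ : Nonempty (F ↪ Fin 3) := by
    apply Function.Embedding.nonempty_of_card_le; simpa using hcard
  let φ : (EuclideanSpace ℝ (Fin N)) → E3 := fun x => WithLp.toLp 2 (fun i => ∑ v : F, if e v = i then c v x else 0)
  have hφe : ∀ x (v : F), φ x (e v) = c v x := by
    intro x v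
    simp [φ]
  have hφs : ∀ x, ∑ i, φ x i = ∑ v ∈ F, c v x := by
    intro x
    simp only [φ]
    rw [Finset.sum_comm]
    simp only [Finset.sum_ite_eq, Finset.mem_univ, if_true]
    exact Finset.sum_coe_sort F (fun v => c v x)
  have hφc : Continuous φ := by
    apply (PiLp.continuous_toLp 2 _).comp
    apply continuous_pi
    intro i
    apply continuous_finsetSum
    intro v _
    split_ifs
    · exact affine_cont _
    · exact continuous_const
  have ho := image_isOpen hX hW φ hφc.continuousOn (by
    intro x hx y hy hxy
    rw [← (hc.hull (hWF x hx)).2.2, ← (hc.hull (hWF y hy)).2.2]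
    apply Finset.sum_congr rfl
    intro v hv
    rw [← hφe x ⟨v, hv⟩, ← hφe y ⟨v, hv⟩, hxy])
  have hpX : p ∈ K.space := Geometry.SimplicialComplex.convexHull_subset_space hF hp
  obtain ⟨ε, hε, y, hy, hyε⟩ := open_dir ho ⟨p, ⟨hpW, hpX⟩, rfl⟩ (EuclideanSpace.single 0 1)
  have h1 : ∑ i, φ y i = 1 := by rw [hφs]; exact (hc.hull (hWF y hy)).2.1
  have h2 : ∑ i, φ p i = 1 := by rw [hφs]; exact (hc.hull hp).2.1
  rw [hyε] at h1
  simp [Fin.sum_univ_three] at h1 h2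
  linarith

/-- a triangle is not in exactly one tetrahedron -/
lemma not_one {K : Geometry.SimplicialComplex ℝ (EuclideanSpace ℝ (Fin N))} (hfin : K.faces.Finite)
    (hX : ∀ y : K.space, ∃ χ : OpenPartialHomeomorph K.space E3, y ∈ χ.source)
    {ρ : Finset (EuclideanSpace ℝ (Fin N))} {a : (EuclideanSpace ℝ (Fin N))} (hcard : ρ.card = 3) (ha : a ∉ ρ) (hσ : insert a ρ ∈ K.faces) :
    ∃ τ ∈ K.faces, ρ ⊆ τ ∧ ¬ τ ⊆ insert a ρ := by
  by_contra! hcon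
  have hne : ρ.Nonempty := Finset.card_pos.1 (by omega)
  have hρ : ρ ∈ K.faces := K.down_closed hσ (Finset.subset_insert _ _) hne
  obtain ⟨c, hc⟩ := exists_coords (K.indep hσ)
  change IsCoords (insert a ρ) c at hc
  have hcρ : IsCoords ρ c := fun v hv w hw => hc v (Finset.mem_insert_of_mem hv) w (Finset.mem_insert_of_mem hw)
  obtain ⟨p, hp, hpos⟩ := exists_center hne hcρ
  obtain ⟨W, hW, hpW, hWs⟩ := exists_nhd hfin hρ hcρ hp hpos
  have hWF : ∀ x ∈ W ∩ K.space, x ∈ convexHull ℝ ((insert a ρ : Finset (EuclideanSpace ℝ (Fin N))) : Set (EuclideanSpace ℝ (Fin N))) := by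
    intro x hx
    obtain ⟨τ, hτ, hFτ, hxτ⟩ := hWs x hx
    exact convexHull_mono (by exact_mod_cast hcon τ hτ hFτ) hxτ
  obtain ⟨v0, v1, v2, h01, h02, h12, rfl⟩ := Finset.card_eq_three.1 hcard
  have hp' : p ∈ convexHull ℝ ((insert a {v0, v1, v2} : Finset (EuclideanSpace ℝ (Fin N))) : Set (EuclideanSpace ℝ (Fin N))) :=
    convexHull_mono (by exact_mod_cast Finset.subset_insert _ _) hp
  simp only [Finset.mem_insert, Finset.mem_singleton, not_or] at ha
  obtain ⟨ha0, ha1, ha2⟩ := ha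
  let φ : (EuclideanSpace ℝ (Fin N)) → E3 := fun x => !₂[c a x, c v0 x, c v1 x]
  have hφc : Continuous φ := by
    apply (PiLp.continuous_toLp 2 _).comp
    apply continuous_pi
    intro i
    fin_cases i <;> exact affine_cont _
  have hsum : ∀ x ∈ convexHull ℝ ((insert a {v0, v1, v2} : Finset (EuclideanSpace ℝ (Fin N))) : Set (EuclideanSpace ℝ (Fin N))),
      c a x + (c v0 x + (c v1 x + c v2 x)) = 1 ∧
      c a x • a + (c v0 x • v0 + (c v1 x • v1 + c v2 x • v2)) = x := by
    intro x hx
    obtain ⟨-, h1, h2⟩ := hc.hull hx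
    have e1 : a ∉ ({v0, v1, v2} : Finset (EuclideanSpace ℝ (Fin N))) := by simp [ha0, ha1, ha2]
    have e2 : v0 ∉ ({v1, v2} : Finset (EuclideanSpace ℝ (Fin N))) := by simp [h01, h02]
    have e3 : v1 ∉ ({v2} : Finset (EuclideanSpace ℝ (Fin N))) := by simp [h12]
    rw [Finset.sum_insert e1, Finset.sum_insert e2, Finset.sum_insert e3, Finset.sum_singleton] at h1 h2
    exact ⟨h1, h2⟩
  have ho := image_isOpen hX hW φ hφc.continuousOn (by
    intro x hx y hy hxy
    obtain ⟨hx1, hx2⟩ := hsum x (hWF x hx)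
    obtain ⟨hy1, hy2⟩ := hsum y (hWF y hy)
    have q0 : c a x = c a y := congrArg (fun z : E3 => z 0) hxy
    have q1 : c v0 x = c v0 y := congrArg (fun z : E3 => z 1) hxy
    have q2 : c v1 x = c v1 y := congrArg (fun z : E3 => z 2) hxy
    have q3 : c v2 x = c v2 y := by linarith
    rw [← hx2, ← hy2, q0, q1, q2, q3])
  have hpX : p ∈ K.space := Geometry.SimplicialComplex.convexHull_subset_space hρ hp
  obtain ⟨ε, hε, y, hy, hyε⟩ := open_dir ho ⟨p, ⟨hpW, hpX⟩, rfl⟩ (EuclideanSpace.single 0 (-1))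
  have hcp : c a p = 0 := hc.sub_zero (Finset.subset_insert _ _) hp (Finset.mem_insert_self _ _)
    (by simp [ha0, ha1, ha2])
  have hya : 0 ≤ c a y := (hc.hull (hWF y hy)).1 a (Finset.mem_insert_self _ _)
  have h3 : c a y = -ε := by
    have := congrArg (fun z : E3 => z 0) hyε
    simpa [φ, hcp] using this
  linarith
end

section
variable {N : ℕ}

/-- coordinates of a four-point combination -/
lemma four_coords {v0 v1 v2 a : EuclideanSpace ℝ (Fin N)} (h01 : v0 ≠ v1) (h02 : v0 ≠ v2)
    (h12 : v1 ≠ v2) (ha0 : a ≠ v0) (ha1 : a ≠ v1) (ha2 : a ≠ v2)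
    {c : EuclideanSpace ℝ (Fin N) → (EuclideanSpace ℝ (Fin N) →ᵃ[ℝ] ℝ)}
    (hc : IsCoords (insert a {v0, v1, v2}) c) (x0 x1 x2 : ℝ) :
    c v0 (x2 • a + (x0 • v0 + (x1 • v1 + (1 - x0 - x1 - x2) • v2))) = x0 ∧
    c v1 (x2 • a + (x0 • v0 + (x1 • v1 + (1 - x0 - x1 - x2) • v2))) = x1 ∧
    c a (x2 • a + (x0 • v0 + (x1 • v1 + (1 - x0 - x1 - x2) • v2))) = x2 := by
  have e1 : a ∉ ({v0, v1, v2} : Finset (EuclideanSpace ℝ (Fin N))) := by simp [ha0, ha1, ha2]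
  have e2 : v0 ∉ ({v1, v2} : Finset (EuclideanSpace ℝ (Fin N))) := by simp [h01, h02]
  have e3 : v1 ∉ ({v2} : Finset (EuclideanSpace ℝ (Fin N))) := by simp [h12]
  let w : EuclideanSpace ℝ (Fin N) → ℝ := fun y =>
    if y = a then x2 else if y = v0 then x0 else if y = v1 then x1 else 1 - x0 - x1 - x2
  have wa : w a = x2 := by simp [w]
  have w0 : w v0 = x0 := by simp [w, ha0.symm]
  have w1 : w v1 = x1 := by simp [w, ha1.symm, h01.symm]
  have w2 : w v2 = 1 - x0 - x1 - x2 := by simp [w, ha2.symm, h02.symm, h12.symm]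
  have hs : ∑ y ∈ insert a ({v0, v1, v2} : Finset (EuclideanSpace ℝ (Fin N))), w y = 1 := by
    rw [Finset.sum_insert e1, Finset.sum_insert e2, Finset.sum_insert e3, Finset.sum_singleton,
      wa, w0, w1, w2]
    ring
  have hx : ∑ y ∈ insert a ({v0, v1, v2} : Finset (EuclideanSpace ℝ (Fin N))), w y • y =
      x2 • a + (x0 • v0 + (x1 • v1 + (1 - x0 - x1 - x2) • v2)) := by
    rw [Finset.sum_insert e1, Finset.sum_insert e2, Finset.sum_insert e3, Finset.sum_singleton,
      wa, w0, w1, w2]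
  rw [← hx]
  refine ⟨?_, ?_, ?_⟩
  · rw [hc.comb w hs (by simp), w0]
  · rw [hc.comb w hs (by simp), w1]
  · rw [hc.comb w hs (by simp), wa]

lemma four_hull {v0 v1 v2 a : EuclideanSpace ℝ (Fin N)} {x0 x1 x2 : ℝ} (h0 : 0 ≤ x0) (h1 : 0 ≤ x1)
    (h2 : 0 ≤ x2) (h : x0 + x1 + x2 ≤ 1) :
    x2 • a + (x0 • v0 + (x1 • v1 + (1 - x0 - x1 - x2) • v2)) ∈
      convexHull ℝ ((insert a {v0, v1, v2} : Finset (EuclideanSpace ℝ (Fin N))) :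
        Set (EuclideanSpace ℝ (Fin N))) := by
  have hm : ∀ y ∈ (insert a {v0, v1, v2} : Finset (EuclideanSpace ℝ (Fin N))),
      y ∈ convexHull ℝ ((insert a {v0, v1, v2} : Finset (EuclideanSpace ℝ (Fin N))) :
        Set (EuclideanSpace ℝ (Fin N))) := fun y hy => subset_convexHull _ _ hy
  have hcv := convex_convexHull ℝ ((insert a {v0, v1, v2} : Finset (EuclideanSpace ℝ (Fin N))) :
        Set (EuclideanSpace ℝ (Fin N)))
  have := hcv.sum_mem (t := Finset.univ) (w := ![x2, x0, x1, 1 - x0 - x1 - x2])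
    (z := ![a, v0, v1, v2]) (by
      intro i _
      fin_cases i <;> simp <;> linarith) (by
      simp [Fin.sum_univ_four]; ring) (by
      intro i _
      fin_cases i <;> apply hm <;> simp)
  simpa [Fin.sum_univ_four, add_assoc] using this

/-- a triangle lies in at most two tetrahedra -/
lemma at_most_two {K : Geometry.SimplicialComplex ℝ (EuclideanSpace ℝ (Fin N))}
    (hX : ∀ y : K.space, ∃ χ : OpenPartialHomeomorph K.space E3, y ∈ χ.source)
    {ρ τ : Finset (EuclideanSpace ℝ (Fin N))} {a b : EuclideanSpace ℝ (Fin N)} (hcard : ρ.card = 3)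
    (ha : a ∉ ρ) (hb : b ∉ ρ) (hab : a ≠ b) (hσa : insert a ρ ∈ K.faces)
    (hσb : insert b ρ ∈ K.faces) (hτ : τ ∈ K.faces) (hρτ : ρ ⊆ τ) :
    τ ⊆ insert a ρ ∨ τ ⊆ insert b ρ := by
  obtain ⟨v0, v1, v2, h01, h02, h12, rfl⟩ := Finset.card_eq_three.1 hcard
  have ha' := ha
  have hb' := hb
  simp only [Finset.mem_insert, Finset.mem_singleton, not_or] at ha hb
  obtain ⟨ha0, ha1, ha2⟩ := ha
  obtain ⟨hb0, hb1, hb2⟩ := hb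
  obtain ⟨c, hc⟩ := exists_coords (K.indep hσa)
  change IsCoords (insert a {v0, v1, v2}) c at hc
  obtain ⟨d, hd⟩ := exists_coords (K.indep hσb)
  change IsCoords (insert b {v0, v1, v2}) d at hd
  let P : EuclideanSpace ℝ (Fin N) → ℝ → ℝ → ℝ → EuclideanSpace ℝ (Fin N) := fun a x0 x1 x2 =>
    x2 • a + (x0 • v0 + (x1 • v1 + (1 - x0 - x1 - x2) • v2))
  let g : E3 → EuclideanSpace ℝ (Fin N) := fun x =>
    max (x 2) 0 • a + max (-x 2) 0 • b + (x 0 • v0 + (x 1 • v1 + (1 - x 0 - x 1 - |x 2|) • v2))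
  have hgp : ∀ x : E3, 0 ≤ x 2 → g x = P a (x 0) (x 1) (x 2) := by
    intro x hx
    simp [g, P, max_eq_left hx, abs_of_nonneg hx, max_eq_right (neg_nonpos.2 hx)]
  have hgn : ∀ x : E3, x 2 ≤ 0 → g x = P b (x 0) (x 1) (-x 2) := by
    intro x hx
    simp [g, P, max_eq_right hx, abs_of_nonpos hx, max_eq_left (neg_nonneg.2 hx)]
  let U : Set E3 := {x | 0 < x 0 ∧ 0 < x 1 ∧ x 0 + x 1 + |x 2| < 1}
  have hU : IsOpen U := by
    have e0 : Continuous fun x : E3 => x 0 := by fun_prop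
    have e1 : Continuous fun x : E3 => x 1 := by fun_prop
    have e2 : Continuous fun x : E3 => x 2 := by fun_prop
    exact (isOpen_lt continuous_const e0).inter ((isOpen_lt continuous_const e1).inter
      (isOpen_lt ((e0.add e1).add e2.abs) continuous_const))
  have hgc : Continuous g := by
    have e0 : Continuous fun x : E3 => x 0 := by fun_prop
    have e1 : Continuous fun x : E3 => x 1 := by fun_prop
    have e2 : Continuous fun x : E3 => x 2 := by fun_prop
    have e3 : Continuous fun x : E3 => max (x 2) 0 := e2.max continuous_const
    have e4 : Continuous fun x : E3 => max (-x 2) 0 := e2.neg.max continuous_const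
    have e5 : Continuous fun x : E3 => |x 2| := e2.abs
    exact ((e3.smul continuous_const).add (e4.smul continuous_const)).add
      ((e0.smul continuous_const).add ((e1.smul continuous_const).add
        ((((continuous_const.sub e0).sub e1).sub e5).smul continuous_const)))
  have hpa : ∀ x ∈ U, 0 ≤ x 2 → g x ∈ convexHull ℝ
      ((insert a {v0, v1, v2} : Finset (EuclideanSpace ℝ (Fin N))) :
        Set (EuclideanSpace ℝ (Fin N))) := by
    rintro x ⟨h0, h1, h2⟩ hx
    rw [hgp x hx]
    rw [abs_of_nonneg hx] at h2
    exact four_hull h0.le h1.le hx h2.le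
  have hpb : ∀ x ∈ U, x 2 ≤ 0 → g x ∈ convexHull ℝ
      ((insert b {v0, v1, v2} : Finset (EuclideanSpace ℝ (Fin N))) :
        Set (EuclideanSpace ℝ (Fin N))) := by
    rintro x ⟨h0, h1, h2⟩ hx
    rw [hgn x hx]
    rw [abs_of_nonpos hx] at h2
    exact four_hull h0.le h1.le (neg_nonneg.2 hx) h2.le
  have hmix : ∀ x ∈ U, ∀ y ∈ U, 0 < x 2 → y 2 ≤ 0 → g x ≠ g y := by
    intro x hx y hy hx2 hy2 hxy
    have h1 := hpa x hx hx2.le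
    have h2 := hpb y hy hy2
    rw [← hxy] at h2
    have h := K.inter_subset_convexHull hσa hσb ⟨h1, h2⟩
    rw [← Finset.coe_inter] at h
    have hz := hc.sub_zero Finset.inter_subset_left h (Finset.mem_insert_self _ _)
      (by simp [hab, ha0, ha1, ha2])
    rw [hgp x hx2.le] at hz
    have := (four_coords h01 h02 h12 ha0 ha1 ha2 hc (x 0) (x 1) (x 2)).2.2
    simp only [P] at hz
    linarith
  have hinj : Set.InjOn g U := by
    intro x hx y hy hxy
    rcases le_or_gt (x 2) 0 with hx2 | hx2 <;> rcases le_or_gt (y 2) 0 with hy2 | hy2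
    · rw [hgn x hx2, hgn y hy2] at hxy
      have A := four_coords h01 h02 h12 hb0 hb1 hb2 hd (x 0) (x 1) (-x 2)
      have B := four_coords h01 h02 h12 hb0 hb1 hb2 hd (y 0) (y 1) (-y 2)
      simp only [P] at hxy
      rw [hxy] at A
      ext i
      fin_cases i
      · exact A.1.symm.trans B.1
      · exact A.2.1.symm.trans B.2.1
      · exact neg_injective (A.2.2.symm.trans B.2.2)
    · exact absurd hxy.symm (hmix y hy x hx hy2 hx2)
    · exact absurd hxy (hmix x hx y hy hx2 hy2)
    · rw [hgp x hx2.le, hgp y hy2.le] at hxy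
      have A := four_coords h01 h02 h12 ha0 ha1 ha2 hc (x 0) (x 1) (x 2)
      have B := four_coords h01 h02 h12 ha0 ha1 ha2 hc (y 0) (y 1) (y 2)
      simp only [P] at hxy
      rw [hxy] at A
      ext i
      fin_cases i
      · exact A.1.symm.trans B.1
      · exact A.2.1.symm.trans B.2.1
      · exact A.2.2.symm.trans B.2.2
  have hmap : Set.MapsTo g U K.space := by
    intro x hx
    rcases le_total (x 2) 0 with h | h
    · exact Geometry.SimplicialComplex.convexHull_subset_space hσb (hpb x hx h)
    · exact Geometry.SimplicialComplex.convexHull_subset_space hσa (hpa x hx h)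
  let x0 : E3 := !₂[1/3, 1/3, 0]
  have hx0 : x0 ∈ U := by
    refine ⟨?_, ?_, ?_⟩ <;> simp [x0]
    norm_num
  have hn := image_mem_nhdsWithin hX hU g hgc.continuousOn hinj hmap hx0
  set p := g x0 with hpdef
  have hpρ : p ∈ convexHull ℝ (τ : Set (EuclideanSpace ℝ (Fin N))) := by
    have h1 := hpa x0 hx0 (by simp [x0])
    have h2 := hpb x0 hx0 (by simp [x0])
    have h := K.inter_subset_convexHull hσa hσb ⟨h1, h2⟩
    refine convexHull_mono ?_ h
    rintro y ⟨hy1, hy2⟩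
    simp only [Finset.coe_insert, Finset.coe_singleton, Set.mem_insert_iff, Set.mem_singleton_iff] at hy1 hy2
    apply hρτ
    simp only [Finset.mem_insert, Finset.mem_singleton]
    rcases hy1 with rfl | h
    · rcases hy2 with h | h
      · exact absurd h hab
      · exact h
    · exact h
  obtain ⟨t, ht⟩ := exists_coords (K.indep hτ)
  change IsCoords τ t at ht
  obtain ⟨q, hq, hqpos⟩ := exists_center (Geometry.SimplicialComplex.nonempty_of_mem_faces hτ) ht
  obtain ⟨W, hW, hpW, hWs⟩ := mem_nhdsWithin.1 hn
  have hcont : Continuous fun ε : ℝ => AffineMap.lineMap p q ε := AffineMap.lineMap_continuous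
  have hpre : (fun ε : ℝ => AffineMap.lineMap p q ε) ⁻¹' W ∈ nhds (0 : ℝ) :=
    (hW.preimage hcont).mem_nhds (by simpa using hpW)
  obtain ⟨η, hη, hs⟩ := Metric.mem_nhds_iff.1 hpre
  obtain ⟨ε, hε0, hε1, hεη⟩ : ∃ ε : ℝ, 0 < ε ∧ ε ≤ 1 ∧ ε < η :=
    ⟨min 1 (η / 2), lt_min one_pos (by positivity), min_le_left _ _,
      lt_of_le_of_lt (min_le_right _ _) (by linarith)⟩
  have hrW : AffineMap.lineMap p q ε ∈ W := hs (by simpa [abs_of_pos hε0] using hεη)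
  have hrτ : AffineMap.lineMap p q ε ∈ convexHull ℝ (τ : Set (EuclideanSpace ℝ (Fin N))) :=
    (convex_convexHull ℝ _).lineMap_mem hpρ hq ⟨hε0.le, hε1⟩
  have hrpos : ∀ v ∈ τ, 0 < t v (AffineMap.lineMap p q ε) := by
    intro v hv
    rw [AffineMap.apply_lineMap, AffineMap.lineMap_apply_ring']
    have h1 := (ht.hull hpρ).1 v hv
    have h2 := hqpos v hv
    nlinarith
  obtain ⟨x, hx, hxr⟩ := hWs ⟨hrW, Geometry.SimplicialComplex.convexHull_subset_space hτ hrτ⟩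
  rcases le_total (x 2) 0 with h | h
  · right
    exact subset_of_pos hτ hσb ht hrτ hrpos (hxr ▸ hpb x hx h)
  · left
    exact subset_of_pos hτ hσa ht hrτ hrpos (hxr ▸ hpa x hx h)
end

section graph
variable {V : Type*} [Fintype V]

/-- independent sets of a graph -/
def IndSet (H : SimpleGraph V) (S : Finset V) : Prop := ∀ x ∈ S, ∀ y ∈ S, ¬ H.Adj x y

/-- the local properties of the complement graph of the triangulation -/
structure Good (H : SimpleGraph V) : Prop where
  ext : ∀ S, IndSet H S → S.card ≤ 3 → ∃ x, x ∉ S ∧ IndSet H (insert x S)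
  flip : ∀ ρ, IndSet H ρ → ρ.card = 3 → ∃ a b, a ≠ b ∧ a ∉ ρ ∧ b ∉ ρ ∧ IndSet H (insert a ρ) ∧
    IndSet H (insert b ρ) ∧ H.Adj a b ∧ ∀ x, x ∉ ρ → IndSet H (insert x ρ) → x = a ∨ x = b

lemma IndSet.insert {H : SimpleGraph V} {S : Finset V} (h : IndSet H S) {x : V}
    (hx : ∀ y ∈ S, ¬ H.Adj x y) : IndSet H (insert x S) := by
  intro u hu w hw
  rcases Finset.mem_insert.1 hu with rfl | hu1 <;> rcases Finset.mem_insert.1 hw with rfl | hw1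
  · exact H.irrefl
  · exact hx w hw1
  · exact fun hh => hx u hu1 hh.symm
  · exact h u hu1 w hw1

lemma Good.of_local {H : SimpleGraph V}
    (hext : ∀ S, IndSet H S → S.card ≤ 3 → ∃ x, x ∉ S ∧ ∀ y ∈ S, ¬ H.Adj x y)
    (hflip : ∀ ρ, IndSet H ρ → ρ.card = 3 → ∃ a b, a ≠ b ∧ a ∉ ρ ∧ b ∉ ρ ∧
      (∀ y ∈ ρ, ¬ H.Adj a y) ∧ (∀ y ∈ ρ, ¬ H.Adj b y) ∧ H.Adj a b ∧
      ∀ x, x ∉ ρ → (∀ y ∈ ρ, ¬ H.Adj x y) → x = a ∨ x = b) : Good H := by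
  refine ⟨?_, ?_⟩
  · intro S hS hc
    obtain ⟨x, hx, h⟩ := hext S hS hc
    exact ⟨x, hx, hS.insert h⟩
  · intro ρ hρ hc
    obtain ⟨a, b, hab, ha, hb, ha2, hb2, hadj, hun⟩ := hflip ρ hρ hc
    refine ⟨a, b, hab, ha, hb, hρ.insert ha2, hρ.insert hb2, hadj, ?_⟩
    intro x hx hI
    exact hun x hx (fun y hy => hI x (Finset.mem_insert_self _ _) y (Finset.mem_insert_of_mem hy))

lemma indSet_empty {H : SimpleGraph V} : IndSet H ∅ := by intro x hx; simp at hx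

lemma indSet_singleton {H : SimpleGraph V} (v : V) : IndSet H {v} := by
  intro x hx y hy
  simp only [Finset.mem_singleton] at hx hy
  subst hx; subst hy; exact H.irrefl

lemma indSet_pair {H : SimpleGraph V} {v w : V} (h : ¬ H.Adj v w) : IndSet H {v, w} := by
  apply (indSet_singleton w).insert
  simpa using h

lemma Good.ext4 {H : SimpleGraph V} (hH : Good H) {S : Finset V} (hS : IndSet H S)
    (hc : S.card ≤ 4) : ∃ T, S ⊆ T ∧ IndSet H T ∧ T.card = 4 := by
  obtain ⟨n, hn⟩ : ∃ n, S.card + n = 4 := ⟨4 - S.card, by omega⟩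
  induction n generalizing S with
  | zero => exact ⟨S, subset_rfl, hS, by omega⟩
  | succ n ih =>
    obtain ⟨x, hx, hi⟩ := hH.ext S hS (by omega)
    have hcx := Finset.card_insert_of_notMem hx
    obtain ⟨T, h1, h2, h3⟩ := ih hi (by omega) (by omega)
    exact ⟨T, (Finset.subset_insert _ _).trans h1, h2, h3⟩

lemma Good.flip4 {H : SimpleGraph V} (hH : Good H) {S : Finset V} (hS : IndSet H S)
    (hc : S.card = 4) {v : V} (hv : v ∈ S) :
    ∃ b, H.Adj v b ∧ (∀ y ∈ S, y ≠ v → ¬ H.Adj y b) ∧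
      ∀ x, x ∉ S → (∀ y ∈ S, y ≠ v → ¬ H.Adj x y) → x = b := by
  have hρ : IndSet H (S.erase v) := fun x hx y hy =>
    hS x (Finset.mem_of_mem_erase hx) y (Finset.mem_of_mem_erase hy)
  obtain ⟨a, b, hab, ha, hb, hIa, hIb, hadj, huniq⟩ := hH.flip (S.erase v) hρ
    (by rw [Finset.card_erase_of_mem hv, hc])
  have hvv : v = a ∨ v = b := huniq v (Finset.notMem_erase v S) (by rwa [Finset.insert_erase hv])
  have key : ∀ a b, (b ∉ S.erase v) → IndSet H (insert b (S.erase v)) → H.Adj a b →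
      (∀ x, x ∉ S.erase v → IndSet H (insert x (S.erase v)) → x = a ∨ x = b) → v = a →
      ∃ b, H.Adj v b ∧ (∀ y ∈ S, y ≠ v → ¬ H.Adj y b) ∧
      ∀ x, x ∉ S → (∀ y ∈ S, y ≠ v → ¬ H.Adj x y) → x = b := by
    rintro a b hb hIb hadj huniq rfl
    refine ⟨b, hadj, ?_, ?_⟩
    · intro y hy hyv
      exact hIb y (Finset.mem_insert_of_mem (Finset.mem_erase.2 ⟨hyv, hy⟩)) b
        (Finset.mem_insert_self _ _)
    · intro x hx hxy
      rcases huniq x (fun h => hx (Finset.mem_of_mem_erase h)) (hρ.insert (fun y hy =>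
        hxy y (Finset.mem_of_mem_erase hy) (Finset.ne_of_mem_erase hy))) with h | h
      · subst h; exact absurd hv hx
      · exact h
  rcases hvv with h | h
  · exact key a b hb hIb hadj huniq h
  · exact key b a ha hIa hadj.symm (fun x hx hx' => (huniq x hx hx').symm) h

lemma Good.exists_adj {H : SimpleGraph V} (hH : Good H) (v : V) : ∃ w, H.Adj v w := by
  obtain ⟨T, h1, h2, h3⟩ := hH.ext4 (indSet_singleton (H := H) v) (by simp)
  obtain ⟨b, hb, -⟩ := hH.flip4 h2 h3 (h1 (Finset.mem_singleton_self v))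
  exact ⟨b, hb⟩

lemma Good.leaf {H : SimpleGraph V} (hH : Good H) {v w : V}
    (h : ∀ y, H.Adj v y → y = w) : ∀ y, H.Adj w y → y = v := by
  intro x hx
  by_contra hne
  have hvx : ¬ H.Adj v x := fun hvx => by
    have := h x hvx
    subst this
    exact H.irrefl hx
  obtain ⟨T, h1, h2, h3⟩ := hH.ext4 (indSet_pair hvx) (by
    refine (Finset.card_insert_le _ _).trans ?_
    simp)
  obtain ⟨b, hb, hb2, -⟩ := hH.flip4 h2 h3 (h1 (Finset.mem_insert_self _ _))
  have := h b hb
  subst this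
  exact hb2 x (h1 (by simp)) hne hx.symm

/-- exactly two extensions of an independent triple -/
lemma Good.two_ext {H : SimpleGraph V} (hH : Good H) {x y z : V} (hxy : x ≠ y) (hxz : x ≠ z)
    (hyz : y ≠ z) (h1 : ¬ H.Adj x y) (h2 : ¬ H.Adj x z) (h3 : ¬ H.Adj y z) :
    ∃ a b, a ≠ b ∧ ∀ u, (u = a ∨ u = b) ↔
      (u ≠ x ∧ u ≠ y ∧ u ≠ z ∧ ¬ H.Adj u x ∧ ¬ H.Adj u y ∧ ¬ H.Adj u z) := by
  have hI : IndSet H {x, y, z} := by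
    apply (indSet_pair h3).insert
    simp [h1, h2]
  obtain ⟨a, b, hab, ha, hb, hIa, hIb, -, hun⟩ := hH.flip {x, y, z} hI (by
    rw [Finset.card_eq_three]; exact ⟨x, y, z, hxy, hxz, hyz, rfl⟩)
  have aux : ∀ u, u ∉ ({x, y, z} : Finset V) → IndSet H (insert u {x, y, z}) →
      (u ≠ x ∧ u ≠ y ∧ u ≠ z ∧ ¬ H.Adj u x ∧ ¬ H.Adj u y ∧ ¬ H.Adj u z) := by
    intro u hu hIu
    simp only [Finset.mem_insert, Finset.mem_singleton, not_or] at hu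
    exact ⟨hu.1, hu.2.1, hu.2.2, hIu u (by simp) x (by simp), hIu u (by simp) y (by simp),
      hIu u (by simp) z (by simp)⟩
  refine ⟨a, b, hab, fun u => ⟨?_, ?_⟩⟩
  · rintro (rfl | rfl)
    · exact aux _ ha hIa
    · exact aux _ hb hIb
  · rintro ⟨h1, h2, h3, h4, h5, h6⟩
    apply hun u (by simp [h1, h2, h3])
    apply hI.insert
    simp [h4, h5, h6]

lemma leaf_of_deg {H : SimpleGraph V} {v : V} (h : H.degree v ≤ 1) {w : V} (hw : H.Adj v w) :
    ∀ y, H.Adj v y → y = w := by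
  intro y hy
  rw [← H.card_neighborFinset_eq_degree] at h
  exact Finset.card_le_one.1 h y (by simpa using hy) w (by simpa using hw)

/-- two isolated edges are impossible -/
lemma Good.no_two_leaves {H : SimpleGraph V} (hH : Good H) (hV : Fintype.card V = 10)
    (hsum : ∑ v, H.degree v ≤ 20) {v w v' w' : V} (hvw : H.Adj v w) (hvw' : H.Adj v' w')
    (hv : ∀ y, H.Adj v y → y = w) (hw : ∀ y, H.Adj w y → y = v)
    (hv' : ∀ y, H.Adj v' y → y = w') (hw' : ∀ y, H.Adj w' y → y = v')
    (h1 : v' ≠ v) (h2 : v' ≠ w) : False := by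
  have h3 : w' ≠ v := by rintro rfl; exact h2 (hv _ hvw'.symm)
  have h4 : w' ≠ w := by rintro rfl; exact h1 (hw _ hvw'.symm)
  have h5 := hvw.ne
  have h6 := hvw'.ne
  let Q : Finset V := {v, w, v', w'}
  have hQ : Q.card = 4 := by
    simp [Q, h1.symm, h2.symm, h3.symm, h4.symm, h5, h6]
  have hR : Qᶜ.card = 6 := by rw [Finset.card_compl, hV, hQ]
  have hdeg : ∀ x ∈ Qᶜ, 3 ≤ H.degree x := by
    intro x hx
    simp only [Q, Finset.mem_compl, Finset.mem_insert, Finset.mem_singleton, not_or] at hx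
    obtain ⟨x1, x2, x3, x4⟩ := hx
    obtain ⟨a, b, -, hab⟩ := hH.two_ext (x := x) (y := v) (z := v') x1 x3 h1.symm
      (fun h => x2 (hv x h.symm)) (fun h => x4 (hv' x h.symm)) (fun h => h2 (hv _ h))
    have hsub : Qᶜ ⊆ {x, a, b} ∪ H.neighborFinset x := by
      intro u hu
      simp only [Q, Finset.mem_compl, Finset.mem_insert, Finset.mem_singleton, not_or] at hu
      obtain ⟨u1, u2, u3, u4⟩ := hu
      simp only [Finset.mem_union, Finset.mem_insert, Finset.mem_singleton,
        SimpleGraph.mem_neighborFinset]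
      by_cases hux : u = x
      · exact Or.inl (Or.inl hux)
      by_cases hadj : H.Adj x u
      · exact Or.inr hadj
      · exact Or.inl (Or.inr ((hab u).2 ⟨hux, u1, u3, fun h => hadj h.symm,
          fun h => u2 (hv u h.symm), fun h => u4 (hv' u h.symm)⟩))
    have := (Finset.card_le_card hsub).trans (Finset.card_union_le _ _)
    rw [hR, H.card_neighborFinset_eq_degree] at this
    have h3 := Finset.card_le_three (a := x) (b := a) (c := b)
    omega
  have hdeg1 : ∀ x ∈ Q, 1 ≤ H.degree x := by
    intro x _
    obtain ⟨y, hy⟩ := hH.exists_adj x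
    rw [← H.card_neighborFinset_eq_degree]
    exact Finset.card_pos.2 ⟨y, by simpa using hy⟩
  have s1 := Finset.card_nsmul_le_sum _ _ _ hdeg
  have s2 := Finset.card_nsmul_le_sum _ _ _ hdeg1
  have s3 := Finset.sum_add_sum_compl Q (fun v => H.degree v)
  rw [hR] at s1
  rw [hQ] at s2
  simp only [smul_eq_mul] at s1 s2
  omega

/-- one isolated edge with all other degrees at least two is impossible -/
lemma Good.no_one_leaf {H : SimpleGraph V} (hH : Good H) (hV : Fintype.card V = 10)
    {m : ℕ} (hm : ∑ v, H.degree v = 2 * m) (hm2 : m ≤ 10)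
    {v w : V} (hvw : H.Adj v w)
    (hv : ∀ y, H.Adj v y → y = w) (hw : ∀ y, H.Adj w y → y = v)
    (hdeg : ∀ x, x ≠ v → x ≠ w → 2 ≤ H.degree x) : False := by
  let Q : Finset V := {v, w}
  have hQ : Q.card = 2 := by simp [Q, hvw.ne]
  let R := Qᶜ
  have hR : R.card = 8 := by simp only [R]; rw [Finset.card_compl, hV, hQ]
  have hmemR : ∀ x, x ∈ R ↔ x ≠ v ∧ x ≠ w := by intro x; simp [R, Q]
  have dv : H.degree v = 1 := by
    rw [← H.card_neighborFinset_eq_degree, Finset.card_eq_one]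
    refine ⟨w, ?_⟩
    ext y
    simp only [SimpleGraph.mem_neighborFinset, Finset.mem_singleton]
    exact ⟨hv y, fun h => h ▸ hvw⟩
  have dw : H.degree w = 1 := by
    rw [← H.card_neighborFinset_eq_degree, Finset.card_eq_one]
    refine ⟨v, ?_⟩
    ext y
    simp only [SimpleGraph.mem_neighborFinset, Finset.mem_singleton]
    exact ⟨hw y, fun h => h ▸ hvw.symm⟩
  have s3 := Finset.sum_add_sum_compl Q (fun v => H.degree v)
  have s2 : ∑ x ∈ Q, H.degree x = 2 := by
    simp only [Q]; rw [Finset.sum_pair hvw.ne, dv, dw]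
  have s1 := Finset.card_nsmul_le_sum R (fun x => H.degree x) 2
    (fun x hx => hdeg x ((hmemR x).1 hx).1 ((hmemR x).1 hx).2)
  rw [hR] at s1
  simp only [smul_eq_mul] at s1
  have hRsum : ∑ x ∈ R, H.degree x + 2 = 2 * m := by simp only [R]; omega
  -- ordered nonadjacent pairs
  let A : V → Finset V := fun x => R.filter (fun y => y ≠ x ∧ ¬ H.Adj x y)
  have hA : ∀ x ∈ R, (A x).card + H.degree x = 7 := by
    intro x hx
    have hnb : H.neighborFinset x ⊆ R.erase x := by
      intro y hy
      rw [SimpleGraph.mem_neighborFinset] at hy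
      rw [Finset.mem_erase, hmemR]
      obtain ⟨x1, x2⟩ := (hmemR x).1 hx
      refine ⟨hy.ne', ?_, ?_⟩
      · rintro rfl; exact x2 (hv _ hy.symm)
      · rintro rfl; exact x1 (hw _ hy.symm)
    have hAe : A x = R.erase x \ H.neighborFinset x := by
      ext y
      simp only [A, Finset.mem_filter, Finset.mem_sdiff, Finset.mem_erase,
        SimpleGraph.mem_neighborFinset]
      tauto
    have := Finset.card_sdiff_add_card_eq_card hnb
    rw [hAe, ← H.card_neighborFinset_eq_degree, this, Finset.card_erase_of_mem hx, hR]
  have hAsum : ∑ x ∈ R, (A x).card + ∑ x ∈ R, H.degree x = 56 := by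
    rw [← Finset.sum_add_distrib, Finset.sum_congr rfl hA]
    simp [hR]
  let P : Finset (Σ _ : V, V) := R.sigma A
  have hP : P.card = ∑ x ∈ R, (A x).card := Finset.card_sigma _ _
  let T : Finset (Finset V) := (R.powersetCard 3).filter (IndSet H)
  have hmemP : ∀ x y, (⟨x, y⟩ : Σ _ : V, V) ∈ P ↔ x ∈ R ∧ y ∈ R ∧ y ≠ x ∧ ¬ H.Adj x y := by
    intro x y; simp [P, A]
  have hmemT : ∀ t, t ∈ T ↔ (t ⊆ R ∧ t.card = 3) ∧ IndSet H t := by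
    intro t; simp [T, Finset.mem_powersetCard]
  have hcount := Finset.sum_card_bipartiteAbove_eq_sum_card_bipartiteBelow
    (s := P) (t := T) (fun p t => p.1 ∈ t ∧ p.2 ∈ t)
  have hL : ∀ p ∈ P, (T.bipartiteAbove (fun (p : Σ _ : V, V) t => p.1 ∈ t ∧ p.2 ∈ t) p).card = 2 := by
    rintro ⟨x, y⟩ hp
    obtain ⟨hx, hy, hyx, hadj⟩ := (hmemP x y).1 hp
    obtain ⟨x1, x2⟩ := (hmemR x).1 hx
    obtain ⟨y1, y2⟩ := (hmemR y).1 hy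
    obtain ⟨a, b, hab, hiff⟩ := hH.two_ext (x := x) (y := y) (z := v) hyx.symm x1 y1 hadj
      (fun h => x2 (hv x h.symm)) (fun h => y2 (hv y h.symm))
    have hiff' : ∀ u, (u = a ∨ u = b) ↔ u ∈ R ∧ u ≠ x ∧ u ≠ y ∧ ¬ H.Adj u x ∧ ¬ H.Adj u y := by
      intro u
      rw [hiff u, hmemR]
      constructor
      · rintro ⟨h1, h2, h3, h4, h5, h6⟩
        exact ⟨⟨h3, fun h => h6 (h ▸ hvw.symm)⟩, h1, h2, h4, h5⟩
      · rintro ⟨⟨h1, h2⟩, h3, h4, h5, h6⟩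
        exact ⟨h3, h4, h1, h5, h6, fun h => h2 (hv u h.symm)⟩
    rw [Finset.card_eq_two]
    obtain ⟨a1, a2, a3, -, -⟩ := (hiff' a).1 (Or.inl rfl)
    obtain ⟨b1, b2, b3, -, -⟩ := (hiff' b).1 (Or.inr rfl)
    refine ⟨{a, x, y}, {b, x, y}, ?_, ?_⟩
    · intro h
      have : a ∈ ({b, x, y} : Finset V) := h ▸ Finset.mem_insert_self _ _
      simp [hab, a2, a3] at this
    · ext t
      rw [Finset.mem_bipartiteAbove, hmemT]
      simp only [Finset.mem_insert, Finset.mem_singleton]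
      constructor
      · rintro ⟨⟨⟨htR, ht3⟩, htI⟩, hxt, hyt⟩
        have hsub : ({x, y} : Finset V) ⊆ t := by
          intro z hz
          simp only [Finset.mem_insert, Finset.mem_singleton] at hz
          rcases hz with rfl | rfl <;> assumption
        obtain ⟨u, hut, hu⟩ := Finset.exists_mem_notMem_of_card_lt_card
          (s := {x, y}) (t := t) (by rw [Finset.card_pair hyx.symm, ht3]; norm_num)
        simp only [Finset.mem_insert, Finset.mem_singleton, not_or] at hu
        have hu' := (hiff' u).2 ⟨htR hut, hu.1, hu.2, htI u hut x hxt, htI u hut y hyt⟩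
        have ht : ({u, x, y} : Finset V) = t := by
          apply Finset.eq_of_subset_of_card_le
          · exact Finset.insert_subset hut hsub
          · rw [ht3]
            apply le_of_eq
            symm
            rw [Finset.card_eq_three]
            exact ⟨u, x, y, hu.1, hu.2, hyx.symm, rfl⟩
        rcases hu' with rfl | rfl
        · exact Or.inl ht.symm
        · exact Or.inr ht.symm
      · have aux : ∀ u, (u = a ∨ u = b) → (({u, x, y} : Finset V) ⊆ R ∧ ({u, x, y} : Finset V).card = 3) ∧
            IndSet H {u, x, y} := by
          intro u hu
          obtain ⟨u1, u2, u3, u4, u5⟩ := (hiff' u).1 hu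
          refine ⟨⟨?_, ?_⟩, ?_⟩
          · intro z hz
            simp only [Finset.mem_insert, Finset.mem_singleton] at hz
            rcases hz with rfl | rfl | rfl <;> assumption
          · rw [Finset.card_eq_three]
            exact ⟨u, x, y, u2, u3, hyx.symm, rfl⟩
          · apply (indSet_pair hadj).insert
            simp [u4, u5]
        rintro (rfl | rfl)
        · exact ⟨aux a (Or.inl rfl), by simp, by simp⟩
        · exact ⟨aux b (Or.inr rfl), by simp, by simp⟩
  have hRr : ∀ t ∈ T, (P.bipartiteBelow (fun (p : Σ _ : V, V) t => p.1 ∈ t ∧ p.2 ∈ t) t).card = 6 := by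
    intro t ht
    obtain ⟨⟨htR, ht3⟩, htI⟩ := (hmemT t).1 ht
    have hoff : t.offDiag.card = 6 := by rw [Finset.offDiag_card, ht3]
    rw [← hoff]
    apply Finset.card_bij (fun p _ => (p.1, p.2))
    · rintro ⟨x, y⟩ hp
      rw [Finset.mem_bipartiteBelow, hmemP] at hp
      rw [Finset.mem_offDiag]
      exact ⟨hp.2.1, hp.2.2, hp.1.2.2.1.symm⟩
    · rintro ⟨x, y⟩ _ ⟨x', y'⟩ _ h
      simp only [Prod.mk.injEq] at h
      rw [h.1, h.2]
    · rintro ⟨x, y⟩ hp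
      rw [Finset.mem_offDiag] at hp
      refine ⟨⟨x, y⟩, ?_, rfl⟩
      rw [Finset.mem_bipartiteBelow, hmemP]
      exact ⟨⟨htR hp.1, htR hp.2.1, hp.2.2.symm, htI x hp.1 y hp.2.1⟩, hp.1, hp.2.1⟩
  rw [Finset.sum_congr rfl hL, Finset.sum_congr rfl hRr] at hcount
  simp only [Finset.sum_const, smul_eq_mul, hP] at hcount
  omega

lemma Good.two_regular {H : SimpleGraph V} (hH : Good H) (hV : Fintype.card V = 10)
    {m : ℕ} (hm : ∑ v, H.degree v = 2 * m) (hm2 : m ≤ 10) :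
    m = 10 ∧ ∀ v, H.degree v = 2 := by
  have h2 : ∀ v, 2 ≤ H.degree v := by
    by_contra! hcon
    obtain ⟨v, hv⟩ := hcon
    obtain ⟨w, hw⟩ := hH.exists_adj v
    have hl := leaf_of_deg (by omega) hw
    have hl' := hH.leaf hl
    by_cases hd : ∀ x, x ≠ v → x ≠ w → 2 ≤ H.degree x
    · exact hH.no_one_leaf hV hm hm2 hw hl hl' hd
    · push Not at hd
      obtain ⟨v', h1, h2, h3⟩ := hd
      obtain ⟨w', hw'⟩ := hH.exists_adj v'
      have hk := leaf_of_deg (by omega) hw'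
      exact hH.no_two_leaves hV (by omega) hw hw' hl hl' hk (hH.leaf hk) h1 h2
  have hs : ∑ _v : V, 2 = 20 := by simp [hV]
  have hle : ∑ _v : V, 2 ≤ ∑ v, H.degree v := Finset.sum_le_sum (fun v _ => h2 v)
  refine ⟨by omega, ?_⟩
  intro v
  have := (Finset.sum_eq_sum_iff_of_le (fun v _ => h2 v)).1 (by omega : ∑ _v : V, 2 = ∑ v, H.degree v)
  exact (this v (Finset.mem_univ v)).symm

end graph

section pentagons
variable {V : Type*} [Fintype V]

lemma nbrs_of_deg {H : SimpleGraph V} (hd : ∀ v, H.degree v = 2) {x y z : V} (hy : H.Adj x y)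
    (hz : H.Adj x z) (hyz : y ≠ z) : ∀ u, H.Adj x u ↔ u = y ∨ u = z := by
  have h := hd x
  rw [← H.card_neighborFinset_eq_degree] at h
  have hs : ({y, z} : Finset V) = H.neighborFinset x := by
    apply Finset.eq_of_subset_of_card_le
    · intro u hu
      simp only [Finset.mem_insert, Finset.mem_singleton] at hu
      rcases hu with rfl | rfl <;> simpa
    · rw [h, Finset.card_pair hyz]
  intro u
  rw [← SimpleGraph.mem_neighborFinset, ← hs]
  simp

lemma other_nbr {H : SimpleGraph V} (hd : ∀ v, H.degree v = 2) {x y : V} (hy : H.Adj x y) :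
    ∃ z, H.Adj x z ∧ y ≠ z := by
  have h := hd x
  rw [← H.card_neighborFinset_eq_degree] at h
  obtain ⟨z, hz, hzy⟩ := Finset.exists_mem_ne (by omega : 1 < (H.neighborFinset x).card) y
  exact ⟨z, by simpa using hz, hzy.symm⟩

lemma Good.no_triangle {H : SimpleGraph V} (hH : Good H) (hd : ∀ v, H.degree v = 2) {x y z : V}
    (hxy : H.Adj x y) (hxz : H.Adj x z) (hyz : H.Adj y z) : False := by
  obtain ⟨T, h1, h2, h3⟩ := hH.ext4 (indSet_singleton (H := H) x) (by simp)
  have hxT : x ∈ T := h1 (Finset.mem_singleton_self x)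
  obtain ⟨b, -, -, hun⟩ := hH.flip4 h2 h3 hxT
  have ny := nbrs_of_deg hd hxy.symm hyz hxz.ne
  have nz := nbrs_of_deg hd hxz.symm hyz.symm hxy.ne
  have hyT : y ∉ T := fun h => h2 x hxT y h hxy
  have hzT : z ∉ T := fun h => h2 x hxT z h hxz
  have e1 := hun y hyT (by
    intro u hu hux hadj
    rcases (ny u).1 hadj with h | h
    · exact hux h
    · exact hzT (h ▸ hu))
  have e2 := hun z hzT (by
    intro u hu hux hadj
    rcases (nz u).1 hadj with h | h
    · exact hux h
    · exact hyT (h ▸ hu))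
  exact hyz.ne (e1.trans e2.symm)

lemma Good.no_square {H : SimpleGraph V} (hH : Good H) (hd : ∀ v, H.degree v = 2) {x y z t : V}
    (hxy : H.Adj x y) (hyz : H.Adj y z) (hzt : H.Adj z t) (htx : H.Adj t x) (hxz : x ≠ z)
    (hyt : y ≠ t) : False := by
  have hn : ¬ H.Adj x z := fun h => hH.no_triangle hd hxy h hyz
  obtain ⟨T, h1, h2, h3⟩ := hH.ext4 (indSet_pair hn) (Finset.card_le_two.trans (by norm_num))
  obtain ⟨b, hb, hb2, -⟩ := hH.flip4 h2 h3 (h1 (Finset.mem_insert_self _ _))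
  have hzT : z ∈ T := h1 (by simp)
  rcases (nbrs_of_deg hd hxy htx.symm hyt b).1 hb with rfl | rfl
  · exact hb2 z hzT hxz.symm hyz.symm
  · exact hb2 z hzT hxz.symm hzt

/-- every vertex lies on an induced pentagon component; labelled with step two -/
lemma Good.pentagon {H : SimpleGraph V} (hH : Good H) (hd : ∀ v, H.degree v = 2) (v : V) :
    ∃ f : Fin 5 → V, f 0 = v ∧ Function.Injective f ∧
      ∀ i u, H.Adj (f i) u ↔ u = f (i + 2) ∨ u = f (i + 3) := by
  obtain ⟨x1, h21⟩ := hH.exists_adj v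
  obtain ⟨x3, h23, h13⟩ := other_nbr hd h21
  obtain ⟨x0, h10, h20⟩ := other_nbr hd h21.symm
  obtain ⟨x4, h34, h24⟩ := other_nbr hd h23.symm
  have h03 : x0 ≠ x3 := by rintro rfl; exact hH.no_triangle hd h21 h23 h10
  have h14 : x1 ≠ x4 := by rintro rfl; exact hH.no_triangle hd h21 h23 h34.symm
  have h04 : x0 ≠ x4 := by
    rintro rfl; exact hH.no_square hd h21 h10 h34.symm h23.symm h20 h13
  have n2 := nbrs_of_deg hd h21 h23 h13
  have n1 := nbrs_of_deg hd h21.symm h10 h20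
  have n3 := nbrs_of_deg hd h23.symm h34 h24
  have a20 : ¬ H.Adj v x0 := by
    rw [n2]; rintro (h | h)
    · exact h10.ne h.symm
    · exact h03 h
  have a24 : ¬ H.Adj v x4 := by
    rw [n2]; rintro (h | h)
    · exact h14 h.symm
    · exact h34.ne h.symm
  have a04 : H.Adj x0 x4 := by
    by_contra hn
    have hI : IndSet H {v, x0, x4} := by
      apply (indSet_pair hn).insert
      simp [a20, a24]
    obtain ⟨T, h1, h2, h3⟩ := hH.ext4 hI (Finset.card_le_three.trans (by norm_num))
    obtain ⟨b, hb, hb2, -⟩ := hH.flip4 h2 h3 (h1 (Finset.mem_insert_self _ _))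
    rcases (n2 b).1 hb with rfl | rfl
    · exact hb2 x0 (h1 (by simp)) h20.symm h10.symm
    · exact hb2 x4 (h1 (by simp)) h24.symm h34.symm
  have n0 := nbrs_of_deg hd h10.symm a04 h14
  have n4 := nbrs_of_deg hd h34.symm a04.symm h03.symm
  -- cycle order : v x3 x4 x0 x1
  refine ⟨![v, x4, x1, x3, x0], rfl, ?_, ?_⟩
  · have e1 := h21.ne
    have e2 := h23.ne
    have e3 := h10.ne
    have e4 := h34.ne
    intro i j hij
    fin_cases i <;> fin_cases j <;> simp at hij ⊢ <;> first | exact absurd hij (by assumption) | exact absurd hij.symm (by assumption)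
  · intro i u
    fin_cases i
    · exact n2 u
    · exact (n4 u)
    · exact (n1 u).trans or_comm
    · exact (n3 u)
    · exact (n0 u).trans or_comm

/-- the forbidden pairs in the join of two pentagons -/
def Bad : Fin 5 ⊕ Fin 5 → Fin 5 ⊕ Fin 5 → Prop
  | Sum.inl i, Sum.inl j => j = i + 2 ∨ j = i + 3
  | Sum.inr i, Sum.inr j => j = i + 2 ∨ j = i + 3
  | _, _ => False

lemma Good.classify {H : SimpleGraph V} (hH : Good H) (hV : Fintype.card V = 10)
    (hd : ∀ v, H.degree v = 2) :
    ∃ e : (Fin 5 ⊕ Fin 5) ≃ V, ∀ s t, H.Adj (e s) (e t) ↔ Bad s t := by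
  have hne : Nonempty V := Fintype.card_pos_iff.1 (by omega)
  obtain ⟨f, -, hfi, hf⟩ := hH.pentagon hd (Classical.arbitrary V)
  obtain ⟨v, hv⟩ : ∃ v, v ∉ Set.range f := by
    by_contra! hcon
    have := Fintype.card_le_of_surjective f hcon
    simp [hV] at this
  obtain ⟨g, hg0, hgi, hg⟩ := hH.pentagon hd v
  have step : ∀ i, g i ∈ Set.range f → g (i + 2) ∈ Set.range f := by
    rintro i ⟨j, hj⟩
    have h : H.Adj (g i) (g (i + 2)) := (hg i _).2 (Or.inl rfl)
    rw [← hj, hf] at h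
    rcases h with h | h
    · exact ⟨_, h.symm⟩
    · exact ⟨_, h.symm⟩
  have hg0' : g 0 ∉ Set.range f := by rwa [hg0]
  have hdisj : ∀ i, g i ∉ Set.range f := by
    have h3 : g 3 ∉ Set.range f := fun h => hg0' (step 3 h)
    have h1 : g 1 ∉ Set.range f := fun h => h3 (step 1 h)
    have h4 : g 4 ∉ Set.range f := fun h => h1 (step 4 h)
    have h2 : g 2 ∉ Set.range f := fun h => h4 (step 2 h)
    intro i
    fin_cases i <;> assumption
  have hinj : Function.Injective (Sum.elim f g) := by
    rintro (i | i) (j | j) h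
    · rw [hfi h]
    · exact absurd ⟨i, h⟩ (hdisj j)
    · exact absurd ⟨j, h.symm⟩ (hdisj i)
    · rw [hgi h]
  have hbij : Function.Bijective (Sum.elim f g) := by
    rw [Fintype.bijective_iff_injective_and_card]
    exact ⟨hinj, by simp [hV]⟩
  refine ⟨Equiv.ofBijective _ hbij, ?_⟩
  rintro (i | i) (j | j)
  · simp only [Equiv.ofBijective_apply, Sum.elim_inl, Bad, hf, hfi.eq_iff]
  · simp only [Equiv.ofBijective_apply, Sum.elim_inl, Sum.elim_inr, Bad, hf, iff_false]
    rintro (h | h)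
    · exact hdisj j ⟨_, h.symm⟩
    · exact hdisj j ⟨_, h.symm⟩
  · simp only [Equiv.ofBijective_apply, Sum.elim_inl, Sum.elim_inr, Bad, iff_false]
    intro h
    have h' := h.symm
    rw [hf] at h'
    rcases h' with h | h
    · exact hdisj i ⟨_, h.symm⟩
    · exact hdisj i ⟨_, h.symm⟩
  · simp only [Equiv.ofBijective_apply, Sum.elim_inr, Bad, hg, hgi.eq_iff]

end pentagons

lemma mem_insert_gen {α : Type*} {inst : DecidableEq α} {a b : α} {s : Finset α} :
    a ∈ @insert _ _ (@Finset.instInsert α inst) b s ↔ a = b ∨ a ∈ s := Finset.mem_insert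

lemma mem_image_gen {α β : Type*} {inst : DecidableEq β} {f : α → β} {s : Finset α} {b : β} :
    b ∈ @Finset.image α β inst f s ↔ ∃ a ∈ s, f a = b := Finset.mem_image

lemma pentagon_iff (σ : Finset (Fin 5)) :
    σ ∈ pentagonFaces ↔ ∀ i ∈ σ, ∀ j ∈ σ, ¬ (j = i + 2 ∨ j = i + 3) := by
  unfold pentagonFaces
  change (σ = ∅ ∨ (∃ i : Fin 5, σ = {i}) ∨ ∃ i : Fin 5, σ = {i, i + 1}) ↔ _
  revert σ
  decide

lemma T10_iff (ρ : Finset (Fin 5 ⊕ Fin 5)) :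
    ρ ∈ T10Faces ↔ ∀ s ∈ ρ, ∀ t ∈ ρ, ¬ Bad s t := by
  constructor
  · rintro ⟨σ₁, h1, σ₂, h2, rfl⟩
    rw [pentagon_iff] at h1 h2
    rintro (i | i) hi (j | j) hj
    · simp at hi hj
      exact h1 i hi j hj
    · exact id
    · exact id
    · simp at hi hj
      exact h2 i hi j hj
  · intro h
    refine ⟨Finset.univ.filter (fun i => Sum.inl i ∈ ρ), ?_,
      Finset.univ.filter (fun i => Sum.inr i ∈ ρ), ?_, ?_⟩
    · rw [pentagon_iff]
      intro i hi j hj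
      exact h (Sum.inl i) (by simpa using hi) (Sum.inl j) (by simpa using hj)
    · rw [pentagon_iff]
      intro i hi j hj
      exact h (Sum.inr i) (by simpa using hi) (Sum.inr j) (by simpa using hj)
    · ext (i | i) <;> simp

section assembly
variable {N : ℕ} {K : Geometry.SimplicialComplex ℝ (EuclideanSpace ℝ (Fin N))}

/-- the vertex type -/
abbrev Vert (K : Geometry.SimplicialComplex ℝ (EuclideanSpace ℝ (Fin N))) : Type :=
  {x : EuclideanSpace ℝ (Fin N) // ({x} : Finset (EuclideanSpace ℝ (Fin N))) ∈ abstractFaces K}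

/-- the non-adjacency graph -/
def nonAdj (K : Geometry.SimplicialComplex ℝ (EuclideanSpace ℝ (Fin N))) : SimpleGraph (Vert K) where
  Adj x y := x ≠ y ∧ ({x.1, y.1} : Finset (EuclideanSpace ℝ (Fin N))) ∉ abstractFaces K
  symm := ⟨fun x y h => ⟨h.1.symm, by rw [Finset.pair_comm]; exact h.2⟩⟩
  loopless := ⟨fun x h => h.1 rfl⟩

lemma abs_mem {σ : Finset (EuclideanSpace ℝ (Fin N))} (h : σ.Nonempty) :
    σ ∈ abstractFaces K ↔ σ ∈ K.faces := by
  unfold abstractFaces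
  rw [Set.mem_insert_iff, or_iff_right h.ne_empty]

lemma abs_down {σ τ : Finset (EuclideanSpace ℝ (Fin N))} (h : σ ∈ abstractFaces K) (hτ : τ ⊆ σ) :
    τ ∈ abstractFaces K := by
  rcases τ.eq_empty_or_nonempty with rfl | hne
  · exact Set.mem_insert _ _
  · rw [abs_mem hne]
    rw [abs_mem (hne.mono hτ)] at h
    exact K.down_closed h hτ hne

lemma ind_iff (hflag : IsFlag (abstractFaces K)) (S : Finset (Vert K)) :
    IndSet (nonAdj K) S ↔ S.image Subtype.val ∈ abstractFaces K := by
  constructor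
  · intro h
    apply hflag
    · intro u hu
      obtain ⟨x, hx, rfl⟩ := Finset.mem_image.1 hu
      exact x.2
    · intro u hu w hw huw
      obtain ⟨x, hx, rfl⟩ := Finset.mem_image.1 hu
      obtain ⟨y, hy, rfl⟩ := Finset.mem_image.1 hw
      by_contra hn
      refine h x hx y hy ⟨fun e => huw (congrArg _ e), fun h' => hn ?_⟩
      convert h' using 1
      ext z
      simp only [Finset.mem_insert, Finset.mem_singleton]
  · rintro h x hx y hy ⟨hne, hn⟩
    apply hn
    apply abs_down h
    intro z hz
    simp only [Finset.mem_insert, Finset.mem_singleton] at hz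
    rcases hz with rfl | rfl
    · exact Finset.mem_image_of_mem _ hx
    · exact Finset.mem_image_of_mem _ hy

lemma vert_finite (hfin : K.faces.Finite) : Finite (Vert K) := by
  have : Finite K.faces := hfin
  refine Finite.of_injective (β := K.faces)
    (fun x => ⟨{x.1}, (abs_mem (Finset.singleton_nonempty _)).1 x.2⟩) ?_
  intro x y h
  have := congrArg Subtype.val h
  exact Subtype.ext (Finset.singleton_injective this)

lemma vert_card : Nat.card (Vert K) = fZero (abstractFaces K) := by
  unfold fZero
  rw [← Nat.card_coe_set_eq]
  apply Nat.card_congr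
  refine Equiv.ofBijective (fun x => ⟨{x.1}, x.2, Finset.card_singleton _⟩) ⟨?_, ?_⟩
  · intro x y h
    have := congrArg Subtype.val h
    exact Subtype.ext (Finset.singleton_injective this)
  · rintro ⟨σ, h1, h2⟩
    obtain ⟨x, rfl⟩ := Finset.card_eq_one.1 h2
    exact ⟨⟨x, h1⟩, rfl⟩

lemma edge_count [Fintype (Vert K)] (hcard : Fintype.card (Vert K) = 10) :
    ∑ v, (nonAdj K).degree v + 2 * fOne (abstractFaces K) = 90 := by
  have h1 : fOne (abstractFaces K) = (nonAdj K)ᶜ.edgeFinset.card := by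
    unfold fOne
    rw [← Set.ncard_coe_finset, SimpleGraph.coe_edgeFinset]
    have : {σ ∈ abstractFaces K | σ.card = 2} =
        (fun e : Sym2 (Vert K) => e.toFinset.image Subtype.val) '' (nonAdj K)ᶜ.edgeSet := by
      ext σ
      constructor
      · rintro ⟨hσ, h2⟩
        obtain ⟨x, y, hxy, rfl⟩ := Finset.card_eq_two.1 h2
        have hx : ({x} : Finset (EuclideanSpace ℝ (Fin N))) ∈ abstractFaces K :=
          abs_down hσ (by simp)
        have hy : ({y} : Finset (EuclideanSpace ℝ (Fin N))) ∈ abstractFaces K :=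
          abs_down hσ (by simp)
        refine ⟨s(⟨x, hx⟩, ⟨y, hy⟩), ?_, ?_⟩
        · rw [SimpleGraph.mem_edgeSet, SimpleGraph.compl_adj]
          exact ⟨fun h => hxy (congrArg Subtype.val h), fun h => h.2 hσ⟩
        · ext z; simp [Sym2.mem_toFinset]; aesop
      · rintro ⟨e, he, rfl⟩
        induction e using Sym2.ind with
        | _ x y =>
          rw [SimpleGraph.mem_edgeSet, SimpleGraph.compl_adj] at he
          have himg : (s(x, y).toFinset.image Subtype.val :
              Finset (EuclideanSpace ℝ (Fin N))) = {x.1, y.1} := by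
            ext z; simp [Sym2.mem_toFinset]; aesop
          simp only [himg]
          refine ⟨?_, Finset.card_pair (fun h => he.1 (Subtype.ext h))⟩
          by_contra hn
          exact he.2 ⟨he.1, hn⟩
    rw [this, Set.ncard_image_of_injective]
    intro e e' h
    have h' : e.toFinset = e'.toFinset := Finset.image_injective Subtype.val_injective h
    apply Sym2.ext
    intro z
    rw [← Sym2.mem_toFinset, ← Sym2.mem_toFinset, h']
  have h2 := (nonAdj K)ᶜ.sum_degrees_eq_twice_card_edges
  rw [h1, ← h2, ← Finset.sum_add_distrib]
  have h3 : ∀ v ∈ Finset.univ, (nonAdj K).degree v + (nonAdj K)ᶜ.degree v = 9 := by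
    intro v _
    have hd := (nonAdj K).degree_compl v
    have hl := (nonAdj K).degree_lt_card_verts v
    omega
  rw [Finset.sum_congr rfl h3]
  simp [hcard]

lemma good_nonAdj (htri : IsSphereTriangulation 3 K) (hflag : IsFlag (abstractFaces K))
    [Fintype (Vert K)] (hcard : Fintype.card (Vert K) = 10) : Good (nonAdj K) := by
  obtain ⟨hfin, ⟨Φ⟩⟩ := htri
  have hX := charts_of_homeo Φ
  have hcimg : ∀ S : Finset (Vert K), (S.image Subtype.val).card = S.card := fun S =>
    Finset.card_image_of_injective _ Subtype.val_injective
  have hnotin : ∀ (x : Vert K) (S : Finset (Vert K)), x.1 ∉ S.image Subtype.val ↔ x ∉ S := by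
    intro x S
    rw [not_iff_not, Finset.mem_image]
    exact ⟨fun ⟨y, hy, h⟩ => Subtype.ext h ▸ hy, fun h => ⟨x, h, rfl⟩⟩
  have hins : ∀ (x : Vert K) (S : Finset (Vert K)), IndSet (nonAdj K) S →
      ((∀ y ∈ S, ¬ (nonAdj K).Adj x y) ↔ insert x.1 (S.image Subtype.val) ∈ K.faces) := by
    intro x S hS
    rw [← abs_mem (Finset.insert_nonempty _ _)]
    constructor
    · intro h
      have := (ind_iff hflag _).1 (hS.insert h)
      convert this using 1
      ext z
      rw [Finset.mem_insert, Finset.mem_image, Finset.mem_image]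
      constructor
      · rintro (rfl | ⟨y, hy, rfl⟩)
        · exact ⟨x, mem_insert_gen.2 (Or.inl rfl), rfl⟩
        · exact ⟨y, mem_insert_gen.2 (Or.inr hy), rfl⟩
      · rintro ⟨y, hy, rfl⟩
        rcases mem_insert_gen.1 hy with rfl | hy
        · exact Or.inl rfl
        · exact Or.inr ⟨y, hy, rfl⟩
    · intro h y hy hadj
      apply hadj.2
      apply abs_down h
      intro z hz
      simp only [Finset.mem_insert, Finset.mem_singleton] at hz ⊢
      rcases hz with rfl | rfl
      · exact Or.inl rfl
      · exact Or.inr (Finset.mem_image_of_mem _ hy)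
  have hvert : ∀ τ ∈ K.faces, ∀ b ∈ τ,
      ({b} : Finset (EuclideanSpace ℝ (Fin N))) ∈ abstractFaces K := by
    intro τ hτ b hb
    rw [abs_mem (Finset.singleton_nonempty _)]
    exact K.down_closed hτ (by simpa using hb) (Finset.singleton_nonempty _)
  have hext : ∀ S, IndSet (nonAdj K) S → S.card ≤ 3 →
      ∃ x, x ∉ S ∧ ∀ y ∈ S, ¬ (nonAdj K).Adj x y := by
    intro S hS hc
    rcases S.eq_empty_or_nonempty with rfl | hne
    · obtain ⟨x⟩ : Nonempty (Vert K) := Fintype.card_pos_iff.1 (by omega)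
      exact ⟨x, by simp, by simp⟩
    · have hS0 := hS
      rw [ind_iff hflag, abs_mem (hne.image _)] at hS
      obtain ⟨τ, hτ, hss⟩ := face_extend hfin hX hS (by rw [hcimg]; exact hc)
      obtain ⟨b, hb, hbS⟩ := Finset.exists_of_ssubset hss
      refine ⟨⟨b, hvert τ hτ b hb⟩, (hnotin _ _).1 hbS, (hins _ _ hS0).2 ?_⟩
      exact K.down_closed hτ (Finset.insert_subset hb hss.1) (Finset.insert_nonempty _ _)
  refine Good.of_local hext ?_
  intro ρ hρ hc
  obtain ⟨a, ha, hIa⟩ := hext ρ hρ hc.le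
  have hIa' := (hins _ _ hρ).1 hIa
  have hc' : (ρ.image Subtype.val).card = 3 := by rw [hcimg, hc]
  obtain ⟨τ, hτ, hρτ, hnτ⟩ := not_one hfin hX hc' ((hnotin _ _).2 ha) hIa'
  obtain ⟨b, hb, hbn⟩ := Finset.not_subset.1 hnτ
  rw [Finset.mem_insert, not_or] at hbn
  have hIb' : insert b (ρ.image Subtype.val) ∈ K.faces :=
    K.down_closed hτ (Finset.insert_subset hb hρτ) (Finset.insert_nonempty _ _)
  obtain ⟨b', rfl⟩ : ∃ b' : Vert K, b'.1 = b := ⟨⟨b, hvert τ hτ b hb⟩, rfl⟩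
  have hab : a ≠ b' := fun h => hbn.1 (congrArg _ h.symm)
  have hb' : b' ∉ ρ := (hnotin _ _).1 hbn.2
  have two := fun τ' => at_most_two (τ := τ') hX hc' ((hnotin _ _).2 ha) hbn.2
    (Ne.symm hbn.1) hIa' hIb'
  refine ⟨a, b', hab, ha, hb', hIa, (hins _ _ hρ).2 hIb', ?_, ?_⟩
  · by_contra hn
    have hI : insert a.1 (insert b'.1 (ρ.image Subtype.val)) ∈ K.faces := by
      have h1 := (hins b' ρ hρ).2 hIb'
      have h2 : IndSet (nonAdj K) (insert a (insert b' ρ)) := by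
        intro x hx y hy
        simp only [Finset.mem_insert] at hx hy
        rcases hx with rfl | rfl | hx <;> rcases hy with rfl | rfl | hy
        · exact (nonAdj K).irrefl
        · exact hn
        · exact hIa y hy
        · exact fun h => hn h.symm
        · exact (nonAdj K).irrefl
        · exact h1 y hy
        · exact fun h => hIa x hx h.symm
        · exact fun h => h1 x hx h.symm
        · exact hρ x hx y hy
      rw [ind_iff hflag, Finset.image_insert, Finset.image_insert,
        abs_mem (Finset.insert_nonempty _ _)] at h2
      exact h2
    rcases two _ hI (fun z hz => by simp only [Finset.mem_insert]; exact Or.inr (Or.inr hz)) with h | h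
    · have := h (Finset.mem_insert_of_mem (Finset.mem_insert_self _ _))
      rcases Finset.mem_insert.1 this with h | h
      · exact hbn.1 h
      · exact hbn.2 h
    · have := h (Finset.mem_insert_self _ _)
      rcases Finset.mem_insert.1 this with h | h
      · exact hbn.1 h.symm
      · exact (hnotin _ _).2 ha h
  · intro x hx hIx
    rcases two _ ((hins _ _ hρ).1 hIx) (Finset.subset_insert _ _) with h | h
    · left
      have := h (Finset.mem_insert_self _ _)
      rcases Finset.mem_insert.1 this with h | h
      · exact Subtype.ext h
      · exact absurd h ((hnotin _ _).2 hx)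
    · right
      have := h (Finset.mem_insert_self _ _)
      rcases Finset.mem_insert.1 this with h | h
      · exact Subtype.ext h
      · exact absurd h ((hnotin _ _).2 hx)
end assembly

theorem tenVertex_flag_is_T10 (N : ℕ)
    (K : Geometry.SimplicialComplex ℝ (EuclideanSpace ℝ (Fin N)))
    (htri : IsSphereTriangulation 3 K)
    (hflag : IsFlag (abstractFaces K))
    (h10 : fZero (abstractFaces K) = 10)
    (hpos : 0 < gammaTwo (abstractFaces K)) :
    CombIso (abstractFaces K) T10Faces ∧
      fOne (abstractFaces K) = 35 ∧ gammaTwo (abstractFaces K) = 1 := by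
  have hfinV : Finite (Vert K) := vert_finite htri.1
  have : Fintype (Vert K) := Fintype.ofFinite _
  have hcard : Fintype.card (Vert K) = 10 := by rw [← Nat.card_eq_fintype_card, vert_card, h10]
  have hG := good_nonAdj htri hflag hcard
  have hE := edge_count hcard
  unfold gammaTwo at hpos ⊢
  rw [h10] at hpos ⊢
  obtain ⟨hm, hd⟩ := hG.two_regular hcard (m := 45 - fOne (abstractFaces K)) (by omega) (by omega)
  have h35 : fOne (abstractFaces K) = 35 := by omega
  refine ⟨?_, h35, by rw [h35]; norm_num⟩
  obtain ⟨e, he⟩ := hG.classify hcard hd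
  have hsing : ∀ y : Fin 5 ⊕ Fin 5, ({y} : Finset (Fin 5 ⊕ Fin 5)) ∈ T10Faces := by
    intro y
    rw [T10_iff]
    intro s hs t ht
    simp only [Finset.mem_singleton] at hs ht
    subst hs; subst ht
    rw [← he]
    exact (nonAdj K).irrefl
  refine ⟨e.symm.trans (Equiv.subtypeUnivEquiv hsing).symm, ?_⟩
  intro σ
  have hσ : σ.image Subtype.val ∈ abstractFaces K ↔ IndSet (nonAdj K) σ := (ind_iff hflag σ).symm
  rw [T10_iff]
  refine Iff.trans ?_ (hσ.trans ?_)
  · apply iff_of_eq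
    congr 1
    ext z
    simp only [Finset.mem_image]
  constructor
  · intro h s hs t ht
    obtain ⟨x, hx, rfl⟩ := mem_image_gen.1 hs
    obtain ⟨y, hy, rfl⟩ := mem_image_gen.1 ht
    rw [← he]
    simpa using h x hx y hy
  · intro h x hx y hy
    have := h (e.symm x) (mem_image_gen.2 ⟨x, hx, rfl⟩) (e.symm y) (mem_image_gen.2 ⟨y, hy, rfl⟩)
    rw [← he] at this
    simpa using this
end
end
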